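/- There exists a constant c = c(r) ∈ ℕ depending only on r such that whenever p > c, the 𝔩-adic Galois representations of φ are all surjective; concretely: for every nonzero prime ideal 𝔩 of A and every integer n ≥ 1, every A/𝔩^n-module automorphism of φ[𝔩^n] is the restriction of some σ ∈ Gal(F̄/F). (Equivalently, ρ_{φ,𝔩} : Gal(F^sep/F) → GL_r(A_𝔩) is surjective for every nonzero prime 𝔩, where A_𝔩 is the 𝔩-adic completion of A.) -/

import Mathlib

open Polynomial

noncomputable section

/-- `F̄`: a fixed algebraic closure of `F = 𝔽_q(T)`. -/
abbrev Kbar (Fq : Type) [Field Fq] := AlgebraicClosure (RatFunc Fq)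

/-- `φ` is (encodes) the rank-`r` Drinfeld `𝔽_q[T]`-module over `𝔽_q(T)` given by
`φ_T = T + τ^{r-1} + T^{q-1} τ^r`: it is a ring homomorphism from `A = 𝔽_q[T]` to the
additive endomorphisms of `F̄` which is `𝔽_q`-linear (the condition on `C c`) and sends
`T` to `x ↦ T·x + x^{q^{r-1}} + T^{q-1}·x^{q^r}`. -/
def IsDrinfeldPhi (Fq : Type) [Field Fq] (q r : ℕ)
    (φ : Polynomial Fq →+* AddMonoid.End (Kbar Fq)) : Prop :=
  (∀ (c : Fq) (x : Kbar Fq),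
      φ (C c) x = algebraMap (RatFunc Fq) (Kbar Fq) (RatFunc.C c) * x) ∧
  (∀ x : Kbar Fq, φ X x =
      algebraMap (RatFunc Fq) (Kbar Fq) RatFunc.X * x + x ^ q ^ (r - 1) +
        algebraMap (RatFunc Fq) (Kbar Fq) RatFunc.X ^ (q - 1) * x ^ q ^ r)

/-- The `a`-torsion `φ[a] ⊆ F̄`. -/
def phiTorsion (Fq : Type) [Field Fq] (φ : Polynomial Fq →+* AddMonoid.End (Kbar Fq))
    (a : Polynomial Fq) : Set (Kbar Fq) := {x | φ a x = 0}

/-- `g` is an `A/(a)`-module automorphism of `φ[a]`: a bijection of `φ[a]` with itself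
which is additive and commutes with the `A`-action through `φ`. -/
def IsTorsionAut (Fq : Type) [Field Fq] (φ : Polynomial Fq →+* AddMonoid.End (Kbar Fq))
    (a : Polynomial Fq) (g : Kbar Fq → Kbar Fq) : Prop :=
  Set.BijOn g (phiTorsion Fq φ a) (phiTorsion Fq φ a) ∧
  (∀ x ∈ phiTorsion Fq φ a, ∀ y ∈ phiTorsion Fq φ a, g (x + y) = g x + g y) ∧
  (∀ b : Polynomial Fq, ∀ x ∈ phiTorsion Fq φ a, g (φ b x) = φ b (g x))

section MatrixGeneration

open Matrix

variable {ι k : Type*} [Fintype ι] [DecidableEq ι] [Field k]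

lemma transvection_mulVec_apply {R : Type*} [CommRing R] (i j : ι) (c : R) (v : ι → R) (m : ι) :
    (transvection i j c *ᵥ v) m = v m + if m = i then c * v j else 0 := by
  simp only [transvection, add_mulVec, one_mulVec, single_mulVec_eq, Pi.add_apply,
    Pi.smul_apply, smul_eq_mul]
  split_ifs with h
  · subst h; simp
  · simp [h]

/-- A diagonal matrix with entries `a`, `a⁻¹` is a product of six transvections. -/
lemma diag2n_eq_transvections {i j : ι} (hij : i ≠ j) (a : k) (ha : a ≠ 0) :
    (diagonal (fun m ↦ if m = i then a else if m = j then a⁻¹ else 1) : Matrix ι ι k) =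
      transvection i j a * transvection j i (-a⁻¹) * transvection i j a *
        transvection i j (-1) * transvection j i 1 * transvection i j (-1) := by
  apply Matrix.mulVec_injective
  funext v m
  simp only [← mulVec_mulVec, transvection_mulVec_apply, mulVec_diagonal, hij, hij.symm, if_true,
    if_false]
  by_cases h1 : m = i
  · subst h1
    simp [hij]
    field_simp
    ring
  · by_cases h2 : m = j
    · subst h2
      simp [h1]
      field_simp
      ring
    · simp [h1, h2]

lemma mem_of_transvection_mem [Nontrivial ι] (N : Submonoid (Matrix ι ι k))
    (hN : ∀ i j : ι, i ≠ j → ∀ c : k, transvection i j c ∈ N)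
    (A : Matrix ι ι k) (hA : A.det = 1) : A ∈ N := by
  refine SpecialLinearGroup.diagonal_transvection_induction' (fun B ↦ (B : Matrix ι ι k) ∈ N)
    ⟨A, hA⟩ (fun i j hij c hc ↦ ?_) (fun i j hij c ↦ hN i j hij c)
    (fun A B hA hB ↦ N.mul_mem hA hB)
  rw [SpecialLinearGroup.diag2n_coe, diag2n_eq_transvections hij c hc]
  have := hN i j hij
  have := hN j i hij.symm
  refine N.mul_mem (N.mul_mem (N.mul_mem (N.mul_mem (N.mul_mem ?_ ?_) ?_) ?_) ?_) ?_ <;>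
    solve_by_elim

/-- An irreducible subgroup of `GL` with surjective determinant which contains all the
transvections with a given hyperplane is everything. -/
theorem eq_top_of_irreducible_of_transvections [Nontrivial ι] (G : Subgroup (GL ι k))
    (hirr : ∀ W : Submodule k (ι → k), (∀ g ∈ G, ∀ w ∈ W, g.1 *ᵥ w ∈ W) → W = ⊥ ∨ W = ⊤)
    (f₀ : ι → k) (hf₀ : f₀ ≠ 0)
    (htv : ∀ h : ι → k, f₀ ⬝ᵥ h = 0 → ∃ g ∈ G, g.1 = 1 + vecMulVec h f₀)
    (hdet : ∀ u : kˣ, ∃ g ∈ G, g.1.det = u) : G = ⊤ := by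
  let N : Submonoid (Matrix ι ι k) := G.toSubmonoid.map (Units.coeHom _)
  have hN : ∀ A, A ∈ N ↔ ∃ g ∈ G, g.1 = A := fun A ↦ by
    simp [N, Submonoid.mem_map]
  have hconj : ∀ g ∈ G, ∀ A ∈ N, g.1 * A * g⁻¹.1 ∈ N := by
    intro g hg A hA
    obtain ⟨a, ha, rfl⟩ := (hN A).1 hA
    exact (hN _).2 ⟨g * a * g⁻¹, G.mul_mem (G.mul_mem hg ha) (G.inv_mem hg), by simp⟩
  have htmul : ∀ (g : GL ι k) (h f : ι → k), g.1 * (1 + vecMulVec h f) * g⁻¹.1 =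
      1 + vecMulVec (g.1 *ᵥ h) (f ᵥ* g⁻¹.1) := by
    intro g h f
    rw [mul_add, add_mul, mul_one, mul_vecMulVec, vecMulVec_mul]
    congr 1
    exact g.mul_inv
  have hinv : ∀ (g : GL ι k) (f : ι → k), (f ᵥ* g.1) ᵥ* g⁻¹.1 = f := by
    intro g f
    rw [vecMul_vecMul]
    have : g.1 * g⁻¹.1 = 1 := g.mul_inv
    rw [this, vecMul_one]
  have hinv' : ∀ (g : GL ι k) (f : ι → k), (f ᵥ* g⁻¹.1) ᵥ* g.1 = f := by
    intro g f
    rw [vecMul_vecMul]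
    have : g⁻¹.1 * g.1 = 1 := g.inv_mul
    rw [this, vecMul_one]
  have hstab : ∀ g ∈ G, ∀ f : ι → k, (∀ h : ι → k, f ⬝ᵥ h = 0 → 1 + vecMulVec h f ∈ N) →
      ∀ h : ι → k, (f ᵥ* g⁻¹.1) ⬝ᵥ h = 0 → 1 + vecMulVec h (f ᵥ* g⁻¹.1) ∈ N := by
    intro g hg f hf h hh
    rw [← dotProduct_mulVec] at hh
    have := hconj g hg _ (hf _ hh)
    rw [htmul, mulVec_mulVec] at this
    have h1 : g.1 * g⁻¹.1 = 1 := g.mul_inv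
    rwa [h1, one_mulVec] at this
  let Ω : Submodule k (ι → k) :=
    { carrier := {f | ∀ h : ι → k, f ⬝ᵥ h = 0 → 1 + vecMulVec h f ∈ N}
      zero_mem' := fun h _ ↦ by simp
      smul_mem' := by
        intro c f hf h hh
        by_cases hc : c = 0
        · subst hc; simp
        · have : f ⬝ᵥ (c • h) = 0 := by simpa [smul_dotProduct] using hh
          simpa [vecMulVec_smul, smul_vecMulVec] using hf _ this
      add_mem' := by
        intro f1 f2 h1 h2
        by_cases hdep : ∃ u : ι → k, f2 ⬝ᵥ u = 0 ∧ f1 ⬝ᵥ u = 1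
        · obtain ⟨u, hu2, hu1⟩ := hdep
          obtain ⟨g, hg, hgu⟩ := (hN _).1 (h2 u hu2)
          have key := hstab g⁻¹ (G.inv_mem hg) f1 h1
          have : f1 ᵥ* g⁻¹⁻¹.1 = f1 + f2 := by
            rw [inv_inv, hgu, vecMul_add, vecMul_one, vecMul_vecMulVec, hu1, one_smul]
          rwa [this] at key
        · push Not at hdep
          by_cases hf2 : f2 = 0
          · simpa [hf2] using h1
          obtain ⟨i, hi⟩ : ∃ i, f2 i ≠ 0 := by
            by_contra! hcon
            exact hf2 (funext hcon)
          have hprop : f1 = (f1 i / f2 i) • f2 := by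
            funext j
            by_contra hne
            set d := f1 j - f1 i / f2 i * f2 j with hd
            have hd0 : d ≠ 0 := sub_ne_zero.2 (by simpa using hne)
            refine hdep (d⁻¹ • (Pi.single j 1 - (f2 j / f2 i) • Pi.single i 1)) ?_ ?_
            · simp [dotProduct_sub]
              right; field_simp; ring
            · simp [dotProduct_sub]
              rw [inv_mul_eq_one₀ hd0, hd]
              ring
          intro h hh
          have : f1 + f2 = (f1 i / f2 i + 1) • f2 := by rw [add_smul, one_smul, ← hprop]
          rw [this] at hh ⊢
          by_cases hc : f1 i / f2 i + 1 = 0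
          · rw [hc]; simp
          · have : f2 ⬝ᵥ ((f1 i / f2 i + 1) • h) = 0 := by
              simpa [smul_dotProduct] using hh
            simpa only [vecMulVec_smul, smul_vecMulVec] using h2 _ this }
  have hΩ : ∀ f, f ∈ Ω ↔ ∀ h : ι → k, f ⬝ᵥ h = 0 → 1 + vecMulVec h f ∈ N := fun f ↦ Iff.rfl
  have hf₀Ω : f₀ ∈ Ω := fun h hh ↦ (hN _).2 (htv h hh)
  let W : Submodule k (ι → k) :=
    { carrier := {w | ∀ f ∈ Ω, f ⬝ᵥ w = 0}
      zero_mem' := by simp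
      add_mem' := fun {a b} ha hb f hf ↦ by rw [dotProduct_add, ha f hf, hb f hf, add_zero]
      smul_mem' := fun c a ha f hf ↦ by rw [dotProduct_smul, ha f hf, smul_zero] }
  have hWbot : W = ⊥ := by
    refine (hirr W ?_).resolve_right ?_
    · intro g hg w hw f hf
      rw [dotProduct_mulVec]
      apply hw
      have := hstab g⁻¹ (G.inv_mem hg) f hf
      rwa [inv_inv] at this
    · intro htop
      obtain ⟨i, hi⟩ : ∃ i, f₀ i ≠ 0 := by
        by_contra! hcon
        exact hf₀ (funext hcon)
      have : (Pi.single i 1 : ι → k) ∈ W := htop ▸ Submodule.mem_top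
      exact hi (by simpa using this f₀ hf₀Ω)
  have hΩtop : Ω = ⊤ := by
    by_contra hne
    obtain ⟨ψ, hψ, hψΩ⟩ := Submodule.exists_le_ker_of_lt_top Ω (lt_top_iff_ne_top.2 hne)
    let w : ι → k := fun i ↦ ψ (Pi.single i 1)
    have hw : ∀ f : ι → k, ψ f = f ⬝ᵥ w := by
      intro f
      conv_lhs => rw [pi_eq_sum_univ' f]
      simp only [map_sum, map_smul, dotProduct, w, smul_eq_mul]
    have hwW : w ∈ W := fun f hf ↦ by rw [← hw]; exact hψΩ hf
    rw [hWbot, Submodule.mem_bot] at hwW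
    exact hψ (LinearMap.ext fun f ↦ by rw [hw, hwW]; simp)
  have hel : ∀ i j : ι, i ≠ j → ∀ c : k, transvection i j c ∈ N := by
    intro i j hij c
    have := (hΩ (Pi.single j 1)).1 (hΩtop ▸ Submodule.mem_top) (c • Pi.single i 1)
      (by simp [hij.symm])
    rwa [smul_vecMulVec, ← single_eq_single_vecMulVec_single, smul_single, smul_eq_mul,
      mul_one] at this
  rw [eq_top_iff]
  intro g _
  obtain ⟨d, hd, hdg⟩ := hdet (GeneralLinearGroup.det g)
  have : (g * d⁻¹).1 ∈ N := by
    refine mem_of_transvection_mem N hel _ ?_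
    change (g.1 * d⁻¹.1).det = 1
    have h1 : d.1 * d⁻¹.1 = 1 := d.mul_inv
    rw [det_mul, ← GeneralLinearGroup.val_det_apply g, ← hdg, ← det_mul, h1, det_one]
  obtain ⟨a, ha, hag⟩ := (hN _).1 this
  have : g = a * d := by rw [Units.ext hag]; group
  exact this ▸ G.mul_mem ha hd

end MatrixGeneration

section MatrixLift

open Matrix

variable {ι k : Type*} [Fintype ι] [DecidableEq ι]

/-- Over a field of characteristic not two, an additive group of matrices which is stable under
conjugation by transvections and contains a non-scalar matrix contains all matrices of trace
zero. -/
lemma mem_of_trace_eq_zero [Field k] (h2 : (2 : k) ≠ 0) (hι : 3 ≤ Fintype.card ι)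
    (K : AddSubgroup (Matrix ι ι k))
    (hK : ∀ X ∈ K, ∀ i j : ι, i ≠ j → ∀ c : k,
      transvection i j c * X * transvection i j (-c) ∈ K)
    (X₀ : Matrix ι ι k) (hX₀ : X₀ ∈ K) (hns : ∀ c : k, X₀ ≠ scalar ι c)
    (X : Matrix ι ι k) (hX : X.trace = 0) : X ∈ K := by
  have hexp : ∀ (X : Matrix ι ι k) (i j : ι) (c : k),
      transvection i j c * X * transvection i j (-c) - X =
        single i j c * X - X * single i j c - single i j (c * c * X j i) := by
    intro X i j c
    simp only [transvection, add_mul, mul_add, one_mul, mul_one]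
    rw [show single i j (-c) = - single i j c from (single_neg _ _ _).symm, mul_neg, mul_neg,
      single_mul_mul_single]
    rw [show c * X j i * c = c * c * X j i by ring]
    abel
  have hd : ∀ X ∈ K, ∀ i j : ι, i ≠ j → ∀ c : k,
      single i j c * X - X * single i j c - single i j (c * c * X j i) ∈ K := by
    intro X hX i j hij c
    rw [← hexp]
    exact K.sub_mem (hK X hX i j hij c) hX
  have hE : ∀ i j : ι, i ≠ j → ∀ X ∈ K, X j i ≠ 0 → ∀ c : k, single i j c ∈ K := by
    intro i j hij X hX hji c
    have hsq : ∀ u : k, single i j (2 * (u * u * X j i)) ∈ K := by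
      intro u
      have h := K.add_mem (hd X hX i j hij u) (hd X hX i j hij (-u))
      have : single i j (2 * (u * u * X j i)) =
          -(single i j u * X - X * single i j u - single i j (u * u * X j i) +
          (single i j (-u) * X - X * single i j (-u) - single i j (-u * -u * X j i))) := by
        rw [show single i j (-u) = - single i j u from (single_neg _ _ _).symm, two_mul, single_add,
          mul_neg, neg_mul, neg_mul_neg]
        abel
      rw [this]
      exact K.neg_mem h
    have := K.sub_mem (hsq ((c / (2 * X j i) + 1) / 2)) (hsq ((c / (2 * X j i) - 1) / 2))
    rw [sub_eq_add_neg, single_neg, ← single_add] at this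
    have hc : c = 2 * ((c / (2 * X j i) + 1) / 2 * ((c / (2 * X j i) + 1) / 2) * X j i) +
        -(2 * ((c / (2 * X j i) - 1) / 2 * ((c / (2 * X j i) - 1) / 2) * X j i)) := by
      field_simp
      ring
    rwa [← hc] at this
  have hex : ∀ a b : ι, ∃ m : ι, m ≠ a ∧ m ≠ b := by
    intro a b
    by_contra! hcon
    have : (Finset.univ : Finset ι) ⊆ {a, b} := fun m _ ↦ by
      by_cases h : m = a
      · simp [h]
      · simp [hcon m h]
    have := (Finset.card_le_card this).trans Finset.card_le_two
    rw [Finset.card_univ] at this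
    omega
  have hoff : ∃ i j : ι, i ≠ j ∧ ∃ X ∈ K, X j i ≠ 0 := by
    by_contra! hcon
    obtain ⟨i₀⟩ : Nonempty ι := Fintype.card_pos_iff.1 (by omega)
    obtain ⟨i, hi⟩ : ∃ i, X₀ i i ≠ X₀ i₀ i₀ := by
      by_contra! hall
      apply hns (X₀ i₀ i₀)
      ext a b
      by_cases hab : a = b
      · subst hab; simp [hall a]
      · simp [hab, hcon b a (Ne.symm hab) X₀ hX₀]
    have hne : i ≠ i₀ := fun h ↦ hi (by rw [h])
    have h1 := hcon i₀ i hne.symm _ (hd X₀ hX₀ i i₀ hne 1)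
    have h0 := hcon i i₀ hne X₀ hX₀
    simp [h0] at h1
    exact hi (by linear_combination -h1)
  obtain ⟨i, j, hij, X1, hX1, hX1ij⟩ := hoff
  have hP1 : ∀ c, single i j c ∈ K := hE i j hij X1 hX1 hX1ij
  have step1 : ∀ i j m : ι, i ≠ j → m ≠ j → (∀ c : k, single i j c ∈ K) →
      ∀ c : k, single m j c ∈ K := by
    intro i j m hij hmj h c
    by_cases hmi : m = i
    · subst hmi; exact h c
    have := hd _ (h c) m i hmi 1
    simpa [hij.symm, hmj.symm, single_mul_single_of_ne, single_apply, hmi] using this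
  have step2 : ∀ i j m : ι, i ≠ j → m ≠ i → (∀ c : k, single i j c ∈ K) →
      ∀ c : k, single i m c ∈ K := by
    intro i j m hij hmi h c
    by_cases hmj : m = j
    · subst hmj; exact h c
    have := hd _ (h (-c)) j m (Ne.symm hmj) 1
    simpa [hij.symm, hmi.symm, hmi, single_mul_single_of_ne, single_apply, ← single_neg] using this
  have hall : ∀ a b : ι, a ≠ b → ∀ c : k, single a b c ∈ K := by
    intro a b hab
    by_cases ha : a = j
    · subst ha
      obtain ⟨m, hm1, hm2⟩ := hex i a
      have h1 := step2 i a m hij hm1 hP1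
      have h2 := step1 i m a hm1.symm hm2.symm h1
      exact step2 a m b hm2.symm hab.symm h2
    · exact step2 a j b ha hab.symm (step1 i j a hij ha hP1)
  have hdiag : ∀ a b : ι, a ≠ b → ∀ c : k, single a a c - single b b c ∈ K := by
    intro a b hab c
    have h1 := hd _ (hall b a hab.symm c) a b hab 1
    have h2 := K.add_mem h1 (hall a b hab c)
    simpa using h2
  obtain ⟨i₀⟩ : Nonempty ι := ⟨i⟩
  have hXeq : X = ∑ a, ∑ b, (if a = b then single a a (X a a) - single i₀ i₀ (X a a)
      else single a b (X a b)) := by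
    have h1 : ∀ a b : ι, (if a = b then single a a (X a a) - single i₀ i₀ (X a a)
      else single a b (X a b)) = single a b (X a b) -
        (if a = b then single i₀ i₀ (X a a) else 0) := by
      intro a b
      split_ifs with h
      · subst h; rfl
      · simp
    simp only [h1, Finset.sum_sub_distrib, Finset.sum_ite_eq, Finset.mem_univ, if_true]
    rw [← matrix_eq_sum_single X]
    have : ∑ a, single i₀ i₀ (X a a) = single i₀ i₀ X.trace := by
      ext u v
      simp only [Matrix.sum_apply, trace, diag, single_apply]
      split_ifs <;> simp
    rw [this, hX]
    simp
  rw [hXeq]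
  refine K.sum_mem fun a _ ↦ K.sum_mem fun b _ ↦ ?_
  split_ifs with h
  · by_cases hi : a = i₀
    · subst hi; simp
    · exact hdiag a i₀ hi _
  · exact hall a b h _

end MatrixLift

section MatrixLift

open Matrix

variable {ι k S : Type*} [Fintype ι] [DecidableEq ι]

/-- The transvection `1 + c E_{ij}` as an element of `GL`. -/
def glTransvection {R : Type*} [CommRing R] {i j : ι} (hij : i ≠ j) (c : R) : GL ι R where
  val := transvection i j c
  inv := transvection i j (-c)
  val_inv := by rw [transvection_mul_transvection_same _ _ hij]; simp
  inv_val := by rw [transvection_mul_transvection_same _ _ hij]; simp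

/-- The leading coefficients `X` of the elements `1 + ϖ ^ m X` of `H`. -/
def congruenceLayer [Field k] [CommRing S] (π : S →+* k) {ϖ : S} (hϖ : π ϖ = 0)
    (H : Subgroup (GL ι S)) (m : ℕ) (hm : 1 ≤ m) : AddSubgroup (Matrix ι ι k) where
  carrier := {X | ∃ g ∈ H, ∃ Y : Matrix ι ι S, g.1 = 1 + ϖ ^ m • Y ∧ Y.map π = X}
  zero_mem' := ⟨1, H.one_mem, 0, by simp, by ext; simp⟩
  add_mem' := by
    rintro _ _ ⟨g, hg, Y, hY, rfl⟩ ⟨g', hg', Y', hY', rfl⟩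
    refine ⟨g * g', H.mul_mem hg hg', Y + Y' + ϖ ^ m • (Y * Y'), ?_, ?_⟩
    · rw [Units.val_mul, hY, hY']
      simp only [mul_add, add_mul, one_mul, mul_one, smul_add, smul_mul_assoc, mul_smul_comm]
      abel
    · ext a b
      simp [hϖ, zero_pow (show m ≠ 0 by omega)]
  neg_mem' := by
    rintro _ ⟨g, hg, Y, hY, rfl⟩
    have hinv : g.1 * g⁻¹.1 = 1 := g.mul_inv
    have h1 : g⁻¹.1 = 1 - ϖ ^ m • (Y * g⁻¹.1) := by
      rw [hY, add_mul, one_mul, smul_mul_assoc] at hinv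
      rw [← hinv]; abel
    refine ⟨g⁻¹, H.inv_mem hg, -(Y * g⁻¹.1), ?_, ?_⟩
    · rw [smul_neg, ← sub_eq_add_neg, ← h1]
    · have h2 : (g⁻¹.1).map π = 1 := by
        rw [h1]
        ext a b
        simp [hϖ, zero_pow (show m ≠ 0 by omega), one_apply, apply_ite π]
      change π.mapMatrix (-(Y * g⁻¹.1)) = _
      rw [map_neg, map_mul, RingHom.mapMatrix_apply, RingHom.mapMatrix_apply, h2, mul_one]

section

variable [Field k] [CommRing S] (π : S →+* k) {ϖ : S} (hϖ : π ϖ = 0)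

lemma conj_mem_congruenceLayer {H : Subgroup (GL ι S)} {m : ℕ} (hm : 1 ≤ m) {X : Matrix ι ι k}
    (hX : X ∈ congruenceLayer π hϖ H m hm) {h : GL ι S} (hh : h ∈ H) :
    h.1.map π * X * h⁻¹.1.map π ∈ congruenceLayer π hϖ H m hm := by
  obtain ⟨g, hg, Y, hY, rfl⟩ := hX
  refine ⟨h * g * h⁻¹, H.mul_mem (H.mul_mem hh hg) (H.inv_mem hh), h.1 * Y * h⁻¹.1, ?_, ?_⟩
  · rw [Units.val_mul, Units.val_mul, hY, mul_add, add_mul, mul_one, mul_smul_comm, smul_mul_assoc,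
      h.mul_inv]
  · exact (map_mul π.mapMatrix (h.1 * Y) h⁻¹.1).trans
      (by rw [map_mul]; rfl)

/-- The commutator of two elements of congruence layers. -/
lemma lie_mem_congruenceLayer {H H' H'' : Subgroup (GL ι S)} {m m' : ℕ} (hm : 1 ≤ m)
    (hm' : 1 ≤ m') (hH : ∀ g ∈ H, ∀ g' ∈ H', g * g' * g⁻¹ * g'⁻¹ ∈ H'')
    {X X' : Matrix ι ι k} (hX : X ∈ congruenceLayer π hϖ H m hm)
    (hX' : X' ∈ congruenceLayer π hϖ H' m' hm') :
    X * X' - X' * X ∈ congruenceLayer π hϖ H'' (m + m') (by omega) := by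
  obtain ⟨g, hg, Y, hY, rfl⟩ := hX
  obtain ⟨g', hg', Y', hY', rfl⟩ := hX'
  have hcomm : g.1 * g'.1 = g'.1 * g.1 + ϖ ^ (m + m') • (Y * Y' - Y' * Y) := by
    rw [hY, hY', pow_add]
    simp only [mul_add, add_mul, one_mul, mul_one, smul_mul_assoc, mul_smul_comm, smul_sub,
      smul_add, smul_smul, mul_comm (ϖ ^ m') (ϖ ^ m)]
    abel
  have hinv : g'.1 * g.1 * g⁻¹.1 * g'⁻¹.1 = 1 := by
    rw [mul_assoc g'.1, show g.1 * g⁻¹.1 = 1 from g.mul_inv, mul_one]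
    exact g'.mul_inv
  have hone : ∀ (g : GL ι S) (Y : Matrix ι ι S) (m : ℕ), 1 ≤ m → g.1 = 1 + ϖ ^ m • Y →
      g⁻¹.1.map π = 1 := by
    intro g Y m hm hY
    have h1 : π.mapMatrix g.1 = 1 := by
      rw [hY]
      ext a b
      simp [hϖ, zero_pow (show m ≠ 0 by omega), one_apply, apply_ite π]
    have h2 : π.mapMatrix g.1 * π.mapMatrix g⁻¹.1 = 1 := by
      rw [← map_mul, show g.1 * g⁻¹.1 = 1 from g.mul_inv, map_one]
    rwa [h1, one_mul] at h2
  refine ⟨g * g' * g⁻¹ * g'⁻¹, hH g hg g' hg', (Y * Y' - Y' * Y) * g⁻¹.1 * g'⁻¹.1, ?_, ?_⟩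
  · rw [Units.val_mul, Units.val_mul, Units.val_mul, hcomm, add_mul, add_mul, hinv,
      smul_mul_assoc, smul_mul_assoc]
  · change π.mapMatrix _ = _
    rw [map_mul, map_mul, RingHom.mapMatrix_apply π g⁻¹.1, RingHom.mapMatrix_apply π g'⁻¹.1,
      hone g Y m hm hY, hone g' Y' m' hm' hY', mul_one, mul_one, map_sub, map_mul, map_mul]
    rfl

end

lemma exists_det_one_lift [Field k] [CommRing S] (π : S →+* k) (hι : 3 ≤ Fintype.card ι)
    (G : Subgroup (GL ι S)) (hG : ∀ g : GL ι k, ∃ g' ∈ G, g'.1.map π = g.1)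
    (A : Matrix ι ι k) (hA : A.det = 1) : ∃ g ∈ G, g.1.det = 1 ∧ g.1.map π = A := by
  have : Nontrivial ι := Fintype.one_lt_card_iff_nontrivial.1 (by omega)
  let N : Submonoid (Matrix ι ι k) :=
    { carrier := {A | ∃ g ∈ G, g.1.det = 1 ∧ g.1.map π = A}
      one_mem' := ⟨1, G.one_mem, by simp, by simp⟩
      mul_mem' := by
        rintro _ _ ⟨g, hg, h1, rfl⟩ ⟨g', hg', h1', rfl⟩
        refine ⟨g * g', G.mul_mem hg hg', by simp [h1, h1'], ?_⟩
        exact map_mul π.mapMatrix g.1 g'.1 }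
  refine mem_of_transvection_mem N (fun i j hij c ↦ ?_) A hA
  obtain ⟨m, hmi, hmj⟩ : ∃ m : ι, m ≠ i ∧ m ≠ j := by
    by_contra! hcon
    have : (Finset.univ : Finset ι) ⊆ {i, j} := fun m _ ↦ by
      by_cases h : m = i
      · simp [h]
      · simp [hcon m h]
    have := (Finset.card_le_card this).trans Finset.card_le_two
    rw [Finset.card_univ] at this
    omega
  obtain ⟨a, ha, haπ⟩ := hG (glTransvection hmi.symm c)
  obtain ⟨b, hb, hbπ⟩ := hG (glTransvection hmj (1 : k))
  have hinv : ∀ (a : GL ι S) (t : GL ι k), a.1.map π = t.1 → a⁻¹.1.map π = t⁻¹.1 := by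
    intro a t hat
    have h2 : π.mapMatrix a.1 * π.mapMatrix a⁻¹.1 = 1 := by
      rw [← map_mul, show a.1 * a⁻¹.1 = 1 from a.mul_inv, map_one]
    rw [RingHom.mapMatrix_apply, RingHom.mapMatrix_apply, hat] at h2
    have h3 : t⁻¹.1 * t.1 = 1 := t.inv_mul
    calc _ = t⁻¹.1 * (t.1 * a⁻¹.1.map π) := by rw [← mul_assoc, h3, one_mul]
      _ = _ := by rw [h2, mul_one]
  refine ⟨a * b * a⁻¹ * b⁻¹, G.mul_mem (G.mul_mem (G.mul_mem ha hb) (G.inv_mem ha))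
    (G.inv_mem hb), ?_, ?_⟩
  · rw [← GeneralLinearGroup.val_det_apply]
    simp [mul_assoc]
  · change π.mapMatrix (a.1 * b.1 * a⁻¹.1 * b⁻¹.1) = _
    simp only [map_mul, RingHom.mapMatrix_apply]
    rw [haπ, hbπ, hinv _ _ haπ, hinv _ _ hbπ]
    apply Matrix.mulVec_injective
    funext v p
    change ((transvection i m c * transvection m j 1 * transvection i m (-c) *
      transvection m j (-1)) *ᵥ v) p = _
    simp only [← mulVec_mulVec, transvection_mulVec_apply, hmi, hmj.symm, hij.symm, if_false,
      if_true]
    split_ifs <;> ring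

/-- A subgroup of `GL` over a local ring with principal nilpotent maximal ideal `(ϖ)` which
surjects onto `GL` of the residue field, contains an element `1 + ϖ X` with `X` not scalar modulo
`ϖ`, and has surjective determinant, is everything. -/
theorem eq_top_of_residual_surjective [Field k] [CommRing S] (π : S →+* k)
    (hπ : Function.Surjective π) {ϖ : S} (hker : ∀ x, π x = 0 ↔ ϖ ∣ x) {n : ℕ} (hn : ϖ ^ n = 0)
    (h2 : (2 : k) ≠ 0) (hι : 3 ≤ Fintype.card ι)
    (G : Subgroup (GL ι S)) (hres : ∀ g : GL ι k, ∃ g' ∈ G, g'.1.map π = g.1)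
    (hlayer : 2 ≤ n → ∃ g ∈ G, ∃ Y : Matrix ι ι S, g.1 = 1 + ϖ • Y ∧
      ∀ c : k, Y.map π ≠ scalar ι c)
    (hdet : ∀ u : Sˣ, ∃ g ∈ G, g.1.det = u) : G = ⊤ := by
  have hϖ : π ϖ = 0 := (hker ϖ).2 dvd_rfl
  let G₁ : Subgroup (GL ι S) := G ⊓ GeneralLinearGroup.det.ker
  have hG₁ : ∀ g, g ∈ G₁ ↔ g ∈ G ∧ g.1.det = 1 := by
    intro g
    simp only [G₁, Subgroup.mem_inf, MonoidHom.mem_ker, Units.ext_iff,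
      GeneralLinearGroup.val_det_apply, Units.val_one]
  have hcomm : ∀ g ∈ G, ∀ g' ∈ G, g * g' * g⁻¹ * g'⁻¹ ∈ G₁ := by
    intro g hg g' hg'
    refine (hG₁ _).2 ⟨G.mul_mem (G.mul_mem (G.mul_mem hg hg') (G.inv_mem hg)) (G.inv_mem hg'), ?_⟩
    rw [← GeneralLinearGroup.val_det_apply]
    simp [mul_assoc]
  have hlift : ∀ A : Matrix ι ι k, A.det = 1 → ∃ g ∈ G₁, g.1.map π = A := by
    intro A hA
    obtain ⟨g, hg, h1, h3⟩ := exists_det_one_lift π hι G hres A hA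
    exact ⟨g, (hG₁ g).2 ⟨hg, h1⟩, h3⟩
  have hinvmap : ∀ g : GL ι S, ∀ t t' : Matrix ι ι k, t' * t = 1 → g.1.map π = t →
      g⁻¹.1.map π = t' := by
    intro g t t' ht hg
    have h3 : π.mapMatrix g.1 * π.mapMatrix g⁻¹.1 = 1 := by
      rw [← map_mul, show g.1 * g⁻¹.1 = 1 from g.mul_inv, map_one]
    rw [RingHom.mapMatrix_apply, RingHom.mapMatrix_apply, hg] at h3
    calc _ = t' * (t * g⁻¹.1.map π) := by rw [← mul_assoc, ht, one_mul]
      _ = _ := by rw [h3, mul_one]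
  have hstab : ∀ (H : Subgroup (GL ι S)), G₁ ≤ H → ∀ (m : ℕ) (hm : 1 ≤ m),
      ∀ X ∈ congruenceLayer π hϖ H m hm, ∀ i j : ι, i ≠ j → ∀ c : k,
      transvection i j c * X * transvection i j (-c) ∈ congruenceLayer π hϖ H m hm := by
    intro H hH m hm X hX i j hij c
    obtain ⟨g, hg, hgt⟩ := hlift (transvection i j c) (det_transvection_of_ne _ _ hij _)
    have := conj_mem_congruenceLayer π hϖ hm hX (hH hg)
    rwa [hinvmap g _ (transvection i j (-c))
      (by rw [transvection_mul_transvection_same _ _ hij]; simp) hgt, hgt] at this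
  obtain ⟨i, j, l, hij, hil, hjl⟩ := Fintype.two_lt_card_iff.1 (show 2 < Fintype.card ι by omega)
  have hsing : ∀ a b : ι, a ≠ b → ∀ c : k, single a b (1 : k) ≠ scalar ι c := by
    intro a b hab c h
    have := congr_fun (congr_fun h a) b
    simp [hab] at this
  have htr : ∀ a b : ι, a ≠ b → (single a b (1 : k)).trace = 0 := by
    intro a b hab
    simp [trace_single_eq_of_ne _ _ _ hab]
  have hlie : single i l (1 : k) =
      single i j 1 * single j l 1 - single j l 1 * single i j 1 := by
    simp [single_mul_single_of_ne, hil.symm]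
  have hall : 2 ≤ n → ∀ (m : ℕ) (hm : 1 ≤ m), ∀ X : Matrix ι ι k, X.trace = 0 →
      X ∈ congruenceLayer π hϖ G₁ m hm := by
    intro hn2 m hm
    have hG : ∀ X : Matrix ι ι k, X.trace = 0 → X ∈ congruenceLayer π hϖ G 1 le_rfl := by
      obtain ⟨g, hg, Y, hY, hns⟩ := hlayer hn2
      refine mem_of_trace_eq_zero h2 hι _ (hstab G inf_le_left 1 le_rfl) (Y.map π)
        ⟨g, hg, Y, by rw [hY, pow_one], rfl⟩ hns
    induction m, hm using Nat.le_induction with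
    | base =>
      refine mem_of_trace_eq_zero h2 hι _ (hstab G₁ le_rfl 1 le_rfl) (single l j 1) ?_
        (hsing l j hjl.symm)
      obtain ⟨g, hg, Y, hY, hYX⟩ := hG (single i j 1) (htr i j hij)
      obtain ⟨t, ht, htt⟩ := hlift (transvection l i 1) (det_transvection_of_ne _ _ hil.symm _)
      have htinv := hinvmap t _ (transvection l i (-1))
        (by rw [transvection_mul_transvection_same _ _ hil.symm]; simp) htt
      have hginv : g⁻¹.1.map π = 1 := by
        refine hinvmap g 1 1 (one_mul 1) ?_
        rw [hY]
        ext a b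
        simp [hϖ, one_apply, apply_ite π]
      have hgg : g.1 * g⁻¹.1 = 1 := g.mul_inv
      refine ⟨t * g * t⁻¹ * g⁻¹, hcomm t (inf_le_left (α := Subgroup (GL ι S)) ht) g hg,
        (t.1 * Y * t⁻¹.1 - Y) * g⁻¹.1, ?_, ?_⟩
      · have : t.1 * g.1 * t⁻¹.1 = g.1 + ϖ ^ 1 • (t.1 * Y * t⁻¹.1 - Y) := by
          rw [hY, mul_add, add_mul, mul_one, show t.1 * t⁻¹.1 = 1 from t.mul_inv,
            mul_smul_comm, smul_mul_assoc, smul_sub]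
          abel
        rw [Units.val_mul, Units.val_mul, Units.val_mul, this, add_mul, hgg, smul_mul_assoc]
      · change π.mapMatrix _ = _
        simp only [map_mul, map_sub, RingHom.mapMatrix_apply]
        rw [hginv, htt, htinv, hYX, mul_one]
        simp only [transvection, add_mul, mul_add, one_mul, mul_one]
        rw [mul_assoc, single_mul_single_of_ne _ _ _ _ hjl]
        simp
    | succ m hm ih =>
      refine mem_of_trace_eq_zero h2 hι _ (hstab G₁ le_rfl _ _) (single i l 1) ?_ (hsing i l hil)
      have := lie_mem_congruenceLayer π hϖ hm le_rfl
        (fun g hg g' hg' ↦ hcomm g (inf_le_left (α := Subgroup (GL ι S)) hg) g' hg')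
        (ih (single i j 1) (htr i j hij)) (hG _ (htr j l hjl))
      rwa [← hlie] at this
  have hdvd : ∀ A B : Matrix ι ι S, A.map π = B.map π → ∃ Z : Matrix ι ι S, A = B + ϖ • Z := by
    intro A B hAB
    have h1 : ∀ a b, ∃ z, A a b - B a b = ϖ * z := by
      intro a b
      have := congr_fun (congr_fun hAB a) b
      simp only [map_apply] at this
      exact (hker _).1 (by rw [map_sub, this, sub_self])
    choose Z hZ using h1
    refine ⟨of Z, ?_⟩
    ext a b
    simp [← hZ]
  have hunit : ∀ x : S, π x ≠ 0 → IsUnit x := by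
    intro x hx
    obtain ⟨y, hy⟩ := hπ (π x)⁻¹
    obtain ⟨z, hz⟩ := (hker (1 - x * y)).1 (by rw [map_sub, map_mul, hy, mul_inv_cancel₀ hx]; simp)
    have hnil : IsNilpotent (1 - x * y) := ⟨n, by rw [hz, mul_pow, hn, zero_mul]⟩
    have := hnil.isUnit_one_sub
    rw [sub_sub_cancel] at this
    exact isUnit_of_mul_isUnit_left this
  have happrox : ∀ m : ℕ, 1 ≤ m → m ≤ max 1 n → ∀ A : Matrix ι ι S, A.det = 1 →
      ∃ g ∈ G₁, ∃ Z : Matrix ι ι S, A = g.1 + ϖ ^ m • Z := by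
    intro m hm
    induction m, hm using Nat.le_induction with
    | base =>
      intro _ A hA
      obtain ⟨g, hg, hgA⟩ := hlift (A.map π) (by
        have := (RingHom.map_det π A).symm
        rwa [hA, map_one] at this)
      obtain ⟨Z, hZ⟩ := hdvd A g.1 hgA.symm
      exact ⟨g, hg, Z, by rw [pow_one]; exact hZ⟩
    | succ m hm ih =>
      intro hmn A hA
      have hn2 : 2 ≤ n := by
        rcases le_max_iff.1 hmn with h | h <;> omega
      obtain ⟨g, hg, Z, hZ⟩ := ih (by omega) A hA
      by_cases hϖm : ϖ ^ m = 0
      · exact ⟨g, hg, Z, by rw [hZ, pow_succ, hϖm, zero_mul]⟩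
      have hgg : g.1 * g⁻¹.1 = 1 := g.mul_inv
      have hgg' : g⁻¹.1 * g.1 = 1 := g.inv_mul
      have hgdet : g⁻¹.1.det = 1 := ((hG₁ _).1 (G₁.inv_mem hg)).2
      have hB : g⁻¹.1 * A = 1 + ϖ ^ m • (g⁻¹.1 * Z) := by
        rw [hZ, mul_add, hgg', mul_smul_comm]
      have hBdet : (1 + ϖ ^ m • (g⁻¹.1 * Z)).det = 1 := by
        rw [← hB, det_mul, hgdet, hA, one_mul]
      have htrW : ((g⁻¹.1 * Z).map π).trace = 0 := by
        have h3 : ((g⁻¹.1 * Z).map π).trace = π (g⁻¹.1 * Z).trace := by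
          simp only [trace, diag, map_apply, map_sum]
        rw [h3]
        by_contra hne
        rw [det_one_add_smul] at hBdet
        obtain ⟨e, he⟩ : ∃ e : S, 1 + (g⁻¹.1 * Z).trace * ϖ ^ m + e * (ϖ ^ m) ^ 2 = 1 :=
          ⟨_, hBdet⟩
        have hu : IsUnit ((g⁻¹.1 * Z).trace + e * ϖ ^ m) := by
          apply hunit
          simpa [hϖ, zero_pow (show m ≠ 0 by omega)] using hne
        exact hϖm (hu.mul_right_eq_zero.1 (by linear_combination he))
      obtain ⟨g', hg', Y, hY, hYW⟩ := hall hn2 m hm _ htrW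
      obtain ⟨V, hV⟩ := hdvd _ _ hYW.symm
      refine ⟨g * g', G₁.mul_mem hg hg', g.1 * V, ?_⟩
      calc A = g.1 * (g⁻¹.1 * A) := by rw [← mul_assoc, hgg, one_mul]
        _ = g.1 * (1 + ϖ ^ m • (Y + ϖ • V)) := by rw [hB, hV]
        _ = _ := by
          rw [Units.val_mul, hY, smul_add, smul_smul, ← pow_succ, ← add_assoc, mul_add,
            mul_smul_comm]
  rw [eq_top_iff]
  intro g _
  obtain ⟨d, hd, hdg⟩ := hdet (GeneralLinearGroup.det g)
  have h1 : (g * d⁻¹).1.det = 1 := by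
    change (g.1 * d⁻¹.1).det = 1
    have h1 : d.1 * d⁻¹.1 = 1 := d.mul_inv
    rw [det_mul, ← GeneralLinearGroup.val_det_apply g, ← hdg, ← det_mul, h1, det_one]
  obtain ⟨a, ha, Z, haZ⟩ := happrox (max 1 n) (le_max_left _ _) le_rfl _ h1
  rw [pow_eq_zero_of_le (le_max_right _ _) hn, zero_smul, add_zero] at haZ
  have : g = a * d := by rw [← Units.ext haZ]; group
  exact this ▸ G.mul_mem ((hG₁ a).1 ha).1 hd

end MatrixLift

section Place

open WithZero IsDedekindDomain
open scoped Pointwise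

/-- `σ` preserves the valuation `v` and acts as `x ↦ x ^ N` on the residue field. -/
def ActsAsPowAt {E : Type*} [Field E] (v : Valuation E ℤᵐ⁰) (N : ℕ) (σ : E → E) : Prop :=
  ∀ x, v (σ x) = v x ∧ (v x ≤ 1 → v (σ x - x ^ N) < 1)

theorem HeightOneSpectrum.intValuation_smul {G B : Type*} [Group G] [CommRing B]
    [IsDedekindDomain B] [MulSemiringAction G B] (w : HeightOneSpectrum B) {σ : G}
    (hσ : σ ∈ MulAction.stabilizer G w.asIdeal) (b : B) :
    w.intValuation (σ • b) = w.intValuation b := by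
  have key : ∀ τ : G, τ ∈ MulAction.stabilizer G w.asIdeal → ∀ b : B,
      w.intValuation (τ • b) ≤ w.intValuation b := by
    intro τ hτ b
    rcases eq_or_ne b 0 with rfl | hb
    · simp
    have h1 : w.intValuation b ≤ w.intValuation b := le_rfl
    rw [w.intValuation_eq_exp_neg_multiplicity hb] at h1 ⊢
    rw [HeightOneSpectrum.intValuation_le_pow_iff_mem]
    have h2 : b ∈ w.asIdeal ^ multiplicity w.asIdeal (Ideal.span {b}) := by
      rw [← HeightOneSpectrum.intValuation_le_pow_iff_mem,
        w.intValuation_eq_exp_neg_multiplicity hb]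
    have h3 := Ideal.mem_map_of_mem (MulSemiringAction.toRingHom G B τ) h2
    rw [Ideal.map_pow] at h3
    rw [MulAction.mem_stabilizer_iff, Ideal.pointwise_smul_def] at hτ
    rw [hτ] at h3
    exact h3
  refine le_antisymm (key σ hσ b) ?_
  simpa using key σ⁻¹ (inv_mem hσ) (σ • b)

theorem HeightOneSpectrum.actsAsPowAt {B E : Type*} [CommRing B] [IsDedekindDomain B]
    [Field E] [Algebra B E] [IsFractionRing B E] (w : HeightOneSpectrum B) (σ : E →+* E)
    (σB : B → B) (hcomp : ∀ b, σ (algebraMap B E b) = algebraMap B E (σB b))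
    (hval : ∀ b, w.intValuation (σB b) = w.intValuation b) (N : ℕ)
    (hres : ∀ b, σB b - b ^ N ∈ w.asIdeal) :
    ActsAsPowAt (w.valuation E) N σ := by
  have hv : ∀ x, w.valuation E (σ x) = w.valuation E x := by
    intro x
    obtain ⟨a, b, hb, rfl⟩ := IsFractionRing.div_surjective (A := B) x
    simp only [map_div₀, hcomp, HeightOneSpectrum.valuation_of_algebraMap, hval]
  intro x
  refine ⟨hv x, fun hx => ?_⟩
  obtain ⟨b, hb⟩ := w.exists_valuation_sub_lt_of_integer hx 1
  rw [Units.val_one] at hb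
  set y := algebraMap B E b with hy
  have hy1 : w.valuation E y ≤ 1 := w.valuation_le_one b
  have e : σ x - x ^ N = -σ (y - x) + (σ y - y ^ N) + (y ^ N - x ^ N) := by
    rw [map_sub]; ring
  have h1 : w.valuation E (-σ (y - x)) < 1 := by rw [Valuation.map_neg, hv]; exact hb
  have h2 : w.valuation E (σ y - y ^ N) < 1 := by
    rw [hy, hcomp, ← map_pow, ← map_sub, HeightOneSpectrum.valuation_of_algebraMap,
      HeightOneSpectrum.intValuation_lt_one_iff_mem]
    exact hres b
  have h3 : w.valuation E (y ^ N - x ^ N) < 1 := by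
    rw [← geom_sum₂_mul, map_mul]
    refine (mul_le_of_le_one_left' ?_).trans_lt hb
    refine Valuation.map_sum_le _ fun i _ => ?_
    rw [map_mul, map_pow, map_pow]
    exact mul_le_one' (pow_le_one' hy1 _) (pow_le_one' hx _)
  rw [e]
  exact Valuation.map_add_lt _ (Valuation.map_add_lt _ h1 h2) h3

/-- Existence of a place above a prime element with its inertia group and a Frobenius. -/
theorem exists_place {R K E : Type*} [CommRing R] [IsDedekindDomain R] [Field K] [Algebra R K]
    [IsFractionRing R K] [Field E] [Algebra K E] [FiniteDimensional K E] [IsGalois K E]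
    [Algebra R E] [IsScalarTower R K E] {ϖ : R} (hϖ : Prime ϖ)
    [Finite (R ⧸ Ideal.span {ϖ})] :
    ∃ (v : Valuation E ℤᵐ⁰) (I : Subgroup (E ≃ₐ[K] E)) (s : E ≃ₐ[K] E),
      (∀ a : R, v (algebraMap R E a) ≤ 1) ∧
      (∀ a : R, v (algebraMap R E a) < 1 ↔ ϖ ∣ a) ∧
      v (algebraMap R E ϖ) = exp (-(Nat.card I : ℤ)) ∧
      (∀ σ ∈ I, ActsAsPowAt v 1 σ) ∧
      ActsAsPowAt v (Nat.card (R ⧸ Ideal.span {ϖ})) s := by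
  let p : Ideal R := Ideal.span {ϖ}
  have hp : p.IsPrime := (Ideal.span_singleton_prime hϖ.ne_zero).2 hϖ
  have hp0 : p ≠ ⊥ := by simpa [p] using hϖ.ne_zero
  have : p.IsMaximal := hp.isMaximal hp0
  let B := integralClosure R E
  have : IsDedekindDomain B := IsIntegralClosure.isDedekindDomain R K E B
  have : Module.Finite R B := IsIntegralClosure.finite R K E B
  have : IsFractionRing B E := IsIntegralClosure.isFractionRing_of_finite_extension R K E B
  let : MulSemiringAction Gal(E/K) B := IsIntegralClosure.MulSemiringAction R K E B
  have : IsGaloisGroup Gal(E/K) R B := IsGaloisGroup.of_isFractionRing _ _ _ K E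
  have hinj : Function.Injective (algebraMap R E) := by
    rw [IsScalarTower.algebraMap_eq R K E]
    exact (algebraMap K E).injective.comp (IsFractionRing.injective R K)
  have : FaithfulSMul R E := (faithfulSMul_iff_algebraMap_injective R E).2 hinj
  have : FaithfulSMul R B := by
    rw [faithfulSMul_iff_algebraMap_injective]
    exact FaithfulSMul.algebraMap_injective R B
  obtain ⟨P, hPm, hPp⟩ := Ideal.exists_maximal_ideal_liesOver_of_isIntegral p (S := B)
  have hP0 : P ≠ ⊥ := Ideal.ne_bot_of_liesOver_of_ne_bot hp0 P
  let w : HeightOneSpectrum B := ⟨P, hPm.isPrime, hP0⟩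
  let vR : HeightOneSpectrum R := ⟨p, hp, hp0⟩
  have : w.asIdeal.LiesOver vR.asIdeal := hPp
  have : Finite p.ResidueField := by
    have := (Ideal.bijective_algebraMap_quotient_residueField p).2
    exact Finite.of_surjective _ this
  have : PerfectField p.ResidueField := inferInstance
  have hcard : Nat.card (P.inertia Gal(E/K)) = p.ramificationIdx' P := by
    rw [Ideal.card_inertia_eq_ramificationIdxIn p P,
      Ideal.ramificationIdxIn_eq_ramificationIdx p P Gal(E/K),
      Ideal.ramificationIdx'_eq_ramificationIdx p P hp0]
  have : Finite (B ⧸ P) := by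
    have : Module.Finite (R ⧸ p) (B ⧸ P) := inferInstance
    exact Module.finite_of_finite (R ⧸ p)
  have : Algebra.IsInvariant R B Gal(E/K) := inferInstance
  obtain ⟨s, hs⟩ := IsArithFrobAt.exists_of_isInvariant R Gal(E/K) P
  have hcomp : ∀ (σ : Gal(E/K)) (b : B),
      (σ : E →+* E) (algebraMap B E b) = algebraMap B E (σ • b) := by
    intro σ b
    exact (algebraMap_galRestrict_apply R (K := K) (L := E) (B := B) σ b).symm
  have hvR : ∀ a : R, w.valuation E (algebraMap R E a) = vR.intValuation a ^ Nat.card (P.inertia Gal(E/K)) := by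
    intro a
    rw [hcard, IsScalarTower.algebraMap_apply R B E, HeightOneSpectrum.valuation_of_algebraMap]
    exact (HeightOneSpectrum.intValuation_liesOver vR w a).symm
  refine ⟨w.valuation E, P.inertia Gal(E/K), s, ?_, ?_, ?_, ?_, ?_⟩
  · intro a
    rw [IsScalarTower.algebraMap_apply R B E]
    exact w.valuation_le_one _
  · intro a
    rw [hvR, pow_lt_one_iff Nat.card_pos.ne', HeightOneSpectrum.intValuation_lt_one_iff_mem]
    exact Ideal.mem_span_singleton
  · rw [hvR, vR.intValuation_singleton hϖ.ne_zero rfl, ← exp_nsmul]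
    simp
  · intro σ hσ
    refine HeightOneSpectrum.actsAsPowAt w (σ : E →+* E) (fun b => σ • b) (hcomp σ)
      (HeightOneSpectrum.intValuation_smul w ?_) 1 ?_
    · exact Ideal.inertia_le_stabilizer (M := Gal(E/K)) P hσ
    · intro b
      rw [pow_one]
      exact hσ b
  · refine HeightOneSpectrum.actsAsPowAt w (s : E →+* E) (fun b => s • b) (hcomp s)
      (HeightOneSpectrum.intValuation_smul w hs.mem_stabilizer) _ ?_
    intro b
    have := hs b
    rw [← Ideal.LiesOver.over (p := p) (P := P)] at this
    exact this

/-- An inertial automorphism of `p`-power order fixes every one-unit class `σ x / x`. -/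
theorem ActsAsPowAt.sub_lt_of_orderOf {E : Type*} [Field E] {v : Valuation E ℤᵐ⁰} {p : ℕ}
    [Fact p.Prime] [CharP E p] {σ : E →+* E} (hσ : ActsAsPowAt v 1 σ) {k : ℕ}
    (hk : ∀ x, σ^[p ^ k] x = x) {x : E} (hx : x ≠ 0) : v (σ x - x) < v x := by
  set u := σ x / x with hu
  have hvx : v x ≠ 0 := (Valuation.ne_zero_iff v).2 hx
  have hvu : v u = 1 := by rw [hu, map_div₀, (hσ x).1, div_self hvx]
  have hu0 : u ≠ 0 := by
    intro h; rw [h] at hvu; simp at hvu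
  have hind : ∀ n : ℕ, v (σ^[n] x / x - u ^ n) < 1 := by
    intro n
    induction n with
    | zero => simp [hx]
    | succ n ih =>
      have h1 : v (σ^[n] x / x) = 1 := by
        have : v (σ^[n] x) = v x := by
          clear ih
          induction n with
          | zero => rfl
          | succ n ih => rw [Function.iterate_succ_apply', (hσ _).1, ih]
        rw [map_div₀, this, div_self hvx]
      have h2 := (hσ (σ^[n] x / x)).2 h1.le
      rw [pow_one] at h2
      have e : σ^[n + 1] x / x - u ^ (n + 1)
          = u * (σ (σ^[n] x / x) - σ^[n] x / x) + u * (σ^[n] x / x - u ^ n) := by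
        have hsx : σ x ≠ 0 := by simpa using hx
        have h3 : u * (σ (σ^[n] x) / σ x) = σ (σ^[n] x) / x := by rw [hu]; field_simp
        rw [Function.iterate_succ_apply', map_div₀, ← h3]
        ring
      rw [e]
      refine Valuation.map_add_lt _ ?_ ?_ <;> rw [map_mul, hvu, one_mul] <;> assumption
  have h := hind (p ^ k)
  rw [hk, div_self hx, ← one_pow (p ^ k), ← sub_pow_char_pow, map_pow,
    pow_lt_one_iff (pow_ne_zero _ (Fact.out (p := p.Prime)).ne_zero)] at h
  have e : σ x - x = -(x * (1 - u)) := by rw [hu]; field_simp; ring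
  rw [e, Valuation.map_neg, map_mul]
  calc v x * v (1 - u) < v x * 1 := mul_lt_mul_of_pos_left h (zero_lt_iff.2 hvx)
    _ = v x := mul_one _

end Place

section DrinfeldModule

variable (Fq : Type*) [Field Fq] [Fintype Fq] {E : Type*} [Field E] [Algebra Fq E]

/-- The `𝔽_q`-linear operator `θ + τ^{r-1} + θ^{q-1} τ^r` on a field containing `𝔽_q`. -/
def drinfeldT (r : ℕ) (θ : E) : Module.End Fq E :=
  θ • (1 : Module.End Fq E) + (FiniteField.frobeniusAlgHom Fq E).toLinearMap ^ (r - 1) +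
    θ ^ (Fintype.card Fq - 1) • (FiniteField.frobeniusAlgHom Fq E).toLinearMap ^ r

theorem frobeniusAlgHom_toLinearMap_pow_apply (n : ℕ) (x : E) :
    ((FiniteField.frobeniusAlgHom Fq E).toLinearMap ^ n) x = x ^ Fintype.card Fq ^ n := by
  induction n with
  | zero => simp
  | succ n ih =>
    rw [pow_succ', Module.End.mul_apply, ih, AlgHom.toLinearMap_apply,
      FiniteField.frobeniusAlgHom_apply, ← pow_mul, pow_succ]

theorem drinfeldT_apply (r : ℕ) (θ x : E) :
    drinfeldT Fq r θ x = θ * x + x ^ Fintype.card Fq ^ (r - 1) +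
      θ ^ (Fintype.card Fq - 1) * x ^ Fintype.card Fq ^ r := by
  simp [drinfeldT, frobeniusAlgHom_toLinearMap_pow_apply]

/-- The polynomial `θ X + X^{q^{r-1}} + θ^{q-1} X^{q^r}`. -/
def drinfeldPolyT (r : ℕ) (θ : E) : E[X] :=
  C θ * X + X ^ Fintype.card Fq ^ (r - 1) + C (θ ^ (Fintype.card Fq - 1)) * X ^ Fintype.card Fq ^ r

variable {Fq}

/-- The polynomial describing the action of `b` on a field. -/
def drinfeldPoly (r : ℕ) (θ : E) (b : Fq[X]) : E[X] :=
  ∑ i ∈ Finset.range (b.natDegree + 1),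
    C (algebraMap Fq E (b.coeff i)) * (drinfeldPolyT Fq r θ).comp^[i] X

theorem eval_iterate_drinfeldPolyT (r : ℕ) (θ x : E) (i : ℕ) :
    ((drinfeldPolyT Fq r θ).comp^[i] X).eval x = (drinfeldT Fq r θ ^ i) x := by
  induction i with
  | zero => simp
  | succ i ih =>
    rw [Function.iterate_succ_apply', eval_comp, ih, pow_succ', Module.End.mul_apply,
      drinfeldT_apply]
    simp [drinfeldPolyT]

theorem eval_drinfeldPoly (r : ℕ) (θ x : E) (b : Fq[X]) :
    (drinfeldPoly r θ b).eval x = aeval (drinfeldT Fq r θ) b x := by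
  rw [drinfeldPoly, eval_finsetSum, aeval_eq_sum_range, LinearMap.sum_apply]
  refine Finset.sum_congr rfl fun i _ => ?_
  rw [eval_mul, eval_C, eval_iterate_drinfeldPolyT, LinearMap.smul_apply, Algebra.smul_def]

theorem derivative_iterate_drinfeldPolyT {r : ℕ} (hr : 2 ≤ r) (θ : E) (i : ℕ) :
    derivative ((drinfeldPolyT Fq r θ).comp^[i] X) = C (θ ^ i) := by
  have hq : (Fintype.card Fq : E) = 0 := by
    rw [← map_natCast (algebraMap Fq E), FiniteField.cast_card_eq_zero, map_zero]
  have h0 : derivative (drinfeldPolyT Fq r θ) = C θ := by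
    simp only [drinfeldPolyT, derivative_add, derivative_mul, derivative_C, derivative_X,
      derivative_X_pow, Nat.cast_pow, hq]
    rw [zero_pow (by omega), zero_pow (by omega)]
    simp
  induction i with
  | zero => simp
  | succ i ih =>
    rw [Function.iterate_succ_apply', derivative_comp, ih, h0, C_comp, ← C_mul, pow_succ]

theorem derivative_drinfeldPoly {r : ℕ} (hr : 2 ≤ r) (θ : E) (b : Fq[X]) :
    derivative (drinfeldPoly r θ b) = C (aeval θ b) := by
  rw [drinfeldPoly, derivative_sum, aeval_eq_sum_range, map_sum]
  refine Finset.sum_congr rfl fun i _ => ?_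
  rw [derivative_C_mul, derivative_iterate_drinfeldPolyT hr, ← C_mul, Algebra.smul_def]

theorem natDegree_drinfeldPolyT {r : ℕ} (hr : 2 ≤ r) {θ : E} (hθ : θ ≠ 0) :
    (drinfeldPolyT Fq r θ).natDegree = Fintype.card Fq ^ r := by
  have hq : 1 < Fintype.card Fq := Fintype.one_lt_card
  have h1 : Fintype.card Fq ^ (r - 1) < Fintype.card Fq ^ r :=
    Nat.pow_lt_pow_right hq (by omega)
  have h2 : 1 ≤ Fintype.card Fq ^ (r - 1) := Nat.one_le_pow _ _ (by omega)
  rw [drinfeldPolyT, natDegree_add_eq_right_of_natDegree_lt]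
  · exact natDegree_C_mul_X_pow _ _ (pow_ne_zero _ hθ)
  · rw [natDegree_C_mul_X_pow _ _ (pow_ne_zero _ hθ)]
    refine (natDegree_add_le _ _).trans_lt (max_lt ?_ ?_)
    · refine (natDegree_C_mul_le _ _).trans_lt ?_
      rw [natDegree_X]
      exact Nat.one_lt_pow (by omega) hq
    · rwa [natDegree_X_pow]

theorem natDegree_drinfeldPoly {r : ℕ} (hr : 2 ≤ r) {θ : E} (hθ : θ ≠ 0) {b : Fq[X]}
    (hb : b ≠ 0) :
    (drinfeldPoly r θ b).natDegree = Fintype.card Fq ^ (r * b.natDegree) := by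
  have hq : 1 < Fintype.card Fq := Fintype.one_lt_card
  have hd : ∀ i, ((drinfeldPolyT Fq r θ).comp^[i] X).natDegree = Fintype.card Fq ^ (r * i) := by
    intro i
    induction i with
    | zero => simp
    | succ i ih =>
      rw [Function.iterate_succ_apply', natDegree_comp, ih, natDegree_drinfeldPolyT hr hθ,
        ← pow_add]
      congr 1; ring
  have hlead : algebraMap Fq E (b.coeff b.natDegree) ≠ 0 := by
    simpa using hb
  rw [drinfeldPoly, Finset.sum_range_succ]
  have htop : (C (algebraMap Fq E (b.coeff b.natDegree)) *
      (drinfeldPolyT Fq r θ).comp^[b.natDegree] X).natDegree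
        = Fintype.card Fq ^ (r * b.natDegree) := by
    rw [natDegree_C_mul hlead, hd]
  rw [natDegree_add_eq_right_of_natDegree_lt, htop]
  rw [htop]
  rcases Nat.eq_zero_or_pos b.natDegree with h | h
  · simp [h]
  refine (natDegree_sum_le_of_forall_le (n := Fintype.card Fq ^ (r * (b.natDegree - 1))) _ _
    fun i hi => ?_).trans_lt ?_
  · refine (natDegree_C_mul_le _ _).trans ?_
    rw [hd]
    have := Finset.mem_range.1 hi
    exact Nat.pow_le_pow_right (by omega) (Nat.mul_le_mul_left _ (by omega))
  · exact Nat.pow_lt_pow_right hq (Nat.mul_lt_mul_of_pos_left (by omega) (by omega))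

/-- The `b`-torsion as an `𝔽_q`-subspace of a field. -/
def drinfeldTorsion (r : ℕ) (θ : E) (b : Fq[X]) : Submodule Fq E :=
  LinearMap.ker (aeval (drinfeldT Fq r θ) b)

theorem mem_drinfeldTorsion {r : ℕ} {θ : E} {b : Fq[X]} {x : E} :
    x ∈ drinfeldTorsion r θ b ↔ aeval (drinfeldT Fq r θ) b x = 0 := Iff.rfl

theorem coe_drinfeldTorsion {r : ℕ} (hr : 2 ≤ r) {θ : E} (hθ : θ ≠ 0) {b : Fq[X]} (hb : b ≠ 0) :
    (drinfeldTorsion r θ b : Set E) = (drinfeldPoly r θ b).rootSet E := by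
  have h0 : drinfeldPoly r θ b ≠ 0 := by
    intro h
    have := natDegree_drinfeldPoly (Fq := Fq) hr hθ hb
    rw [h, natDegree_zero] at this
    exact (pow_pos Fintype.card_pos _).ne this
  ext x
  rw [SetLike.mem_coe, mem_drinfeldTorsion, mem_rootSet, ← eval_drinfeldPoly, coe_aeval_eq_eval]
  simp [h0]

theorem card_drinfeldTorsion [IsAlgClosed E] {r : ℕ} (hr : 2 ≤ r) {θ : E} (hθ : θ ≠ 0)
    {b : Fq[X]} (hb : aeval θ b ≠ 0) :
    Nat.card (drinfeldTorsion r θ b) = Fintype.card Fq ^ (r * b.natDegree) := by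
  have hb0 : b ≠ 0 := by rintro rfl; simp at hb
  have hsep : (drinfeldPoly r θ b).Separable := by
    rw [Polynomial.separable_def, derivative_drinfeldPoly hr]
    exact ⟨0, C (aeval θ b)⁻¹, by rw [zero_mul, zero_add, ← C_mul, inv_mul_cancel₀ hb, C_1]⟩
  have h1 := card_rootSet_eq_natDegree (K := E) hsep (IsAlgClosed.splits _)
  rw [natDegree_drinfeldPoly hr hθ hb0] at h1
  rw [← h1, ← Nat.card_eq_fintype_card]
  exact Nat.card_congr (Equiv.setCongr (coe_drinfeldTorsion hr hθ hb0))

end DrinfeldModule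

section FrobeniusStable

variable {k κ : Type*} [Field k] [Fintype k] [Field κ] [Algebra k κ]

theorem mem_range_algebraMap_of_pow_card_eq {x : κ} (hx : x ^ Fintype.card k = x) :
    x ∈ Set.range (algebraMap k κ) := by
  classical
  by_contra h
  have hP : (X ^ Fintype.card k - X : κ[X]) ≠ 0 :=
    FiniteField.X_pow_card_sub_X_ne_zero κ Fintype.one_lt_card
  have hdeg := FiniteField.X_pow_card_sub_X_natDegree_eq κ (Fintype.one_lt_card (α := k))
  let S : Finset κ := insert x (Finset.univ.image (algebraMap k κ))
  have hS : S.card = Fintype.card k + 1 := by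
    rw [Finset.card_insert_of_notMem, Finset.card_image_of_injective _ (algebraMap k κ).injective,
      Finset.card_univ]
    simpa using h
  have hsub : S ⊆ (X ^ Fintype.card k - X : κ[X]).roots.toFinset := by
    intro y hy
    rw [Multiset.mem_toFinset, mem_roots hP, IsRoot.def, eval_sub, eval_pow, eval_X, sub_eq_zero]
    rcases Finset.mem_insert.1 hy with rfl | hy
    · exact hx
    · obtain ⟨c, -, rfl⟩ := Finset.mem_image.1 hy
      rw [← map_pow, FiniteField.pow_card]
  have := (Finset.card_le_card hsub).trans ((Multiset.toFinset_card_le _).trans (card_roots' _))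
  omega

/-- A monic polynomial dividing its Frobenius twist has coefficients in the small field. -/
theorem exists_map_eq_of_dvd_frobenius {b : κ[X]} (hb : b.Monic)
    (h : b ∣ b.map (FiniteField.frobeniusAlgHom k κ : κ →+* κ)) :
    ∃ b₀ : k[X], b₀.map (algebraMap k κ) = b := by
  have h1 : b = b.map (FiniteField.frobeniusAlgHom k κ : κ →+* κ) :=
    eq_of_dvd_of_natDegree_le_of_leadingCoeff h (natDegree_map_le)
      (by rw [hb.leadingCoeff, (hb.map _).leadingCoeff])
  have h2 : b ∈ Polynomial.lifts (algebraMap k κ) := by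
    rw [lifts_iff_coeff_lifts]
    intro n
    apply mem_range_algebraMap_of_pow_card_eq
    conv_rhs => rw [h1]
    rw [coeff_map]
    rfl
  exact (lifts_iff_set_range _ |>.1 h2)

/-- An ideal of `κ[X]` containing a polynomial over the small field, stable under a twisted
Frobenius, is generated by a monic polynomial over the small field. -/
theorem exists_span_eq_of_frobenius_stable (J : Ideal κ[X]) (hJ0 : J ≠ ⊥) {c : κ} (hc : c ≠ 0)
    (hJ : ∀ f ∈ J, C c * f.map (FiniteField.frobeniusAlgHom k κ : κ →+* κ) ∈ J) :
    ∃ b₀ : k[X], b₀.Monic ∧ J = Ideal.span {b₀.map (algebraMap k κ)} := by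
  obtain ⟨g, hg⟩ := IsPrincipalIdealRing.principal J
  have hg' : J = Ideal.span {g} := hg
  have hg0 : g ≠ 0 := by rintro rfl; simp at hg'; exact hJ0 hg'
  set b := g * C (g.leadingCoeff)⁻¹ with hb
  have hbm : b.Monic := monic_mul_leadingCoeff_inv hg0
  have hJb : J = Ideal.span {b} := by
    rw [hg']
    refine (Ideal.span_singleton_mul_right_unit ?_ g).symm
    exact isUnit_C.2 (by simpa using hg0)
  have h1 : b ∣ b.map (FiniteField.frobeniusAlgHom k κ : κ →+* κ) := by
    have h2 := hJ b (by rw [hJb]; exact Ideal.mem_span_singleton_self b)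
    have h3 := J.mul_mem_left (C c⁻¹) h2
    rw [← mul_assoc, ← C_mul, inv_mul_cancel₀ hc, C_1, one_mul, hJb,
      Ideal.mem_span_singleton] at h3
    exact h3
  obtain ⟨b₀, hb₀⟩ := exists_map_eq_of_dvd_frobenius hbm h1
  refine ⟨b₀, ?_, by rw [hb₀, hJb]⟩
  exact monic_of_injective (algebraMap k κ).injective (by rw [hb₀]; exact hbm)

/-- Subspaces of `κ[X] / (l)` stable under `X`, a scalar generating `κ` and a twisted
Frobenius are trivial. -/
theorem eq_bot_or_top_of_frobenius_stable (hp : (Module.finrank k κ).Prime) {l : k[X]}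
    (hl : Irreducible l) (W : Submodule k κ[X])
    (hlW : ∀ f, l.map (algebraMap k κ) * f ∈ W) (hX : ∀ f ∈ W, X * f ∈ W)
    {z : κ} (hz : z ∉ Set.range (algebraMap k κ)) (hzW : ∀ f ∈ W, C z * f ∈ W)
    {c : κ} (hc : c ≠ 0)
    (hW : ∀ f ∈ W, C c * f.map (FiniteField.frobeniusAlgHom k κ : κ →+* κ) ∈ W) :
    (∀ f ∈ W, l.map (algebraMap k κ) ∣ f) ∨ W = ⊤ := by
  let D : Subalgebra k κ :=
    { carrier := {x | ∀ f ∈ W, C x * f ∈ W}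
      mul_mem' := fun {x y} hx hy f hf => by
        rw [C_mul, mul_assoc]; exact hx _ (hy _ hf)
      add_mem' := fun {x y} hx hy f hf => by
        rw [C_add, add_mul]; exact W.add_mem (hx _ hf) (hy _ hf)
      algebraMap_mem' := fun x f hf => by
        have := W.smul_mem x hf
        rwa [← algebraMap_smul κ x f, smul_eq_C_mul] at this }
  have hD : D = ⊤ := by
    refine ((Subalgebra.isSimpleOrder_of_finrank_prime k κ hp).eq_bot_or_eq_top D).resolve_left ?_
    intro h
    have : z ∈ D := hzW
    rw [h, Algebra.mem_bot] at this
    exact hz this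
  have hmul : ∀ g f, f ∈ W → g * f ∈ W := by
    intro g f hf
    induction g using Polynomial.induction_on' with
    | add p q hp hq => rw [add_mul]; exact W.add_mem hp hq
    | monomial n a =>
      rw [← C_mul_X_pow_eq_monomial, mul_assoc]
      have h1 : X ^ n * f ∈ W := by
        induction n with
        | zero => simpa
        | succ n ih => rw [pow_succ', mul_assoc]; exact hX _ ih
      have h2 : a ∈ D := by rw [hD]; trivial
      exact h2 _ h1
  let J : Ideal κ[X] :=
    { carrier := W
      add_mem' := W.add_mem
      zero_mem' := W.zero_mem
      smul_mem' := hmul }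
  have hlJ : l.map (algebraMap k κ) ∈ J := by
    have h := hlW 1
    rw [mul_one] at h
    exact h
  have hJ0 : J ≠ ⊥ := by
    intro h
    rw [h, Ideal.mem_bot, Polynomial.map_eq_zero] at hlJ
    exact hl.ne_zero hlJ
  obtain ⟨b₀, -, hJ⟩ := exists_span_eq_of_frobenius_stable (k := k) J hJ0 hc hW
  have hdvd : b₀ ∣ l := by
    rw [hJ, Ideal.mem_span_singleton] at hlJ
    exact (map_dvd_map' _).1 hlJ
  rcases hl.dvd_iff.1 hdvd with h | h
  · right
    rw [eq_top_iff]
    intro f _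
    have : J = ⊤ := by
      rw [hJ, Ideal.span_singleton_eq_top]
      exact h.map (mapRingHom (algebraMap k κ))
    have h2 : f ∈ J := by rw [this]; trivial
    exact h2
  · left
    intro f hf
    have h2 : f ∈ J := hf
    rw [hJ, Ideal.mem_span_singleton] at h2
    exact ((map_dvd_map' _).2 h.dvd).trans h2

end FrobeniusStable

section TorsionPolynomial

variable {k E : Type*} [Field k] [Field E] [Algebra k E]

/-- For `x` in a `k[X]`-module structure on `E` given by an operator `T`, the polynomial
`∑ aᵢ(T) x Xⁱ` where `aᵢ` are the successive quotients of `a` by powers of `X`. -/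
def torsionPoly (T : Module.End k E) (a : k[X]) : E →ₗ[k] E[X] :=
  ∑ i ∈ Finset.range a.natDegree,
    ((monomial i : E →ₗ[E] E[X]).restrictScalars k) ∘ₗ aeval T (divX^[i + 1] a)

theorem torsionPoly_apply (T : Module.End k E) (a : k[X]) (x : E) :
    torsionPoly T a x = ∑ i ∈ Finset.range a.natDegree, monomial i (aeval T (divX^[i + 1] a) x) := by
  simp [torsionPoly]

theorem natDegree_iterate_divX (a : k[X]) (n : ℕ) :
    (divX^[n] a).natDegree = a.natDegree - n := by
  induction n with
  | zero => simp
  | succ n ih => rw [Function.iterate_succ_apply', natDegree_divX_eq_natDegree_tsub_one, ih]; omega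

theorem iterate_divX_eq_zero {a : k[X]} {n : ℕ} (h : a.natDegree < n) : divX^[n] a = 0 := by
  obtain ⟨m, rfl⟩ : ∃ m, n = m + 1 := ⟨n - 1, by omega⟩
  rw [Function.iterate_succ_apply', divX_eq_zero_iff]
  apply eq_C_of_natDegree_eq_zero
  rw [natDegree_iterate_divX]; omega

theorem coeff_iterate_divX (a : k[X]) (n i : ℕ) : (divX^[n] a).coeff i = a.coeff (n + i) := by
  induction n generalizing i with
  | zero => simp
  | succ n ih => rw [Function.iterate_succ_apply', coeff_divX, ih]; congr 1; ring

theorem coeff_torsionPoly (T : Module.End k E) (a : k[X]) (x : E) (i : ℕ) :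
    (torsionPoly T a x).coeff i = aeval T (divX^[i + 1] a) x := by
  rw [torsionPoly_apply, finsetSum_coeff]
  simp only [coeff_monomial, Finset.sum_ite_eq', Finset.mem_range]
  split_ifs with h
  · rfl
  · rw [iterate_divX_eq_zero (by omega)]; simp

theorem coeff_torsionPoly_top (T : Module.End k E) {a : k[X]} (ha : a.Monic)
    (hd : 0 < a.natDegree) (x : E) : (torsionPoly T a x).coeff (a.natDegree - 1) = x := by
  have h : divX^[a.natDegree - 1 + 1] a = 1 := by
    rw [Nat.sub_add_cancel hd]
    rw [eq_C_of_natDegree_eq_zero (p := divX^[a.natDegree] a) (by rw [natDegree_iterate_divX]; omega),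
      coeff_iterate_divX, add_zero, ha.coeff_natDegree, C_1]
  rw [coeff_torsionPoly, h]; simp

theorem X_mul_torsionPoly (T : Module.End k E) (a : k[X]) {x : E} (hx : aeval T a x = 0) :
    X * torsionPoly T a x = torsionPoly T a (T x) + a.map (algebraMap k E) * C x := by
  have hcomm : ∀ b : k[X], aeval T b (T x) = aeval T (X * b) x := by
    intro b
    rw [mul_comm, map_mul, aeval_X]; rfl
  have hstep : ∀ b : k[X], X * divX b = b - C (b.coeff 0) := by
    intro b
    rw [eq_sub_iff_add_eq]; exact X_mul_divX_add b
  ext i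
  rw [coeff_add, coeff_mul_C, coeff_map, coeff_torsionPoly, hcomm, Function.iterate_succ_apply',
    hstep, coeff_iterate_divX, add_zero]
  rw [map_sub, aeval_C, LinearMap.sub_apply, Module.algebraMap_end_apply, Algebra.smul_def,
    sub_add_cancel]
  cases i with
  | zero => rw [mul_coeff_zero, coeff_X_zero, zero_mul]; simpa using hx.symm
  | succ i => rw [coeff_X_mul, coeff_torsionPoly]

end TorsionPolynomial

section Reduction

open WithZero

variable (k : Type*) [Field k] {E : Type*} [Field E] [Algebra k E]

/-- A residue map for a valuation, with values in an extension of the field of constants. -/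
structure Reduction (v : Valuation E ℤᵐ⁰) (κ : Type*) [Field κ] [Algebra k κ] where
  hom : v.valuationSubring →+* κ
  hom_eq_zero_iff : ∀ x, hom x = 0 ↔ v x < 1
  val_algebraMap_le : ∀ c : k, v (algebraMap k E c) ≤ 1
  hom_algebraMap : ∀ c : k, hom ⟨algebraMap k E c, val_algebraMap_le c⟩ = algebraMap k κ c

variable {k}

theorem val_algebraMap_of_finite [Finite k] (v : Valuation E ℤᵐ⁰) {c : k} (hc : c ≠ 0) :
    v (algebraMap k E c) = 1 := by
  have := Fintype.ofFinite k
  have h := FiniteField.pow_card_sub_one_eq_one c hc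
  have h2 : v (algebraMap k E c) ^ (Fintype.card k - 1) = 1 := by
    rw [← map_pow, ← map_pow, h, map_one, map_one]
  refine (pow_eq_one_iff_of_nonneg zero_le ?_).1 h2
  have := Fintype.one_lt_card (α := k)
  omega

theorem exists_reduction {k : Type*} {E : Type} [Field k] [Field E] [Algebra k E] [Finite k]
    (v : Valuation E ℤᵐ⁰) :
    ∃ (κ : Type) (_ : Field κ) (_ : Algebra k κ), Nonempty (Reduction k v κ) := by
  have hle : ∀ c : k, v (algebraMap k E c) ≤ 1 := by
    intro c
    rcases eq_or_ne c 0 with rfl | hc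
    · simp
    · exact (val_algebraMap_of_finite v hc).le
  let f : k →+* v.valuationSubring := (algebraMap k E).codRestrict _ hle
  let g := (IsLocalRing.residue v.valuationSubring)
  refine ⟨IsLocalRing.ResidueField v.valuationSubring, inferInstance, (g.comp f).toAlgebra, ?_⟩
  let := (g.comp f).toAlgebra
  refine ⟨⟨g, fun x => ?_, hle, fun c => rfl⟩⟩
  rw [IsLocalRing.residue_eq_zero_iff, IsLocalRing.mem_maximalIdeal, mem_nonunits_iff,
    (Valuation.valuationSubring.integers v).isUnit_iff_valuation_eq_one]
  exact ⟨fun h => lt_of_le_of_ne x.2 h, fun h => h.ne⟩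

namespace Reduction

variable {v : Valuation E ℤᵐ⁰} {κ : Type*} [Field κ] [Algebra k κ] (R : Reduction k v κ)

open Classical in
/-- The residue map extended by zero. -/
def red (x : E) : κ := if h : v x ≤ 1 then R.hom ⟨x, h⟩ else 0

theorem red_of_le {x : E} (h : v x ≤ 1) : R.red x = R.hom ⟨x, h⟩ := dif_pos h

theorem hom_eq_red (x : v.valuationSubring) : R.hom x = R.red x := (R.red_of_le x.2).symm

theorem red_eq_zero_iff {x : E} (h : v x ≤ 1) : R.red x = 0 ↔ v x < 1 := by
  rw [R.red_of_le h, R.hom_eq_zero_iff]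

theorem red_add {x y : E} (hx : v x ≤ 1) (hy : v y ≤ 1) : R.red (x + y) = R.red x + R.red y := by
  rw [R.red_of_le hx, R.red_of_le hy, R.red_of_le ((v.map_add x y).trans (max_le hx hy)), ← map_add]
  rfl

theorem red_mul {x y : E} (hx : v x ≤ 1) (hy : v y ≤ 1) : R.red (x * y) = R.red x * R.red y := by
  have h : v (x * y) ≤ 1 := by rw [map_mul]; exact mul_le_one' hx hy
  rw [R.red_of_le hx, R.red_of_le hy, R.red_of_le h]
  exact map_mul R.hom ⟨x, hx⟩ ⟨y, hy⟩

theorem red_zero : R.red 0 = 0 := by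
  rw [R.red_of_le (by simp)]; exact map_zero R.hom

theorem red_one : R.red 1 = 1 := by
  rw [R.red_of_le (by simp)]; exact map_one R.hom

theorem red_neg {x : E} (hx : v x ≤ 1) : R.red (-x) = -R.red x := by
  rw [R.red_of_le hx, R.red_of_le (by rwa [Valuation.map_neg]), ← map_neg]
  rfl

theorem red_sub {x y : E} (hx : v x ≤ 1) (hy : v y ≤ 1) : R.red (x - y) = R.red x - R.red y := by
  rw [sub_eq_add_neg, R.red_add hx (by rwa [Valuation.map_neg]), R.red_neg hy, sub_eq_add_neg]

theorem red_pow {x : E} (hx : v x ≤ 1) (n : ℕ) : R.red (x ^ n) = R.red x ^ n := by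
  have h : v (x ^ n) ≤ 1 := by rw [map_pow]; exact pow_le_one' hx n
  rw [R.red_of_le hx, R.red_of_le h]
  exact map_pow R.hom ⟨x, hx⟩ n

theorem red_algebraMap (c : k) : R.red (algebraMap k E c) = algebraMap k κ c := by
  rw [R.red_of_le (R.val_algebraMap_le c), R.hom_algebraMap]

theorem red_eq_red_iff {x y : E} (hx : v x ≤ 1) (hy : v y ≤ 1) :
    R.red x = R.red y ↔ v (x - y) < 1 := by
  rw [← sub_eq_zero, ← R.red_sub hx hy,
    R.red_eq_zero_iff ((v.map_sub x y).trans (max_le hx hy))]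

end Reduction

end Reduction

section InfinityEstimates

open WithZero

variable {Fq : Type*} [Field Fq] [Fintype Fq] {E : Type*} [Field E] [Algebra Fq E]
  {v : Valuation E ℤᵐ⁰} {r : ℕ} {θ x₀ : E}

theorem val_pow_lt_of_val_drinfeldT_le (hr : 2 ≤ r) (hθ : 1 < v θ) (hx₀ : x₀ ≠ 0)
    (hmax : v (drinfeldT Fq r θ x₀) ≤ v x₀) : v x₀ ^ (Fintype.card Fq ^ (r - 1) - 1) < v θ := by
  have hq : 1 < Fintype.card Fq := Fintype.one_lt_card
  have hQ : 1 < Fintype.card Fq ^ (r - 1) := Nat.one_lt_pow (by omega) hq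
  have hQr : Fintype.card Fq ^ (r - 1) ≤ Fintype.card Fq ^ r :=
    Nat.pow_le_pow_right (by omega) (by omega)
  have hv0 : 0 < v x₀ := zero_lt_iff.2 ((Valuation.ne_zero_iff v).2 hx₀)
  by_contra! h
  have h1 : 1 < v x₀ := by
    by_contra! h1
    exact (hθ.trans_le (h.trans (pow_le_one' h1 _))).false
  have hA : v (θ * x₀) ≤ v (x₀ ^ Fintype.card Fq ^ (r - 1)) := by
    rw [map_mul, map_pow, ← Nat.sub_add_cancel hQ.le, pow_succ]
    exact mul_le_mul_left h _
  have hB : v (x₀ ^ Fintype.card Fq ^ (r - 1)) <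
      v (θ ^ (Fintype.card Fq - 1) * x₀ ^ Fintype.card Fq ^ r) := by
    rw [map_mul, map_pow, map_pow, map_pow]
    calc v x₀ ^ Fintype.card Fq ^ (r - 1) ≤ v x₀ ^ Fintype.card Fq ^ r := pow_le_pow_right' h1.le hQr
      _ = 1 * v x₀ ^ Fintype.card Fq ^ r := (one_mul _).symm
      _ < _ := mul_lt_mul_of_pos_right (one_lt_pow' hθ (by omega)) (pow_pos hv0 _)
  have hAB : v (θ * x₀ + x₀ ^ Fintype.card Fq ^ (r - 1)) <
      v (θ ^ (Fintype.card Fq - 1) * x₀ ^ Fintype.card Fq ^ r) :=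
    Valuation.map_add_lt v (hA.trans_lt hB) hB
  rw [drinfeldT_apply, Valuation.map_add_eq_of_lt_right v hAB] at hmax
  have h2 : v x₀ ≤ v (x₀ ^ Fintype.card Fq ^ (r - 1)) := by
    rw [map_pow]
    exact le_self_pow h1.le (by omega)
  exact (h2.trans_lt hB).not_ge hmax

theorem drinfeldT_eq_mul (hr : 2 ≤ r) (hθ : θ ≠ 0) (hx₀ : x₀ ≠ 0) (z : E) :
    drinfeldT Fq r θ (z * x₀) = θ * x₀ * (z + x₀ ^ (Fintype.card Fq ^ (r - 1) - 1) / θ *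
      z ^ Fintype.card Fq ^ (r - 1) + θ ^ (Fintype.card Fq - 2) *
      x₀ ^ (Fintype.card Fq ^ r - 1) * z ^ Fintype.card Fq ^ r) := by
  have hq : 1 < Fintype.card Fq := Fintype.one_lt_card
  have hQ : 1 < Fintype.card Fq ^ (r - 1) := Nat.one_lt_pow (by omega) hq
  have hqr : 1 < Fintype.card Fq ^ r := Nat.one_lt_pow (by omega) hq
  have e1 : x₀ ^ Fintype.card Fq ^ (r - 1) = x₀ ^ (Fintype.card Fq ^ (r - 1) - 1) * x₀ := by
    rw [← pow_succ, Nat.sub_add_cancel hQ.le]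
  have e2 : x₀ ^ Fintype.card Fq ^ r = x₀ ^ (Fintype.card Fq ^ r - 1) * x₀ := by
    rw [← pow_succ, Nat.sub_add_cancel hqr.le]
  have e3 : θ ^ (Fintype.card Fq - 1) = θ ^ (Fintype.card Fq - 2) * θ := by
    rw [← pow_succ]; congr 1; omega
  rw [drinfeldT_apply, mul_pow, mul_pow, e1, e2, e3]
  field_simp

theorem val_one_add_lt (hr : 2 ≤ r) (hθ : 1 < v θ) (hx₀ : x₀ ≠ 0)
    (hmax : v (drinfeldT Fq r θ x₀) ≤ v x₀) :
    v (1 + θ ^ (Fintype.card Fq - 2) * x₀ ^ (Fintype.card Fq ^ r - 1)) < 1 := by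
  have hθ0 : θ ≠ 0 := (Valuation.ne_zero_iff v).1 (zero_lt_one.trans hθ).ne'
  have hv0 : 0 < v x₀ := zero_lt_iff.2 ((Valuation.ne_zero_iff v).2 hx₀)
  have h1 := val_pow_lt_of_val_drinfeldT_le hr hθ hx₀ hmax
  have h2 := drinfeldT_eq_mul (Fq := Fq) hr hθ0 hx₀ 1
  rw [one_mul] at h2
  simp only [one_pow, mul_one] at h2
  set w := θ ^ (Fintype.card Fq - 2) * x₀ ^ (Fintype.card Fq ^ r - 1)
  set ε := x₀ ^ (Fintype.card Fq ^ (r - 1) - 1) / θ with hε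
  have e : 1 + w = drinfeldT Fq r θ x₀ / (θ * x₀) - ε := by
    rw [h2]; field_simp; ring
  rw [e]
  refine Valuation.map_sub_lt v ?_ ?_
  · rw [map_div₀, map_mul, div_lt_one₀ (mul_pos (zero_lt_one.trans hθ) hv0)]
    refine hmax.trans_lt ?_
    calc v x₀ = 1 * v x₀ := (one_mul _).symm
      _ < v θ * v x₀ := mul_lt_mul_of_pos_right hθ hv0
  · rw [hε, map_div₀, map_pow, div_lt_one₀ (zero_lt_one.trans hθ)]
    exact h1

theorem val_mul_pow_eq_one (hr : 2 ≤ r) (hθ : 1 < v θ) (hx₀ : x₀ ≠ 0)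
    (hmax : v (drinfeldT Fq r θ x₀) ≤ v x₀) :
    v θ ^ (Fintype.card Fq - 2) * v x₀ ^ (Fintype.card Fq ^ r - 1) = 1 := by
  have h := val_one_add_lt hr hθ hx₀ hmax
  rw [← map_pow, ← map_pow, ← map_mul, ← Valuation.map_neg]
  have h2 := Valuation.map_sub_eq_of_lt_left v (x := 1) (y := 1 + θ ^ (Fintype.card Fq - 2) * x₀ ^ (Fintype.card Fq ^ r - 1)) (by rwa [map_one])
  rw [map_one] at h2
  rw [← h2]
  congr 1; ring

theorem val_sub_pow_lt_one (hr : 2 ≤ r) (hθ : 1 < v θ) (hx₀ : x₀ ≠ 0)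
    (hmax : v (drinfeldT Fq r θ x₀) ≤ v x₀) {x : E} (hx : v x ≤ v x₀)
    (hTx : v (drinfeldT Fq r θ x) ≤ v x₀) :
    v (x / x₀ - (x / x₀) ^ Fintype.card Fq ^ r) < 1 := by
  have hθ0 : θ ≠ 0 := (Valuation.ne_zero_iff v).1 (zero_lt_one.trans hθ).ne'
  have hv0 : 0 < v x₀ := zero_lt_iff.2 ((Valuation.ne_zero_iff v).2 hx₀)
  have h1 := val_pow_lt_of_val_drinfeldT_le hr hθ hx₀ hmax
  have h3 := val_one_add_lt hr hθ hx₀ hmax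
  have h2 := drinfeldT_eq_mul (Fq := Fq) hr hθ0 hx₀ (x / x₀)
  rw [div_mul_cancel₀ _ hx₀] at h2
  set w := θ ^ (Fintype.card Fq - 2) * x₀ ^ (Fintype.card Fq ^ r - 1)
  set ε := x₀ ^ (Fintype.card Fq ^ (r - 1) - 1) / θ with hε
  set z := x / x₀ with hz
  have hz1 : v z ≤ 1 := by rw [hz, map_div₀, div_le_one₀ hv0]; exact hx
  have e : z - z ^ Fintype.card Fq ^ r = drinfeldT Fq r θ x / (θ * x₀)
      - ε * z ^ Fintype.card Fq ^ (r - 1) - (1 + w) * z ^ Fintype.card Fq ^ r := by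
    rw [h2]; field_simp; ring
  rw [e]
  refine Valuation.map_sub_lt v (Valuation.map_sub_lt v ?_ ?_) ?_
  · rw [map_div₀, map_mul, div_lt_one₀ (mul_pos (zero_lt_one.trans hθ) hv0)]
    refine hTx.trans_lt ?_
    calc v x₀ = 1 * v x₀ := (one_mul _).symm
      _ < v θ * v x₀ := mul_lt_mul_of_pos_right hθ hv0
  · rw [map_mul, map_pow]
    refine (mul_le_of_le_one_right' (pow_le_one' hz1 _)).trans_lt ?_
    rw [hε, map_div₀, map_pow, div_lt_one₀ (zero_lt_one.trans hθ)]
    exact h1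
  · rw [map_mul, map_pow]
    exact (mul_le_of_le_one_right' (pow_le_one' hz1 _)).trans_lt h3

theorem val_drinfeldT_of_lt (hr : 2 ≤ r) (hθ : 1 < v θ) (hx₀ : x₀ ≠ 0)
    (hmax : v (drinfeldT Fq r θ x₀) ≤ v x₀) {x : E} (hx : v x < v x₀) :
    v (drinfeldT Fq r θ x) = v θ * v x := by
  have hq : 1 < Fintype.card Fq := Fintype.one_lt_card
  have hqr : 1 < Fintype.card Fq ^ r := Nat.one_lt_pow (by omega) hq
  have hQ : 1 < Fintype.card Fq ^ (r - 1) := Nat.one_lt_pow (by omega) hq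
  rcases eq_or_ne x 0 with rfl | hx0
  · simp
  have hθ0 : θ ≠ 0 := (Valuation.ne_zero_iff v).1 (zero_lt_one.trans hθ).ne'
  have hvx : 0 < v x := zero_lt_iff.2 ((Valuation.ne_zero_iff v).2 hx0)
  have hv0 : 0 < v x₀ := zero_lt_iff.2 ((Valuation.ne_zero_iff v).2 hx₀)
  have h1 := val_pow_lt_of_val_drinfeldT_le hr hθ hx₀ hmax
  have h3 := val_mul_pow_eq_one hr hθ hx₀ hmax
  have h2 := drinfeldT_eq_mul (Fq := Fq) hr hθ0 hx0 1
  rw [one_mul] at h2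
  simp only [one_pow, mul_one] at h2
  rw [h2, add_assoc, map_mul, map_mul, Valuation.map_add_eq_of_lt_left, map_one, mul_one]
  rw [map_one]
  refine Valuation.map_add_lt v ?_ ?_
  · rw [map_div₀, map_pow, div_lt_one₀ (zero_lt_one.trans hθ)]
    exact (pow_le_pow_left' hx.le _).trans_lt h1
  · rw [map_mul, map_pow, map_pow, ← h3]
    refine mul_lt_mul_of_pos_left ?_ (pow_pos (zero_lt_one.trans hθ) _)
    exact pow_lt_pow_left₀ hx zero_le (by omega)

end InfinityEstimates

section ReductionPolynomial

open WithZero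

namespace Reduction

variable {k : Type*} [Field k] {E : Type*} [Field E] [Algebra k E]
  {v : Valuation E ℤᵐ⁰} {κ : Type*} [Field κ] [Algebra k κ] (R : Reduction k v κ)

/-- Coefficientwise residue of a polynomial. -/
def redPoly (p : E[X]) : κ[X] := ∑ i ∈ p.support, monomial i (R.red (p.coeff i))

theorem coeff_redPoly (p : E[X]) (i : ℕ) : (R.redPoly p).coeff i = R.red (p.coeff i) := by
  rw [redPoly, finsetSum_coeff]
  simp only [coeff_monomial]
  rw [Finset.sum_ite_eq']
  split_ifs with h
  · rfl
  · rw [notMem_support_iff.1 h, R.red_zero]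

theorem redPoly_map_subtype (P : v.valuationSubring[X]) :
    R.redPoly (P.map v.valuationSubring.subtype) = P.map R.hom := by
  ext i
  rw [coeff_redPoly, coeff_map, coeff_map, R.hom_eq_red]
  rfl

theorem exists_map_subtype_eq {p : E[X]} (hp : ∀ i, v (p.coeff i) ≤ 1) :
    ∃ P : v.valuationSubring[X], P.map v.valuationSubring.subtype = p := by
  refine (lifts_iff_set_range _).1 ((lifts_iff_coeff_lifts _).2 fun i => ?_)
  exact ⟨⟨p.coeff i, hp i⟩, rfl⟩

theorem redPoly_add {p q : E[X]} (hp : ∀ i, v (p.coeff i) ≤ 1) (hq : ∀ i, v (q.coeff i) ≤ 1) :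
    R.redPoly (p + q) = R.redPoly p + R.redPoly q := by
  obtain ⟨P, rfl⟩ := exists_map_subtype_eq hp
  obtain ⟨Q, rfl⟩ := exists_map_subtype_eq hq
  rw [← Polynomial.map_add, redPoly_map_subtype, redPoly_map_subtype, redPoly_map_subtype,
    Polynomial.map_add]

theorem redPoly_mul {p q : E[X]} (hp : ∀ i, v (p.coeff i) ≤ 1) (hq : ∀ i, v (q.coeff i) ≤ 1) :
    R.redPoly (p * q) = R.redPoly p * R.redPoly q := by
  obtain ⟨P, rfl⟩ := exists_map_subtype_eq hp
  obtain ⟨Q, rfl⟩ := exists_map_subtype_eq hq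
  rw [← Polynomial.map_mul, redPoly_map_subtype, redPoly_map_subtype, redPoly_map_subtype,
    Polynomial.map_mul]

theorem val_coeff_mul_le {p q : E[X]} (hp : ∀ i, v (p.coeff i) ≤ 1)
    (hq : ∀ i, v (q.coeff i) ≤ 1) (i : ℕ) : v ((p * q).coeff i) ≤ 1 := by
  obtain ⟨P, rfl⟩ := exists_map_subtype_eq hp
  obtain ⟨Q, rfl⟩ := exists_map_subtype_eq hq
  rw [← Polynomial.map_mul, coeff_map]
  exact ((P * Q).coeff i).2

theorem redPoly_det {n : Type*} [Fintype n] [DecidableEq n] {N : Matrix n n E[X]}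
    (hN : ∀ i j m, v ((N i j).coeff m) ≤ 1) : R.redPoly N.det = (N.map R.redPoly).det := by
  choose P hP using fun i j => exists_map_subtype_eq (hN i j)
  obtain rfl : (Matrix.of P).map (mapRingHom v.valuationSubring.subtype) = N := by
    ext1 i j; exact hP i j
  have h := RingHom.map_det (mapRingHom v.valuationSubring.subtype) (Matrix.of P)
  rw [← RingHom.mapMatrix_apply, ← h, coe_mapRingHom, redPoly_map_subtype, ← coe_mapRingHom,
    RingHom.map_det]
  congr 1
  ext1 i j
  exact (R.redPoly_map_subtype _).symm

theorem val_coeff_det_le {n : Type*} [Fintype n] [DecidableEq n] {N : Matrix n n E[X]}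
    (hN : ∀ i j m, v ((N i j).coeff m) ≤ 1) (m : ℕ) : v (N.det.coeff m) ≤ 1 := by
  choose P hP using fun i j => exists_map_subtype_eq (hN i j)
  obtain rfl : (Matrix.of P).map (mapRingHom v.valuationSubring.subtype) = N := by
    ext1 i j; exact hP i j
  have h := RingHom.map_det (mapRingHom v.valuationSubring.subtype) (Matrix.of P)
  rw [← RingHom.mapMatrix_apply, ← h, coe_mapRingHom, coeff_map]
  exact ((Matrix.of P).det.coeff m).2

theorem val_coeff_map_le (R : Reduction k v κ) (b : k[X]) (i : ℕ) : v ((b.map (algebraMap k E)).coeff i) ≤ 1 := by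
  rw [coeff_map]; exact R.val_algebraMap_le _

theorem redPoly_map (b : k[X]) : R.redPoly (b.map (algebraMap k E)) = b.map (algebraMap k κ) := by
  ext i
  rw [coeff_redPoly, coeff_map, coeff_map, R.red_algebraMap]

theorem redPoly_C (x : E) : R.redPoly (C x) = C (R.red x) := by
  ext i
  rw [coeff_redPoly, coeff_C, coeff_C]
  split_ifs
  · rfl
  · exact R.red_zero

theorem redPoly_X : R.redPoly X = X := by
  simpa using R.redPoly_map (X : k[X])

theorem redPoly_eq_zero_iff {p : E[X]} (hp : ∀ i, v (p.coeff i) ≤ 1) :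
    R.redPoly p = 0 ↔ ∀ i, v (p.coeff i) < 1 := by
  rw [Polynomial.ext_iff]
  refine forall_congr' fun i => ?_
  rw [coeff_redPoly, coeff_zero, R.red_eq_zero_iff (hp i)]

/-- Divisibility by a polynomial over the constants is preserved by reduction. -/
theorem map_dvd_redPoly {b : k[X]} (hb : b.Monic) {p : E[X]} (hp : ∀ i, v (p.coeff i) ≤ 1)
    (h : b.map (algebraMap k E) ∣ p) : b.map (algebraMap k κ) ∣ R.redPoly p := by
  obtain ⟨P, rfl⟩ := exists_map_subtype_eq hp
  obtain ⟨B, hB⟩ := exists_map_subtype_eq (R.val_coeff_map_le b)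
  have hinj : Function.Injective v.valuationSubring.subtype := Subtype.val_injective
  have hBm : B.Monic := monic_of_injective hinj (by rw [hB]; exact hb.map _)
  rw [← hB] at h
  have h2 : B ∣ P := (map_dvd_map _ hinj hBm).1 h
  have h3 : B.map R.hom = b.map (algebraMap k κ) := by
    rw [← R.redPoly_map b, ← hB, redPoly_map_subtype]
  rw [← h3, redPoly_map_subtype]
  exact Polynomial.map_dvd R.hom h2

end Reduction

end ReductionPolynomial

theorem aeval_mem_drinfeldTorsion {Fq : Type*} [Field Fq] [Fintype Fq] {E : Type*} [Field E]
    [Algebra Fq E] {r : ℕ} {θ : E} {a : Fq[X]} (b : Fq[X]) {x : E}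
    (hx : x ∈ drinfeldTorsion r θ a) :
    aeval (drinfeldT Fq r θ) b x ∈ drinfeldTorsion r θ a := by
  rw [mem_drinfeldTorsion] at hx ⊢
  rw [← Module.End.mul_apply, ← map_mul, mul_comm, map_mul, Module.End.mul_apply, hx, map_zero]

theorem drinfeldT_mem_drinfeldTorsion {Fq : Type*} [Field Fq] [Fintype Fq] {E : Type*} [Field E]
    [Algebra Fq E] {r : ℕ} {θ : E} {a : Fq[X]} {x : E} (hx : x ∈ drinfeldTorsion r θ a) :
    drinfeldT Fq r θ x ∈ drinfeldTorsion r θ a := by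
  simpa using aeval_mem_drinfeldTorsion X hx

section FixedField

variable (k : Type*) [Field k] [Fintype k] (κ : Type*) [Field κ] [Algebra k κ]

/-- The subfield of elements fixed by the `r`-th power of the Frobenius. -/
def frobeniusFixed (r : ℕ) : IntermediateField k κ where
  toSubalgebra := AlgHom.equalizer ((FiniteField.frobeniusAlgHom k κ) ^ r) (AlgHom.id k κ)
  inv_mem' := fun x hx => by
    have h : ((FiniteField.frobeniusAlgHom k κ) ^ r) x = x := hx
    change ((FiniteField.frobeniusAlgHom k κ) ^ r) x⁻¹ = x⁻¹
    rw [map_inv₀, h]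

variable {k κ}

theorem mem_frobeniusFixed {r : ℕ} {z : κ} :
    z ∈ frobeniusFixed k κ r ↔ z ^ Fintype.card k ^ r = z := by
  have h : ((FiniteField.frobeniusAlgHom k κ) ^ r) z = z ^ Fintype.card k ^ r := by
    induction r with
    | zero => simp
    | succ n ih =>
      rw [pow_succ', AlgHom.mul_apply, ih, FiniteField.frobeniusAlgHom_apply, ← pow_mul, ← pow_succ]
  rw [← h]; rfl

theorem finite_frobeniusFixed {r : ℕ} (hr : r ≠ 0) :
    Finite (frobeniusFixed k κ r) ∧ Nat.card (frobeniusFixed k κ r) ≤ Fintype.card k ^ r := by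
  classical
  have hq : 1 < Fintype.card k ^ r := Nat.one_lt_pow hr Fintype.one_lt_card
  have h0 := FiniteField.X_pow_card_sub_X_ne_zero κ hq
  have h1 := FiniteField.X_pow_card_sub_X_natDegree_eq κ hq
  have hs : ((frobeniusFixed k κ r : Set κ)) =
      ((X ^ (Fintype.card k ^ r) - X : κ[X]).roots.toFinset : Set κ) := by
    ext z
    simp [mem_frobeniusFixed, h0, sub_eq_zero]
  constructor
  · change Finite (frobeniusFixed k κ r : Set κ)
    rw [hs]; exact Finite.of_fintype _
  · change Nat.card (frobeniusFixed k κ r : Set κ) ≤ _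
    rw [hs, Nat.card_coe_set_eq, Set.ncard_coe_finset]
    exact (Multiset.toFinset_card_le _).trans ((card_roots' _).trans_eq h1)

end FixedField

section InfinityResidue

open WithZero

variable {Fq : Type*} [Field Fq] [Fintype Fq] {E : Type*} [Field E] [Algebra Fq E]
  {v : Valuation E ℤᵐ⁰} {κ : Type*} [Field κ] [Algebra Fq κ] (R : Reduction Fq v κ)
  {r : ℕ} {θ x₀ : E} {a : Fq[X]}

/-- At a place at infinity, `x₀` is an `a`-torsion point of maximal absolute value. -/
structure IsMaxTorsion (v : Valuation E ℤᵐ⁰) (r : ℕ) (θ : E) (a : Fq[X]) (x₀ : E) : Prop where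
  two_le : 2 ≤ r
  one_lt : 1 < v θ
  monic : a.Monic
  natDegree_pos : 0 < a.natDegree
  mem : x₀ ∈ drinfeldTorsion r θ a
  ne_zero : x₀ ≠ 0
  le : ∀ y ∈ drinfeldTorsion r θ a, v y ≤ v x₀

/-- The residue of the torsion polynomial of `x`, normalized by `x₀`. -/
def Reduction.infPoly (r : ℕ) (θ : E) (a : Fq[X]) (x₀ x : E) : κ[X] :=
  R.redPoly (C x₀⁻¹ * torsionPoly (drinfeldT Fq r θ) a x)

theorem coeff_C_inv_mul_torsionPoly (x : E) (i : ℕ) :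
    (C x₀⁻¹ * torsionPoly (drinfeldT Fq r θ) a x).coeff i =
      aeval (drinfeldT Fq r θ) (divX^[i + 1] a) x / x₀ := by
  rw [coeff_C_mul, coeff_torsionPoly, div_eq_inv_mul]

theorem Reduction.coeff_infPoly (x : E) (i : ℕ) : (R.infPoly r θ a x₀ x).coeff i =
    R.red (aeval (drinfeldT Fq r θ) (divX^[i + 1] a) x / x₀) := by
  rw [Reduction.infPoly, R.coeff_redPoly, coeff_C_inv_mul_torsionPoly]

theorem Reduction.degree_infPoly_lt (x : E) : (R.infPoly r θ a x₀ x).degree < a.natDegree := by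
  rw [degree_lt_iff_coeff_zero]
  intro m hm
  rw [R.coeff_infPoly, iterate_divX_eq_zero (by omega)]
  simp [R.red_zero]

namespace IsMaxTorsion

variable (H : IsMaxTorsion v r θ a x₀)
include H

theorem val_div_le {y : E} (hy : y ∈ drinfeldTorsion r θ a) : v (y / x₀) ≤ 1 := by
  rw [map_div₀, div_le_one₀ (zero_lt_iff.2 ((Valuation.ne_zero_iff v).2 H.ne_zero))]
  exact H.le y hy

theorem val_coeff_le {x : E} (hx : x ∈ drinfeldTorsion r θ a) (i : ℕ) :
    v ((C x₀⁻¹ * torsionPoly (drinfeldT Fq r θ) a x).coeff i) ≤ 1 := by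
  rw [coeff_C_inv_mul_torsionPoly]
  exact H.val_div_le (aeval_mem_drinfeldTorsion _ hx)

theorem infPoly_add {x y : E} (hx : x ∈ drinfeldTorsion r θ a) (hy : y ∈ drinfeldTorsion r θ a) :
    R.infPoly r θ a x₀ (x + y) = R.infPoly r θ a x₀ x + R.infPoly r θ a x₀ y := by
  rw [Reduction.infPoly, map_add, mul_add, R.redPoly_add (H.val_coeff_le hx) (H.val_coeff_le hy)]
  rfl

theorem infPoly_smul (c : Fq) {x : E} (hx : x ∈ drinfeldTorsion r θ a) :
    R.infPoly r θ a x₀ (c • x) = c • R.infPoly r θ a x₀ x := by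
  ext i
  rw [R.coeff_infPoly, coeff_smul, R.coeff_infPoly, map_smul, Algebra.smul_def, mul_div_assoc,
    R.red_mul (R.val_algebraMap_le c) (H.val_div_le (aeval_mem_drinfeldTorsion _ hx)),
    R.red_algebraMap, Algebra.smul_def]

theorem coeff_infPoly_top (x : E) :
    (R.infPoly r θ a x₀ x).coeff (a.natDegree - 1) = R.red (x / x₀) := by
  rw [R.coeff_infPoly, ← coeff_torsionPoly, coeff_torsionPoly_top _ H.monic H.natDegree_pos]

theorem X_mul_infPoly {x : E} (hx : x ∈ drinfeldTorsion r θ a) :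
    X * R.infPoly r θ a x₀ x = R.infPoly r θ a x₀ (drinfeldT Fq r θ x) +
      a.map (algebraMap Fq κ) * C (R.red (x / x₀)) := by
  have hC : ∀ i, v ((C (x / x₀)).coeff i) ≤ 1 := by
    intro i
    rw [coeff_C]
    split_ifs
    · exact H.val_div_le hx
    · simp
  have hX : ∀ i, v ((X : E[X]).coeff i) ≤ 1 := by
    intro i
    rw [coeff_X]; split_ifs <;> simp
  have h := X_mul_torsionPoly (drinfeldT Fq r θ) a hx
  rw [Reduction.infPoly, Reduction.infPoly, ← R.redPoly_X, ← R.redPoly_mul hX (H.val_coeff_le hx),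
    mul_left_comm, h, mul_add, R.redPoly_add (H.val_coeff_le (drinfeldT_mem_drinfeldTorsion hx)),
    ← R.redPoly_map, ← R.redPoly_C, ← R.redPoly_mul (R.val_coeff_map_le a) hC, mul_left_comm,
    ← C_mul, div_eq_inv_mul]
  rw [mul_left_comm, ← C_mul, ← div_eq_inv_mul]
  exact Reduction.val_coeff_mul_le (R.val_coeff_map_le a) hC

theorem eq_zero_of_infPoly_eq_zero [Finite (drinfeldTorsion r θ a)] {x : E}
    (hx : x ∈ drinfeldTorsion r θ a) (h0 : R.infPoly r θ a x₀ x = 0) : x = 0 := by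
  let K := {y : E // y ∈ drinfeldTorsion r θ a ∧ R.infPoly r θ a x₀ y = 0}
  have : Finite K := Finite.of_injective
    (fun y : K => (⟨y.1, y.2.1⟩ : drinfeldTorsion r θ a)) fun y z h =>
      Subtype.ext (by simpa using h)
  have : Nonempty K := ⟨⟨x, hx, h0⟩⟩
  obtain ⟨y, hy⟩ := Finite.exists_max fun y : K => v y.1
  have hyx := hy ⟨x, hx, h0⟩
  have hy0 : y.1 = 0 := by
    by_contra hne
    have hred : R.red (y.1 / x₀) = 0 := by
      rw [← H.coeff_infPoly_top R, y.2.2, coeff_zero]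
    have h1 := H.X_mul_infPoly R y.2.1
    rw [hred, y.2.2, mul_zero, C_0, mul_zero, add_zero] at h1
    have h2 := hy ⟨_, drinfeldT_mem_drinfeldTorsion y.2.1, h1.symm⟩
    have hlt : v y.1 < v x₀ := by
      rw [R.red_eq_zero_iff (H.val_div_le y.2.1), map_div₀,
        div_lt_one₀ (zero_lt_iff.2 ((Valuation.ne_zero_iff v).2 H.ne_zero))] at hred
      exact hred
    have h3 := val_drinfeldT_of_lt H.two_le H.one_lt H.ne_zero
      (H.le _ (drinfeldT_mem_drinfeldTorsion H.mem)) hlt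
    have h4 : v y.1 < v θ * v y.1 := by
      calc v y.1 = 1 * v y.1 := (one_mul _).symm
        _ < _ := mul_lt_mul_of_pos_right H.one_lt
          (zero_lt_iff.2 ((Valuation.ne_zero_iff v).2 hne))
    simp only at h2
    rw [h3] at h2
    exact h4.not_ge h2
  simp only [hy0, map_zero] at hyx
  exact (Valuation.zero_iff v).1 (le_antisymm hyx zero_le)

theorem coeff_infPoly_mem {x : E} (hx : x ∈ drinfeldTorsion r θ a) (i : ℕ) :
    (R.infPoly r θ a x₀ x).coeff i ∈ frobeniusFixed Fq κ r := by
  have hy := aeval_mem_drinfeldTorsion (divX^[i + 1] a) hx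
  rw [mem_frobeniusFixed, R.coeff_infPoly, ← R.red_pow (H.val_div_le hy), eq_comm,
    R.red_eq_red_iff (H.val_div_le hy) (by rw [map_pow]; exact pow_le_one' (H.val_div_le hy) _)]
  exact val_sub_pow_lt_one H.two_le H.one_lt H.ne_zero
    (H.le _ (drinfeldT_mem_drinfeldTorsion H.mem)) (H.le _ hy)
    (H.le _ (drinfeldT_mem_drinfeldTorsion hy))

theorem exists_map_eq_infPoly {x : E} (hx : x ∈ drinfeldTorsion r θ a) :
    ∃ f : (frobeniusFixed Fq κ r)[X],
      f.map (algebraMap (frobeniusFixed Fq κ r) κ) = R.infPoly r θ a x₀ x :=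
  (lifts_iff_set_range _).1 ((lifts_iff_coeff_lifts _).2
    fun i => ⟨⟨_, H.coeff_infPoly_mem R hx i⟩, rfl⟩)

/-- `Reduction.infPoly` as a linear map into polynomials over a finite field. -/
theorem exists_linearMap : ∃ ρ : drinfeldTorsion r θ a →ₗ[Fq] (frobeniusFixed Fq κ r)[X],
    ∀ x, (ρ x).map (algebraMap (frobeniusFixed Fq κ r) κ) = R.infPoly r θ a x₀ x := by
  choose ρ hρ using fun x : drinfeldTorsion r θ a => H.exists_map_eq_infPoly R x.2
  have hinj := Polynomial.map_injective (algebraMap (frobeniusFixed Fq κ r) κ)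
    (algebraMap (frobeniusFixed Fq κ r) κ).injective
  refine ⟨⟨⟨ρ, fun x y => hinj ?_⟩, fun c x => hinj ?_⟩, hρ⟩
  · rw [Polynomial.map_add, hρ, hρ, hρ]
    exact H.infPoly_add R x.2 y.2
  · rw [hρ]
    refine (H.infPoly_smul R c x.2).trans ?_
    rw [← hρ]
    ext i
    rw [coeff_smul, coeff_map, coeff_map]
    rfl

end IsMaxTorsion

end InfinityResidue

/-- A family of `a`-torsion points forming a basis over `k[X] / (a)`, for the `k[X]`-module
structure on `E` given by `T`. -/
structure IsTorsionBasis {k E ι : Type*} [Field k] [Field E] [Algebra k E] [Fintype ι]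
    (T : Module.End k E) (a : k[X]) (x : ι → E) : Prop where
  mem : ∀ j, aeval T a (x j) = 0
  span : ∀ y, aeval T a y = 0 → ∃ b : ι → k[X], y = ∑ j, aeval T (b j) (x j)
  indep : ∀ b : ι → k[X], ∑ j, aeval T (b j) (x j) = 0 → ∀ j, a ∣ b j

theorem aeval_modByMonic_apply {k V : Type*} [Field k] [AddCommGroup V] [Module k V]
    (T : Module.End k V) {a : k[X]} (b : k[X]) {x : V} (hx : aeval T a x = 0) :
    aeval T (b %ₘ a) x = aeval T b x := by
  conv_rhs => rw [← modByMonic_add_div b a, map_add, mul_comm, map_mul, LinearMap.add_apply,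
    Module.End.mul_apply, hx, map_zero, add_zero]

section Moore

variable (k : Type*) [Field k] [Fintype k] (E : Type*) [Field E] [Algebra k E]

/-- The Frobenius acting on the coefficients of polynomials. -/
def frobeniusCoeff : E[X] →+* E[X] := mapRingHom (FiniteField.frobeniusAlgHom k E : E →+* E)

variable {k E}

theorem coeff_frobeniusCoeff_pow (p : E[X]) (i m : ℕ) :
    ((frobeniusCoeff k E ^ i) p).coeff m = p.coeff m ^ Fintype.card k ^ i := by
  induction i with
  | zero => simp
  | succ i ih =>
    rw [pow_succ', RingHom.mul_def, RingHom.comp_apply, frobeniusCoeff, coe_mapRingHom, coeff_map,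
      pow_succ, pow_mul, ← ih]
    rfl

theorem frobeniusCoeff_pow_map (b : k[X]) (i : ℕ) :
    (frobeniusCoeff k E ^ i) (b.map (algebraMap k E)) = b.map (algebraMap k E) := by
  ext m
  rw [coeff_frobeniusCoeff_pow, coeff_map, ← map_pow, FiniteField.pow_card_pow]

theorem det_moore_ne_zero {n : ℕ} {η : Fin n → E} (hη : LinearIndependent k η) :
    (Matrix.of fun i j : Fin n => η j ^ Fintype.card k ^ (i : ℕ)).det ≠ 0 := by
  classical
  intro h0
  obtain ⟨c, hc, hcv⟩ := Matrix.exists_vecMul_eq_zero_iff.2 h0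
  have hq : 1 < Fintype.card k := Fintype.one_lt_card
  let P : E[X] := ∑ i : Fin n, C (c i) * X ^ Fintype.card k ^ (i : ℕ)
  have hP : P ≠ 0 := by
    obtain ⟨i₀, hi₀⟩ := Function.ne_iff.1 hc
    intro hP
    apply hi₀
    have h1 : P.coeff (Fintype.card k ^ (i₀ : ℕ)) = c i₀ := by
      rw [finsetSum_coeff, Finset.sum_eq_single i₀]
      · simp
      · intro i _ hi
        rw [coeff_C_mul, coeff_X_pow, if_neg, mul_zero]
        intro h
        exact hi (Fin.ext (Nat.pow_right_injective hq h).symm)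
      · simp
    rw [← h1, hP, coeff_zero]; rfl
  have hn : 0 < n := by
    rcases Nat.eq_zero_or_pos n with rfl | h
    · exact absurd (Subsingleton.elim c 0) hc
    · exact h
  have hdeg : P.natDegree ≤ Fintype.card k ^ (n - 1) := by
    refine natDegree_sum_le_of_forall_le _ _ fun i _ => ?_
    refine (natDegree_C_mul_X_pow_le _ _).trans (Nat.pow_le_pow_right (by omega) (by omega))
  let L : (Fin n → k) → E := fun b => ∑ j, b j • η j
  have hL : Function.Injective L := by
    intro b b' h
    have h2 := Fintype.linearIndependent_iff.1 hη (fun j => b j - b' j) (by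
      simp only [sub_smul, Finset.sum_sub_distrib]
      exact sub_eq_zero.2 h)
    funext j
    exact sub_eq_zero.1 (h2 j)
  have hroot : ∀ b, L b ∈ P.roots.toFinset := by
    intro b
    rw [Multiset.mem_toFinset, mem_roots hP, IsRoot.def]
    change (∑ i : Fin n, C (c i) * X ^ Fintype.card k ^ (i : ℕ) : E[X]).eval _ = 0
    simp only [eval_finsetSum, eval_mul, eval_C, eval_pow, eval_X]
    have h1 : ∀ i : Fin n, L b ^ Fintype.card k ^ (i : ℕ) =
        ∑ j, b j • η j ^ Fintype.card k ^ (i : ℕ) := by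
      intro i
      rw [← frobeniusAlgHom_toLinearMap_pow_apply (Fq := k), map_sum]
      refine Finset.sum_congr rfl fun j _ => ?_
      rw [map_smul, frobeniusAlgHom_toLinearMap_pow_apply]
    simp only [h1, Finset.mul_sum]
    rw [Finset.sum_comm]
    refine Finset.sum_eq_zero fun j _ => ?_
    have h2 := congrFun hcv j
    rw [Matrix.vecMul, dotProduct] at h2
    simp only [mul_smul_comm, ← Finset.smul_sum]
    rw [show (∑ i, c i * η j ^ Fintype.card k ^ (i : ℕ)) = 0 from h2, smul_zero]
  have h1 := Finset.card_le_card (s := Finset.univ.image L) (t := P.roots.toFinset) (by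
    intro y hy
    obtain ⟨b, -, rfl⟩ := Finset.mem_image.1 hy
    exact hroot b)
  rw [Finset.card_image_of_injective _ hL, Finset.card_univ, Fintype.card_fun, Fintype.card_fin]
    at h1
  have h2 := h1.trans ((Multiset.toFinset_card_le _).trans ((card_roots' _).trans hdeg))
  exact absurd h2 (not_le.2 (Nat.pow_lt_pow_right hq (by omega)))

end Moore

section InfinityBasis

open WithZero

variable {Fq : Type*} [Field Fq] [Fintype Fq] {E : Type*} [Field E] [Algebra Fq E]
  {v : Valuation E ℤᵐ⁰} {κ : Type*} [Field κ] [Algebra Fq κ] (R : Reduction Fq v κ)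
  {r : ℕ} {θ x₀ : E} {a : Fq[X]}

/-- The determinant of the Frobenius twists of the torsion polynomials of a family. -/
def torsionDet (T : Module.End Fq E) (a : Fq[X]) {n : ℕ} (x : Fin n → E) : E[X] :=
  (Matrix.of fun i j : Fin n => (frobeniusCoeff Fq E ^ (i : ℕ)) (torsionPoly T a (x j))).det

namespace IsMaxTorsion

variable (H : IsMaxTorsion v r θ a x₀)
include H

theorem finrank_eq_and_surjective (hcard : Nat.card (drinfeldTorsion r θ a) =
      Fintype.card Fq ^ (r * a.natDegree))
    {ρ : drinfeldTorsion r θ a →ₗ[Fq] (frobeniusFixed Fq κ r)[X]}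
    (hρ : ∀ x, (ρ x).map (algebraMap (frobeniusFixed Fq κ r) κ) = R.infPoly r θ a x₀ x) :
    Module.finrank Fq (frobeniusFixed Fq κ r) = r ∧
      ∀ f : (frobeniusFixed Fq κ r)[X], f.degree < a.natDegree → ∃ x, ρ x = f := by
  have h2 := H.two_le
  have hd := H.natDegree_pos
  have hq : 1 < Fintype.card Fq := Fintype.one_lt_card
  have : Finite (drinfeldTorsion r θ a) := Nat.finite_of_card_ne_zero (by
    rw [hcard]; exact (pow_pos Fintype.card_pos _).ne')
  obtain ⟨hfin, hle⟩ := finite_frobeniusFixed (k := Fq) (κ := κ) (r := r) (by omega)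
  have hinj := Polynomial.map_injective (algebraMap (frobeniusFixed Fq κ r) κ)
    (algebraMap (frobeniusFixed Fq κ r) κ).injective
  have hdeg : ∀ x, ρ x ∈ degreeLT (frobeniusFixed Fq κ r) a.natDegree := by
    intro x
    rw [mem_degreeLT, ← degree_map_eq_of_injective (algebraMap (frobeniusFixed Fq κ r) κ).injective,
      hρ]
    exact R.degree_infPoly_lt _
  let ρ' : drinfeldTorsion r θ a → degreeLT (frobeniusFixed Fq κ r) a.natDegree :=
    fun x => ⟨ρ x, hdeg x⟩
  have hρ' : Function.Injective ρ' := by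
    intro x y h
    have h1 : ρ x = ρ y := congrArg Subtype.val h
    rw [← sub_eq_zero, ← map_sub] at h1
    have h3 := H.eq_zero_of_infPoly_eq_zero R (x - y).2 (by rw [← hρ, h1, Polynomial.map_zero])
    exact sub_eq_zero.1 (Subtype.ext h3)
  have e := degreeLTEquiv (frobeniusFixed Fq κ r) a.natDegree
  have : Finite (degreeLT (frobeniusFixed Fq κ r) a.natDegree) := Finite.of_equiv _ e.symm.toEquiv
  have hcard2 : Nat.card (degreeLT (frobeniusFixed Fq κ r) a.natDegree) =
      Nat.card (frobeniusFixed Fq κ r) ^ a.natDegree := by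
    rw [Nat.card_congr e.toEquiv, Nat.card_fun, Nat.card_fin]
  have h3 := Nat.card_le_card_of_injective ρ' hρ'
  rw [hcard, hcard2, pow_mul] at h3
  have h4 : Fintype.card Fq ^ r = Nat.card (frobeniusFixed Fq κ r) :=
    le_antisymm ((Nat.pow_le_pow_iff_left hd.ne').1 h3) hle
  constructor
  · have h5 := Module.natCard_eq_pow_finrank (K := Fq) (V := frobeniusFixed Fq κ r)
    rw [← h4, Nat.card_eq_fintype_card] at h5
    exact (Nat.pow_right_injective hq h5).symm
  · intro f hf
    have hb := hρ'.bijective_of_nat_card_le (by rw [hcard, hcard2, pow_mul, h4])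
    obtain ⟨x, hx⟩ := hb.2 ⟨f, mem_degreeLT.2 hf⟩
    exact ⟨x, congrArg Subtype.val hx⟩

theorem map_dvd_infPoly_aeval_sub (b : Fq[X]) {x : E} (hx : x ∈ drinfeldTorsion r θ a) :
    a.map (algebraMap Fq κ) ∣ R.infPoly r θ a x₀ (aeval (drinfeldT Fq r θ) b x) -
      b.map (algebraMap Fq κ) * R.infPoly r θ a x₀ x := by
  induction b using Polynomial.induction_on with
  | C c =>
    rw [aeval_C, map_C, Module.algebraMap_end_apply, H.infPoly_smul R c hx, ← smul_eq_C_mul,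
      algebraMap_smul, sub_self]
    exact dvd_zero _
  | add p q hp hq =>
    rw [map_add, LinearMap.add_apply, H.infPoly_add R (aeval_mem_drinfeldTorsion _ hx)
      (aeval_mem_drinfeldTorsion _ hx), Polynomial.map_add, add_mul, add_sub_add_comm]
    exact dvd_add hp hq
  | monomial n c ih =>
    have h1 := H.X_mul_infPoly R (aeval_mem_drinfeldTorsion (C c * X ^ n) hx)
    have h2 : drinfeldT Fq r θ (aeval (drinfeldT Fq r θ) (C c * X ^ n) x) =
        aeval (drinfeldT Fq r θ) (C c * X ^ (n + 1)) x := by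
      rw [show C c * X ^ (n + 1) = X * (C c * X ^ n) by ring,
        map_mul (aeval (drinfeldT Fq r θ)) X, aeval_X]
      rfl
    rw [← h2, ← sub_eq_of_eq_add h1, show C c * X ^ (n + 1) = X * (C c * X ^ n) by ring,
      Polynomial.map_mul, map_X, sub_right_comm, mul_assoc, ← mul_sub]
    exact dvd_sub (Dvd.dvd.mul_left ih _) (dvd_mul_right _ _)

theorem infPoly_sum_aeval {n : ℕ} {x : Fin n → E} {η : Fin n → κ}
    (hx : ∀ j, x j ∈ drinfeldTorsion r θ a) (hη : ∀ j, R.infPoly r θ a x₀ (x j) = C (η j))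
    {b : Fin n → Fq[X]} (hb : ∀ j, (b j).degree < a.natDegree) :
    R.infPoly r θ a x₀ (∑ j, aeval (drinfeldT Fq r θ) (b j) (x j)) =
      ∑ j, (b j).map (algebraMap Fq κ) * C (η j) := by
  have hsum : ∀ s : Finset (Fin n),
      R.infPoly r θ a x₀ (∑ j ∈ s, aeval (drinfeldT Fq r θ) (b j) (x j)) =
        ∑ j ∈ s, R.infPoly r θ a x₀ (aeval (drinfeldT Fq r θ) (b j) (x j)) := by
    intro s
    induction s using Finset.cons_induction with
    | empty =>
      rw [Finset.sum_empty, Finset.sum_empty]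
      simpa using H.infPoly_smul R 0 (zero_mem (drinfeldTorsion r θ a))
    | cons j s hj ih =>
      rw [Finset.sum_cons, Finset.sum_cons, ← ih]
      exact H.infPoly_add R (aeval_mem_drinfeldTorsion _ (hx j))
        (Submodule.sum_mem _ fun i _ => aeval_mem_drinfeldTorsion _ (hx i))
  rw [hsum]
  refine Finset.sum_congr rfl fun j _ => ?_
  have h1 := H.map_dvd_infPoly_aeval_sub R (b j) (hx j)
  rw [hη] at h1
  refine sub_eq_zero.1 (eq_zero_of_dvd_of_degree_lt h1 ?_)
  rw [degree_map, degree_eq_natDegree H.monic.ne_zero]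
  refine (degree_sub_le _ _).trans_lt (max_lt (R.degree_infPoly_lt _) ?_)
  rw [mul_comm, ← smul_eq_C_mul]
  refine (degree_smul_le _ _).trans_lt ?_
  rw [degree_map]
  exact hb j

theorem exists_isTorsionBasis (hcard : Nat.card (drinfeldTorsion r θ a) =
      Fintype.card Fq ^ (r * a.natDegree)) :
    ∃ (x : Fin r → E) (η : Fin r → κ), (∀ j, R.infPoly r θ a x₀ (x j) = C (η j)) ∧
      LinearIndependent Fq η ∧ IsTorsionBasis (drinfeldT Fq r θ) a x := by
  have : Finite (drinfeldTorsion r θ a) := Nat.finite_of_card_ne_zero (by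
    rw [hcard]; exact (pow_pos Fintype.card_pos _).ne')
  obtain ⟨ρ, hρ⟩ := H.exists_linearMap R
  obtain ⟨hr, hsurj⟩ := H.finrank_eq_and_surjective R hcard hρ
  have : Module.Finite Fq (frobeniusFixed Fq κ r) :=
    Module.finite_of_finrank_pos (by rw [hr]; have := H.two_le; omega)
  let B := Module.finBasisOfFinrankEq Fq (frobeniusFixed Fq κ r) hr
  have hd0 : (0 : WithBot ℕ) < a.natDegree := by exact_mod_cast H.natDegree_pos
  choose x hx using fun j => hsurj (C (B j)) (degree_C_le.trans_lt hd0)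
  have hη : ∀ j, R.infPoly r θ a x₀ (x j) = C (algebraMap (frobeniusFixed Fq κ r) κ (B j)) := by
    intro j
    rw [← hρ, hx, map_C]
  have hli : LinearIndependent Fq fun j => algebraMap (frobeniusFixed Fq κ r) κ (B j) := by
    exact B.linearIndependent.map' (IsScalarTower.toAlgHom Fq (frobeniusFixed Fq κ r) κ).toLinearMap
      (LinearMap.ker_eq_bot.2 (algebraMap (frobeniusFixed Fq κ r) κ).injective)
  refine ⟨fun j => x j, _, hη, hli, fun j => (x j).2, fun y hy => ?_, fun b hb => ?_⟩
  · let g := ρ ⟨y, hy⟩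
    have hgdeg : g.degree < a.natDegree := by
      rw [← degree_map_eq_of_injective (algebraMap (frobeniusFixed Fq κ r) κ).injective, hρ]
      exact R.degree_infPoly_lt _
    let b : Fin r → Fq[X] := fun j =>
      ∑ i ∈ Finset.range a.natDegree, monomial i (B.repr (g.coeff i) j)
    have hbc : ∀ j i, (b j).coeff i = B.repr (g.coeff i) j := by
      intro j i
      rw [finsetSum_coeff]
      simp only [coeff_monomial]
      rw [Finset.sum_ite_eq']
      split_ifs with h
      · rfl
      · rw [(degree_lt_iff_coeff_zero _ _).1 hgdeg i (by simpa using h)]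
        simp
    have hbd : ∀ j, (b j).degree < a.natDegree := by
      intro j
      rw [degree_lt_iff_coeff_zero]
      intro m hm
      rw [hbc, (degree_lt_iff_coeff_zero _ _).1 hgdeg m hm]
      simp
    have h1 := H.infPoly_sum_aeval R (fun j => (x j).2) hη hbd
    refine ⟨b, ?_⟩
    have hmem : (∑ j, aeval (drinfeldT Fq r θ) (b j) (x j : E)) ∈ drinfeldTorsion r θ a :=
      Submodule.sum_mem _ fun i _ => aeval_mem_drinfeldTorsion _ (x i).2
    have h2 : ρ ⟨y, hy⟩ = ρ ⟨_, hmem⟩ := by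
      apply Polynomial.map_injective _ (algebraMap (frobeniusFixed Fq κ r) κ).injective
      rw [hρ ⟨_, hmem⟩, h1]
      ext i
      simp only [finsetSum_coeff, coeff_mul_C, coeff_map, hbc]
      change algebraMap _ κ (g.coeff i) = _
      conv_lhs => rw [← B.sum_repr (g.coeff i)]
      rw [map_sum]
      refine Finset.sum_congr rfl fun j _ => ?_
      rw [Algebra.smul_def, map_mul, ← IsScalarTower.algebraMap_apply]
    rw [← sub_eq_zero, ← map_sub] at h2
    have h3 := H.eq_zero_of_infPoly_eq_zero R
      (⟨y, hy⟩ - ⟨_, hmem⟩ : drinfeldTorsion r θ a).2 (by rw [← hρ, h2, Polynomial.map_zero])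
    exact sub_eq_zero.1 h3
  · have hb2 : ∑ j, aeval (drinfeldT Fq r θ) (b j %ₘ a) (x j : E) = 0 := by
      rw [← hb]
      exact Finset.sum_congr rfl fun j _ => aeval_modByMonic_apply _ (b j) (x j).2
    have hbd : ∀ j, (b j %ₘ a).degree < a.natDegree := fun j => by
      rw [← degree_eq_natDegree H.monic.ne_zero]
      exact degree_modByMonic_lt _ H.monic
    have h1 := H.infPoly_sum_aeval R (fun j => (x j).2) hη hbd
    rw [hb2] at h1
    have h0 : R.infPoly r θ a x₀ 0 = 0 := by
      simpa using H.infPoly_smul R 0 (zero_mem (drinfeldTorsion r θ a))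
    rw [h0] at h1
    intro j
    rw [← modByMonic_eq_zero_iff_dvd H.monic]
    ext i
    have h2 := congrArg (fun p => p.coeff i) h1.symm
    simp only [finsetSum_coeff, coeff_mul_C, coeff_map, coeff_zero] at h2
    exact Fintype.linearIndependent_iff.1 hli (fun j => (b j %ₘ a).coeff i)
      (by simpa only [Algebra.smul_def] using h2) j

theorem not_dvd_torsionDet {n : ℕ} {x : Fin n → E} {η : Fin n → κ}
    (hx : ∀ j, x j ∈ drinfeldTorsion r θ a) (hη : ∀ j, R.infPoly r θ a x₀ (x j) = C (η j))
    (hli : LinearIndependent Fq η) {l : Fq[X]} (hl : l.Monic) (hl0 : 0 < l.natDegree) :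
    ¬ l.map (algebraMap Fq E) ∣ torsionDet (drinfeldT Fq r θ) a x := by
  intro hdvd
  let N : Matrix (Fin n) (Fin n) E[X] := Matrix.of fun i j =>
    (frobeniusCoeff Fq E ^ (i : ℕ)) (C x₀⁻¹ * torsionPoly (drinfeldT Fq r θ) a (x j))
  have hN : N.det = (∏ i : Fin n, (frobeniusCoeff Fq E ^ (i : ℕ)) (C x₀⁻¹)) *
      torsionDet (drinfeldT Fq r θ) a x := by
    rw [torsionDet, ← Matrix.det_mul_column]
    congr 1
    ext1 i j
    simp only [N, Matrix.of_apply, map_mul]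
  have hint : ∀ i j m, v ((N i j).coeff m) ≤ 1 := by
    intro i j m
    simp only [N, Matrix.of_apply]
    rw [coeff_frobeniusCoeff_pow, map_pow]
    exact pow_le_one' (H.val_coeff_le (hx j) m) _
  have h1 := R.map_dvd_redPoly hl (Reduction.val_coeff_det_le hint)
    (by rw [hN]; exact Dvd.dvd.mul_left hdvd _)
  have h2 : N.map R.redPoly =
      (Matrix.of fun i j : Fin n => η j ^ Fintype.card Fq ^ (i : ℕ)).map C := by
    ext1 i j
    ext m
    simp only [N, Matrix.map_apply, Matrix.of_apply]
    rw [R.coeff_redPoly, coeff_frobeniusCoeff_pow, R.red_pow (H.val_coeff_le (hx j) m),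
      ← R.coeff_redPoly]
    have h3 := congrArg (fun p => p.coeff m) (hη j)
    simp only [Reduction.infPoly] at h3
    rw [h3, coeff_C, coeff_C]
    split_ifs
    · rfl
    · exact zero_pow (pow_pos Fintype.card_pos _).ne'
  have h4 := RingHom.map_det C (Matrix.of fun i j : Fin n => η j ^ Fintype.card Fq ^ (i : ℕ))
  rw [R.redPoly_det hint, h2, ← RingHom.mapMatrix_apply, ← h4] at h1
  have h5 := natDegree_le_of_dvd h1 (C_ne_zero.2 (det_moore_ne_zero hli))
  rw [natDegree_C, natDegree_map] at h5
  omega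

end IsMaxTorsion

end InfinityBasis

section GaloisAction

variable {Fq : Type*} [Field Fq] [Fintype Fq] {E : Type*} [Field E] [Algebra Fq E]
  {r : ℕ} {θ : E} {a : Fq[X]}

theorem map_aeval_drinfeldT {L : Type*} [Field L] [Algebra Fq L] {θ' : L} (σ : E →ₐ[Fq] L)
    (hσ : σ θ = θ') (b : Fq[X]) (x : E) :
    σ (aeval (drinfeldT Fq r θ) b x) = aeval (drinfeldT Fq r θ') b (σ x) := by
  have hT : ∀ x, σ (drinfeldT Fq r θ x) = drinfeldT Fq r θ' (σ x) := by
    intro x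
    rw [drinfeldT_apply, drinfeldT_apply]
    simp only [map_add, map_mul, map_pow, hσ]
  induction b using Polynomial.induction_on generalizing x with
  | C c => simp [Module.algebraMap_end_apply]
  | add p q hp hq => rw [map_add, map_add, LinearMap.add_apply, map_add, hp, hq,
      LinearMap.add_apply]
  | monomial n c ih =>
    rw [pow_succ, ← mul_assoc, map_mul _ (C c * X ^ n), map_mul _ (C c * X ^ n),
      Module.End.mul_apply, Module.End.mul_apply, ih, aeval_X, aeval_X, hT]

theorem map_mem_drinfeldTorsion {L : Type*} [Field L] [Algebra Fq L] {θ' : L} (σ : E →ₐ[Fq] L)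
    (hσ : σ θ = θ') {x : E} (hx : x ∈ drinfeldTorsion r θ a) :
    σ x ∈ drinfeldTorsion r θ' a := by
  rw [mem_drinfeldTorsion] at hx ⊢
  rw [← map_aeval_drinfeldT σ hσ, hx, map_zero]

end GaloisAction

section InfinityIrreducible

open WithZero

variable {Fq : Type*} [Field Fq] [Fintype Fq] {E : Type*} [Field E] [Algebra Fq E]
  {v : Valuation E ℤᵐ⁰} {κ : Type*} [Field κ] [Algebra Fq κ] (R : Reduction Fq v κ)
  {r : ℕ} {θ x₀ : E} {a : Fq[X]}

theorem Reduction.red_map_of_actsAsPowAt {k E κ : Type*} [Field k] [Field E] [Algebra k E]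
    {v : Valuation E ℤᵐ⁰} [Field κ] [Algebra k κ] (R : Reduction k v κ) {N : ℕ} {σ : E → E}
    (hσ : ActsAsPowAt v N σ) {z : E} (hz : v z ≤ 1) : R.red (σ z) = R.red z ^ N := by
  rw [← R.red_pow hz, R.red_eq_red_iff]
  · exact (hσ z).2 hz
  · rw [(hσ z).1]; exact hz
  · rw [map_pow]; exact pow_le_one' hz _

namespace IsMaxTorsion

variable (H : IsMaxTorsion v r θ a x₀)
include H

theorem coeff_infPoly_map {N : ℕ} (σ : E →ₐ[Fq] E) (hθ : σ θ = θ) (hσ : ActsAsPowAt v N σ) {x : E}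
    (hx : x ∈ drinfeldTorsion r θ a) (i : ℕ) :
    (R.infPoly r θ a x₀ (σ x)).coeff i =
      R.red (σ x₀ / x₀) * (R.infPoly r θ a x₀ x).coeff i ^ N := by
  have hy := H.val_div_le (aeval_mem_drinfeldTorsion (divX^[i + 1] a) hx)
  rw [R.coeff_infPoly, R.coeff_infPoly, ← map_aeval_drinfeldT σ hθ,
    ← R.red_map_of_actsAsPowAt hσ hy, mul_comm, ← R.red_mul]
  · rw [map_div₀, div_mul_div_cancel₀]
    exact (map_ne_zero σ).2 H.ne_zero
  · rw [(hσ _).1]; exact hy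
  · exact H.val_div_le (map_mem_drinfeldTorsion σ hθ H.mem)

theorem red_map_div_ne_zero {N : ℕ} (σ : E →ₐ[Fq] E) (hσ : ActsAsPowAt v N σ) :
    R.red (σ x₀ / x₀) ≠ 0 := by
  have h1 : v (σ x₀ / x₀) = 1 := by
    rw [map_div₀, (hσ _).1, div_self ((Valuation.ne_zero_iff v).2 H.ne_zero)]
  rw [Ne, R.red_eq_zero_iff h1.le, h1]
  exact lt_irrefl _

variable {K : Type*} [Field K] [Algebra K E] [Algebra Fq K] [IsScalarTower Fq K E]

theorem exists_red_notMem_range {t : K} (hθ : algebraMap K E t = θ) (hq : 3 ≤ Fintype.card Fq)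
    [Finite (E ≃ₐ[K] E)] (hr : 3 ≤ r)
    (hcard : Nat.card (drinfeldTorsion r θ a) = Fintype.card Fq ^ (r * a.natDegree))
    (hfaith : ∀ σ : E ≃ₐ[K] E, (∀ x ∈ drinfeldTorsion r θ a, σ x = x) → σ = 1)
    (I : Subgroup (E ≃ₐ[K] E)) (hI : ∀ σ ∈ I, ActsAsPowAt v 1 σ)
    (hvθ : v θ = exp (Nat.card I : ℤ)) :
    ∃ σ ∈ I, R.red (σ x₀ / x₀) ∉ Set.range (algebraMap Fq κ) := by
  by_contra! hcon
  have : Finite (drinfeldTorsion r θ a) := Nat.finite_of_card_ne_zero (by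
    rw [hcard]; exact (pow_pos Fintype.card_pos _).ne')
  have hσθ : ∀ σ : E ≃ₐ[K] E, (σ.toAlgHom.restrictScalars Fq) θ = θ := by
    intro σ
    rw [← hθ]; exact σ.commutes t
  have hne : ∀ σ : I, R.red (σ.1 x₀ / x₀) ≠ 0 := fun σ =>
    H.red_map_div_ne_zero R (σ.1.toAlgHom.restrictScalars Fq) (hI σ.1 σ.2)
  choose c hc using fun σ : I => hcon σ.1 σ.2
  have hc0 : ∀ σ, c σ ≠ 0 := by
    intro σ h
    apply hne σ
    rw [← hc, h, map_zero]
  have hinj : Function.Injective c := by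
    intro σ τ h
    have h1 : R.red (σ.1 x₀ / x₀) = R.red (τ.1 x₀ / x₀) := by rw [← hc, ← hc, h]
    have h2 : ∀ x ∈ drinfeldTorsion r θ a, σ.1 x = τ.1 x := by
      intro x hx
      have hm1 := map_mem_drinfeldTorsion (σ.1.toAlgHom.restrictScalars Fq) (hσθ _) hx
      have hm2 := map_mem_drinfeldTorsion (τ.1.toAlgHom.restrictScalars Fq) (hσθ _) hx
      have h3 : R.infPoly r θ a x₀ (σ.1 x) = R.infPoly r θ a x₀ (τ.1 x) := by
        ext i
        have e1 := H.coeff_infPoly_map R (σ.1.toAlgHom.restrictScalars Fq) (hσθ _) (hI σ.1 σ.2) hx i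
        have e2 := H.coeff_infPoly_map R (τ.1.toAlgHom.restrictScalars Fq) (hσθ _) (hI τ.1 τ.2) hx i
        refine e1.trans (Eq.trans ?_ e2.symm)
        exact congrArg (· * _) h1
      have h4 := H.infPoly_add R (sub_mem hm1 hm2) hm2
      rw [sub_add_cancel] at h4
      have h5 := H.eq_zero_of_infPoly_eq_zero R (sub_mem hm1 hm2)
        (by exact right_eq_add.1 (h3.symm.trans h4))
      exact sub_eq_zero.1 h5
    have h3 : τ.1⁻¹ * σ.1 = 1 := by
      refine hfaith _ fun x hx => ?_
      rw [AlgEquiv.mul_apply, h2 x hx]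
      exact τ.1.symm_apply_apply x
    exact Subtype.ext (inv_mul_eq_one.1 h3).symm
  have hle : Nat.card I ≤ Fintype.card Fq - 1 := by
    have h1 := Nat.card_le_card_of_injective (fun σ : I => Units.mk0 (c σ) (hc0 σ)) (by
      intro σ τ h
      exact hinj (by simpa using congrArg Units.val h))
    rwa [Nat.card_units, Nat.card_eq_fintype_card (α := Fq)] at h1
  have hprod := val_mul_pow_eq_one H.two_le H.one_lt H.ne_zero
    (H.le _ (drinfeldT_mem_drinfeldTorsion H.mem))
  have hv0 : v x₀ ≠ 0 := (Valuation.ne_zero_iff v).2 H.ne_zero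
  obtain ⟨n, hn⟩ : ∃ n : ℤ, v x₀ = exp n := ⟨log (v x₀), (exp_log hv0).symm⟩
  rw [hvθ, hn, ← exp_nsmul, ← exp_nsmul, ← exp_add, exp_eq_one] at hprod
  have hpos : 0 < Nat.card I := Nat.card_pos
  set q := Fintype.card Fq
  have hqr : q ^ 3 ≤ q ^ r := Nat.pow_le_pow_right (by omega) hr
  obtain ⟨m, hm⟩ : ∃ m, q = m + 3 := ⟨q - 3, by omega⟩
  obtain ⟨w, hw⟩ : ∃ w, q ^ r = q ^ 3 + w := ⟨q ^ r - q ^ 3, by omega⟩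
  have e1 : q - 2 = m + 1 := by omega
  have e2 : q ^ r - 1 = (m + 3) ^ 3 - 1 + w := by
    have : 1 ≤ (m + 3) ^ 3 := Nat.one_le_pow _ _ (by omega)
    rw [hw, hm]; omega
  have e3 : ((m + 3) ^ 3 - 1 : ℕ) = (m + 1) * (m + 2) + 1 +
      (m ^ 3 + 8 * m ^ 2 + 24 * m + 23) := by
    have : (m + 3) ^ 3 = (m + 1) * (m + 2) + 1 + (m ^ 3 + 8 * m ^ 2 + 24 * m + 23) + 1 := by ring
    omega
  rw [e1, e2, e3] at hprod
  have hle' : Nat.card I ≤ m + 2 := by omega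
  have h6 : (m + 1) * Nat.card I ≤ (m + 1) * (m + 2) := Nat.mul_le_mul_left _ hle'
  have h7 : 0 < (m + 1) * Nat.card I := by positivity
  have h8 : ((m + 1 : ℕ) : ℤ) * (Nat.card I : ℤ) = (((m + 1) * Nat.card I : ℕ) : ℤ) := by
    push_cast; ring
  simp only [nsmul_eq_mul] at hprod
  rw [h8] at hprod
  set u := (m + 1) * Nat.card I
  set z := (m + 1) * (m + 2) + 1 + (m ^ 3 + 8 * m ^ 2 + 24 * m + 23) + w with hz
  have h9 : u < z := by omega
  have hn0 : n < 0 := by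
    by_contra! h
    have : 0 ≤ (z : ℤ) * n := by positivity
    omega
  have : (z : ℤ) * n ≤ (z : ℤ) * (-1) := mul_le_mul_of_nonneg_left (by omega) (by positivity)
  omega

include R in
theorem eq_bot_or_eq_of_stable {t : K} (hθ : algebraMap K E t = θ) (hq : 3 ≤ Fintype.card Fq)
    [Finite (E ≃ₐ[K] E)] (hr : 3 ≤ r) (hrp : r.Prime) (ha : Irreducible a)
    (hcard : Nat.card (drinfeldTorsion r θ a) = Fintype.card Fq ^ (r * a.natDegree))
    (hfaith : ∀ σ : E ≃ₐ[K] E, (∀ x ∈ drinfeldTorsion r θ a, σ x = x) → σ = 1)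
    (I : Subgroup (E ≃ₐ[K] E)) (hI : ∀ σ ∈ I, ActsAsPowAt v 1 σ)
    (hvθ : v θ = exp (Nat.card I : ℤ)) {s : E ≃ₐ[K] E}
    (hs : ActsAsPowAt v (Fintype.card Fq) s) {W : Submodule Fq E}
    (hWM : W ≤ drinfeldTorsion r θ a) (hWT : ∀ x ∈ W, drinfeldT Fq r θ x ∈ W)
    (hWG : ∀ σ : E ≃ₐ[K] E, ∀ x ∈ W, σ x ∈ W) :
    W = ⊥ ∨ W = drinfeldTorsion r θ a := by
  have : Finite (drinfeldTorsion r θ a) := Nat.finite_of_card_ne_zero (by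
    rw [hcard]; exact (pow_pos Fintype.card_pos _).ne')
  have hσθ : ∀ σ : E ≃ₐ[K] E, (σ.toAlgHom.restrictScalars Fq) θ = θ := by
    intro σ
    rw [← hθ]; exact σ.commutes t
  obtain ⟨σ, hσI, hσ⟩ := H.exists_red_notMem_range R hθ hq hr hcard hfaith I hI hvθ
  obtain ⟨ρ, hρ⟩ := H.exists_linearMap R
  obtain ⟨hfr, -⟩ := H.finrank_eq_and_surjective R hcard hρ
  have hF := (algebraMap (frobeniusFixed Fq κ r) κ).injective
  have hmapinj := Polynomial.map_injective _ hF
  have hmap : ∀ b : Fq[X], (b.map (algebraMap Fq (frobeniusFixed Fq κ r))).map (algebraMap (frobeniusFixed Fq κ r) κ) =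
      b.map (algebraMap Fq κ) := by
    intro b; rw [Polynomial.map_map, ← IsScalarTower.algebraMap_eq]
  have hdeg : ∀ x, (ρ x).degree < (a.map (algebraMap Fq (frobeniusFixed Fq κ r))).degree := by
    intro x
    rw [← degree_map_eq_of_injective hF, hρ, degree_map, degree_eq_natDegree H.monic.ne_zero]
    exact R.degree_infPoly_lt _
  have hρ0 : ∀ x, ρ x = 0 → x = 0 := fun x hx =>
    Subtype.ext (H.eq_zero_of_infPoly_eq_zero R x.2 (by rw [← hρ, hx, Polynomial.map_zero]))
  have hscal : ∀ τ : E ≃ₐ[K] E, ∃ c : (frobeniusFixed Fq κ r), algebraMap (frobeniusFixed Fq κ r) κ c = R.red (τ x₀ / x₀) := by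
    intro τ
    have h1 := map_mem_drinfeldTorsion (τ.toAlgHom.restrictScalars Fq) (hσθ τ) H.mem
    have h2 := H.coeff_infPoly_mem R h1 (a.natDegree - 1)
    rw [H.coeff_infPoly_top] at h2
    exact ⟨⟨_, h2⟩, rfl⟩
  let W' : Submodule Fq (frobeniusFixed Fq κ r)[X] := (W.comap (drinfeldTorsion r θ a).subtype).map ρ ⊔
    (Ideal.span {a.map (algebraMap Fq (frobeniusFixed Fq κ r))}).restrictScalars Fq
  have hW' : ∀ f, f ∈ W' ↔ ∃ x : drinfeldTorsion r θ a, x.1 ∈ W ∧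
      ∃ h, f = ρ x + a.map (algebraMap Fq (frobeniusFixed Fq κ r)) * h := by
    intro f
    constructor
    · intro hf
      obtain ⟨y, hy, z, hz, rfl⟩ := Submodule.mem_sup.1 hf
      obtain ⟨x, hx, rfl⟩ := hy
      obtain ⟨h, rfl⟩ := Ideal.mem_span_singleton.1 hz
      exact ⟨x, hx, h, rfl⟩
    · rintro ⟨x, hx, h, rfl⟩
      exact Submodule.add_mem_sup ⟨x, hx, rfl⟩ (Ideal.mem_span_singleton.2 (dvd_mul_right _ _))
  obtain ⟨z, hz⟩ := hscal σ
  obtain ⟨c, hc⟩ := hscal s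
  have hkey := eq_bot_or_top_of_frobenius_stable (k := Fq) (κ := (frobeniusFixed Fq κ r)) (by rw [hfr]; exact hrp) ha W'
    (fun f => (hW' _).2 ⟨0, W.zero_mem, f, by rw [map_zero, zero_add]⟩) ?_ (z := z) ?_ ?_
    (c := c) ?_ ?_
  · rcases hkey with hkey | hkey
    · left
      rw [eq_bot_iff]
      intro x hx
      have h1 := hkey (ρ ⟨x, hWM hx⟩) ((hW' _).2 ⟨_, hx, 0, by rw [mul_zero, add_zero]⟩)
      have h2 := hρ0 _ (eq_zero_of_dvd_of_degree_lt h1 (hdeg _))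
      exact congrArg Subtype.val h2
    · right
      refine le_antisymm hWM fun x hx => ?_
      obtain ⟨y, hy, h, hyx⟩ := (hW' (ρ ⟨x, hx⟩)).1 (by rw [hkey]; trivial)
      have h1 : a.map (algebraMap Fq (frobeniusFixed Fq κ r)) ∣ ρ (⟨x, hx⟩ - y) := by
        rw [map_sub, hyx, add_sub_cancel_left]; exact dvd_mul_right _ _
      have h2 := hρ0 _ (eq_zero_of_dvd_of_degree_lt h1 (hdeg _))
      have h3 : (⟨x, hx⟩ : drinfeldTorsion r θ a) = y := sub_eq_zero.1 h2
      rw [← h3] at hy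
      exact hy
  · intro f hf
    obtain ⟨x, hx, h, rfl⟩ := (hW' f).1 hf
    obtain ⟨w, hw⟩ : ∃ w : (frobeniusFixed Fq κ r), algebraMap (frobeniusFixed Fq κ r) κ w = R.red (x.1 / x₀) := by
      have h2 := H.coeff_infPoly_mem R x.2 (a.natDegree - 1)
      rw [H.coeff_infPoly_top] at h2
      exact ⟨⟨_, h2⟩, rfl⟩
    refine (hW' _).2 ⟨⟨_, drinfeldT_mem_drinfeldTorsion x.2⟩, hWT _ hx, C w + X * h, hmapinj ?_⟩
    simp only [Polynomial.map_add, Polynomial.map_mul, map_X, map_C, hρ, hmap, mul_add, hw,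
      H.X_mul_infPoly R x.2]
    ring
  · rintro ⟨y, rfl⟩
    exact hσ ⟨y, by rw [← hz, ← IsScalarTower.algebraMap_apply]⟩
  · intro f hf
    obtain ⟨x, hx, h, rfl⟩ := (hW' f).1 hf
    refine (hW' _).2 ⟨⟨_, map_mem_drinfeldTorsion (σ.toAlgHom.restrictScalars Fq) (hσθ σ) x.2⟩,
      hWG σ _ hx, C z * h, ?_⟩
    rw [mul_add, mul_left_comm]
    congr 1
    apply hmapinj
    ext i
    rw [hρ, H.coeff_infPoly_map R _ (hσθ σ) (hI σ hσI) x.2, pow_one, Polynomial.map_mul, map_C,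
      coeff_C_mul, hz, hρ]
    rfl
  · rintro rfl
    apply H.red_map_div_ne_zero R (s.toAlgHom.restrictScalars Fq) hs
    exact hc.symm.trans (map_zero _)
  · intro f hf
    obtain ⟨x, hx, h, rfl⟩ := (hW' f).1 hf
    refine (hW' _).2 ⟨⟨_, map_mem_drinfeldTorsion (s.toAlgHom.restrictScalars Fq) (hσθ s) x.2⟩,
      hWG s _ hx, C c * h.map (FiniteField.frobeniusAlgHom Fq (frobeniusFixed Fq κ r) : (frobeniusFixed Fq κ r) →+* (frobeniusFixed Fq κ r)), ?_⟩
    have h1 := frobeniusCoeff_pow_map (E := (frobeniusFixed Fq κ r)) a 1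
    rw [pow_one, frobeniusCoeff, coe_mapRingHom] at h1
    rw [Polynomial.map_add, Polynomial.map_mul, h1, mul_add, mul_left_comm]
    congr 1
    apply hmapinj
    ext i
    rw [hρ, H.coeff_infPoly_map R _ (hσθ s) hs x.2, Polynomial.map_mul, map_C,
      coeff_C_mul, hc, ← hρ, coeff_map, coeff_map, coeff_map]
    rfl

end IsMaxTorsion

end InfinityIrreducible

section PlacesOfFunctionField

open WithZero

variable {Fq : Type*} [Field Fq]

/-- `K` is the field of rational functions in `t` over the constant field. -/
structure IsRationalFunctionField (Fq : Type*) [Field Fq] {K : Type*} [Field K] [Algebra Fq K]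
    (t : K) : Prop where
  transcendental : Transcendental Fq t
  exists_eq_div : ∀ x : K, ∃ f g : Fq[X], x = aeval t f / aeval t g

variable {K : Type*} [Field K] [Algebra Fq K] {t : K}

namespace IsRationalFunctionField

theorem ratFunc : IsRationalFunctionField Fq (RatFunc.X : RatFunc Fq) where
  transcendental := RatFunc.transcendental_X
  exists_eq_div x := ⟨x.num, x.denom, by
    rw [RatFunc.aeval_X_left_eq_algebraMap, RatFunc.aeval_X_left_eq_algebraMap,
      RatFunc.num_div_denom]⟩

theorem inv (h : IsRationalFunctionField Fq t) : IsRationalFunctionField Fq t⁻¹ where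
  transcendental := fun h' => h.transcendental (by simpa using h'.inv)
  exists_eq_div x := by
    obtain ⟨f, g, rfl⟩ := h.exists_eq_div x
    have ht : t ≠ 0 := fun h0 => h.transcendental (h0 ▸ isAlgebraic_zero)
    letI := invertibleOfNonzero ht
    set N := max f.natDegree g.natDegree
    refine ⟨f.reflect N, g.reflect N, ?_⟩
    have h1 := eval₂_reflect_mul_pow (algebraMap Fq K) t N f (le_max_left _ _)
    have h2 := eval₂_reflect_mul_pow (algebraMap Fq K) t N g (le_max_right _ _)
    rw [invOf_eq_inv] at h1 h2
    rw [aeval_def, aeval_def, aeval_def, aeval_def, ← h1, ← h2,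
      mul_div_mul_right _ _ (pow_ne_zero _ ht)]

theorem aeval_injective (h : IsRationalFunctionField Fq t) :
    Function.Injective (aeval (R := Fq) t) := transcendental_iff_injective.1 h.transcendental

theorem isFractionRing (h : IsRationalFunctionField Fq t) :
    letI := (aeval (R := Fq) t).toAlgebra
    IsFractionRing Fq[X] K := by
  letI := (aeval (R := Fq) t).toAlgebra
  have : FaithfulSMul Fq[X] K := (faithfulSMul_iff_algebraMap_injective _ _).2 h.aeval_injective
  exact IsFractionRing.of_field Fq[X] K h.exists_eq_div

theorem exists_place [Fintype Fq] (h : IsRationalFunctionField Fq t) {E : Type*} [Field E]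
    [Algebra K E] [FiniteDimensional K E] [IsGalois K E] {ϖ : Fq[X]} (hϖ : Prime ϖ) :
    ∃ (v : Valuation E ℤᵐ⁰) (I : Subgroup (E ≃ₐ[K] E)) (s : E ≃ₐ[K] E),
      (∀ b : Fq[X], v (algebraMap K E (aeval t b)) ≤ 1) ∧
      (∀ b : Fq[X], v (algebraMap K E (aeval t b)) < 1 ↔ ϖ ∣ b) ∧
      v (algebraMap K E (aeval t ϖ)) = exp (-(Nat.card I : ℤ)) ∧
      (∀ σ ∈ I, ActsAsPowAt v 1 σ) ∧
      ActsAsPowAt v (Fintype.card Fq ^ ϖ.natDegree) s := by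
  letI a1 : Algebra Fq[X] K := (aeval (R := Fq) t).toAlgebra
  letI a2 : Algebra Fq[X] E := ((algebraMap K E).comp (aeval (R := Fq) t).toRingHom).toAlgebra
  have := h.isFractionRing
  have : IsScalarTower Fq[X] K E := IsScalarTower.of_algebraMap_eq fun x => rfl
  have hfin : Module.Finite Fq (Fq[X] ⧸ Ideal.span {ϖ}) :=
    Module.Finite.of_basis (AdjoinRoot.powerBasis hϖ.ne_zero).basis
  have : Finite (Fq[X] ⧸ Ideal.span {ϖ}) := Module.finite_of_finite Fq
  have hc : Nat.card (Fq[X] ⧸ Ideal.span {ϖ}) = Fintype.card Fq ^ ϖ.natDegree := by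
    rw [Module.natCard_eq_pow_finrank (K := Fq), finrank_quotient_span_eq_natDegree,
      Nat.card_eq_fintype_card]
  obtain ⟨v, I, s, h1, h2, h3, h4, h5⟩ := _root_.exists_place (K := K) (E := E) hϖ
  rw [hc] at h5
  exact ⟨v, I, s, h1, h2, h3, h4, h5⟩

end IsRationalFunctionField

theorem eq_bot_or_eq_drinfeldTorsion_of_stable {Fq : Type*} [Field Fq] [Fintype Fq] {K : Type*}
    [Field K] [Algebra Fq K] {t : K} (h : IsRationalFunctionField Fq t) {E : Type} [Field E]
    [Algebra K E] [Algebra Fq E] [IsScalarTower Fq K E] [FiniteDimensional K E] [IsGalois K E]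
    (hq : 3 ≤ Fintype.card Fq) {r : ℕ} (hr : 3 ≤ r) (hrp : r.Prime) {a : Fq[X]}
    (hm : a.Monic) (ha : Irreducible a)
    (hcard : Nat.card (drinfeldTorsion r (algebraMap K E t) a) =
      Fintype.card Fq ^ (r * a.natDegree))
    (hfaith : ∀ σ : E ≃ₐ[K] E, (∀ x ∈ drinfeldTorsion r (algebraMap K E t) a, σ x = x) → σ = 1)
    {W : Submodule Fq E} (hWM : W ≤ drinfeldTorsion r (algebraMap K E t) a)
    (hWT : ∀ x ∈ W, drinfeldT Fq r (algebraMap K E t) x ∈ W)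
    (hWG : ∀ σ : E ≃ₐ[K] E, ∀ x ∈ W, σ x ∈ W) :
    W = ⊥ ∨ W = drinfeldTorsion r (algebraMap K E t) a := by
  obtain ⟨v, I, s, -, -, h3, h4, h5⟩ := h.inv.exists_place (E := E) (prime_X (R := Fq))
  obtain ⟨κ, _, _, ⟨R⟩⟩ := exists_reduction (k := Fq) v
  rw [aeval_X, map_inv₀, map_inv₀, exp_neg, inv_inj] at h3
  rw [natDegree_X, pow_one] at h5
  have hd : 0 < a.natDegree := ha.natDegree_pos
  have hcard1 : 1 < Nat.card (drinfeldTorsion r (algebraMap K E t) a) := by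
    rw [hcard]; exact Nat.one_lt_pow (by positivity) (by omega)
  have hfin : Finite (drinfeldTorsion r (algebraMap K E t) a) :=
    Nat.finite_of_card_ne_zero (by omega)
  obtain ⟨x₀, hx₀⟩ := Finite.exists_max fun x : drinfeldTorsion r (algebraMap K E t) a => v x.1
  have hx0 : x₀.1 ≠ 0 := by
    intro h0
    have : Nontrivial (drinfeldTorsion r (algebraMap K E t) a) :=
      Finite.one_lt_card_iff_nontrivial.1 hcard1
    obtain ⟨y, hy⟩ := exists_ne (0 : drinfeldTorsion r (algebraMap K E t) a)
    have h1 := hx₀ y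
    rw [h0, map_zero, le_zero_iff, Valuation.zero_iff] at h1
    exact hy (Subtype.ext h1)
  have H : IsMaxTorsion v r (algebraMap K E t) a x₀.1 :=
    ⟨by omega, by rw [h3, ← exp_zero, exp_lt_exp]; exact_mod_cast Nat.card_pos, hm, hd, x₀.2, hx0,
      fun y hy => hx₀ ⟨y, hy⟩⟩
  exact H.eq_bot_or_eq_of_stable R rfl hq hr hrp ha hcard hfaith I h4 h3 h5 hWM hWT hWG

end PlacesOfFunctionField

section PlaceAboveT

open WithZero

variable {Fq : Type*} [Field Fq] [Fintype Fq] {E : Type*} [Field E] [Algebra Fq E]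
  {v : Valuation E ℤᵐ⁰} {κ : Type*} [Field κ] [Algebra Fq κ] (R : Reduction Fq v κ)
  {r : ℕ} {θ : E} {a : Fq[X]}

/-- The place `v` lies above `T` and the `a`-torsion is finite. -/
structure IsPlaceAboveT (v : Valuation E ℤᵐ⁰) (r : ℕ) (θ : E) (a : Fq[X]) : Prop where
  two_le : 2 ≤ r
  ne_zero : θ ≠ 0
  lt_one : v θ < 1
  finite : Finite (drinfeldTorsion r θ a)

theorem one_lt_card_pow (Fq : Type*) [Field Fq] [Fintype Fq] {n : ℕ} (hn : n ≠ 0) :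
    1 < Fintype.card Fq ^ n := Nat.one_lt_pow hn Fintype.one_lt_card

theorem sub_smul_pow_card_pow (n : ℕ) (c : Fq) (x y : E) :
    (x - c • y) ^ Fintype.card Fq ^ n =
      x ^ Fintype.card Fq ^ n - c • y ^ Fintype.card Fq ^ n := by
  rw [← frobeniusAlgHom_toLinearMap_pow_apply, map_sub, map_smul,
    frobeniusAlgHom_toLinearMap_pow_apply, frobeniusAlgHom_toLinearMap_pow_apply]

theorem drinfeldT_pow_apply_mem (n : ℕ) {x : E} (hx : x ∈ drinfeldTorsion r θ a) :
    (drinfeldT Fq r θ ^ n) x ∈ drinfeldTorsion r θ a := by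
  simpa using aeval_mem_drinfeldTorsion (X ^ n) hx

theorem val_smul_le (c : Fq) (x : E) : v (c • x) ≤ v x := by
  rcases eq_or_ne c 0 with rfl | hc
  · simp
  · rw [Algebra.smul_def, map_mul, val_algebraMap_of_finite v hc, one_mul]

/-- The submodule of integral torsion points. -/
def integralTorsion (v : Valuation E ℤᵐ⁰) (r : ℕ) (θ : E) (a : Fq[X]) : Submodule Fq E where
  carrier := {x | x ∈ drinfeldTorsion r θ a ∧ v x ≤ 1}
  add_mem' := fun hx hy => ⟨add_mem hx.1 hy.1, Valuation.map_add_le v hx.2 hy.2⟩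
  zero_mem' := ⟨zero_mem _, by simp⟩
  smul_mem' := fun c x hx => ⟨Submodule.smul_mem _ c hx.1, (val_smul_le c x).trans hx.2⟩

namespace IsPlaceAboveT

variable (H : IsPlaceAboveT v r θ a)
include H

theorem one_lt_pow : 1 < Fintype.card Fq ^ (r - 1) :=
  one_lt_card_pow Fq (by have := H.two_le; omega)

theorem pow_eq : Fintype.card Fq ^ r = Fintype.card Fq ^ (r - 1) * Fintype.card Fq := by
  rw [← pow_succ]; congr 1; have := H.two_le; omega

theorem val_last_eq (x : E) : v (θ ^ (Fintype.card Fq - 1) * x ^ Fintype.card Fq ^ r) =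
    (v θ * v x ^ Fintype.card Fq ^ (r - 1)) ^ (Fintype.card Fq - 1) *
      v x ^ Fintype.card Fq ^ (r - 1) := by
  have hq : 1 < Fintype.card Fq := Fintype.one_lt_card
  rw [map_mul, map_pow, map_pow, H.pow_eq, mul_pow, mul_assoc, ← pow_mul, ← pow_add]
  congr 2
  obtain ⟨k, hk⟩ : ∃ k, Fintype.card Fq = k + 1 := ⟨Fintype.card Fq - 1, by omega⟩
  rw [hk, Nat.add_sub_cancel]
  ring

theorem val_drinfeldT_le_one {x : E} (hx : v x ≤ 1) : v (drinfeldT Fq r θ x) ≤ 1 := by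
  rw [drinfeldT_apply]
  refine Valuation.map_add_le v (Valuation.map_add_le v ?_ ?_) ?_
  · rw [map_mul]; exact mul_le_one' H.lt_one.le hx
  · rw [map_pow]; exact pow_le_one' hx _
  · rw [map_mul, map_pow, map_pow]
    exact mul_le_one' (pow_le_one' H.lt_one.le _) (pow_le_one' hx _)

theorem val_drinfeldT_lt {x : E} (hx : v x < 1) (hx0 : x ≠ 0) : v (drinfeldT Fq r θ x) < v x := by
  have hv0 : 0 < v x := zero_lt_iff.2 ((Valuation.ne_zero_iff v).2 hx0)
  have hpow : ∀ n, 1 < n → v x ^ n < v x := fun n hn =>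
    pow_lt_self_of_lt_one₀ hv0 hx hn
  rw [drinfeldT_apply]
  refine Valuation.map_add_lt v (Valuation.map_add_lt v ?_ ?_) ?_
  · rw [map_mul]
    exact mul_lt_of_lt_one_left hv0 H.lt_one
  · rw [map_pow]; exact hpow _ H.one_lt_pow
  · rw [map_mul, map_pow, map_pow]
    exact (mul_le_of_le_one_left' (pow_le_one' H.lt_one.le _)).trans_lt
      (hpow _ (one_lt_card_pow Fq (by have := H.two_le; omega)))

theorem val_drinfeldT_eq {x : E} (hx : 1 < v x) (hx' : v θ * v x ^ Fintype.card Fq ^ (r - 1) < 1) :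
    v (drinfeldT Fq r θ x) = v x ^ Fintype.card Fq ^ (r - 1) := by
  have hq : 1 < Fintype.card Fq := Fintype.one_lt_card
  have hv0 : 0 < v x := zero_lt_one.trans hx
  have h1 : v (θ * x) < v (x ^ Fintype.card Fq ^ (r - 1)) := by
    rw [map_mul, map_pow]
    exact (mul_lt_of_lt_one_left hv0 H.lt_one).trans_le (le_self_pow hx.le (by
      have := H.one_lt_pow; omega))
  have h2 : v (θ ^ (Fintype.card Fq - 1) * x ^ Fintype.card Fq ^ r) <
      v (x ^ Fintype.card Fq ^ (r - 1)) := by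
    rw [H.val_last_eq, map_pow]
    exact mul_lt_of_lt_one_left (pow_pos hv0 _) (pow_lt_one₀ zero_le hx' (by omega))
  rw [drinfeldT_apply, add_assoc, Valuation.map_add_eq_of_lt_right, Valuation.map_add_eq_of_lt_left v h2,
    map_pow]
  rwa [Valuation.map_add_eq_of_lt_left v h2]

theorem lt_val_drinfeldT {x : E} (hx : 1 < v θ * v x ^ Fintype.card Fq ^ (r - 1)) :
    v x ^ Fintype.card Fq ^ (r - 1) < v (drinfeldT Fq r θ x) ∧ 1 < v x := by
  have hq : 1 < Fintype.card Fq := Fintype.one_lt_card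
  have hx1 : 1 < v x := by
    by_contra! h
    exact hx.not_ge (mul_le_one' H.lt_one.le (pow_le_one' h _))
  have hv0 : 0 < v x := zero_lt_one.trans hx1
  have h3 : v (x ^ Fintype.card Fq ^ (r - 1)) <
      v (θ ^ (Fintype.card Fq - 1) * x ^ Fintype.card Fq ^ r) := by
    rw [H.val_last_eq, map_pow]
    exact lt_mul_of_one_lt_left (pow_pos hv0 _) (one_lt_pow' hx (by omega))
  have h1 : v (θ * x) < v (x ^ Fintype.card Fq ^ (r - 1)) := by
    rw [map_mul, map_pow]
    exact (mul_lt_of_lt_one_left hv0 H.lt_one).trans_le (le_self_pow hx1.le (by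
      have := H.one_lt_pow; omega))
  refine ⟨?_, hx1⟩
  rw [drinfeldT_apply, Valuation.map_add_eq_of_lt_right v, ← map_pow]
  · exact h3
  · exact Valuation.map_add_lt v (h1.trans h3) h3

theorem not_of_val_lt {P : E → Prop}
    (hP : ∀ x ∈ drinfeldTorsion r θ a, P x →
      P (drinfeldT Fq r θ x) ∧ v x < v (drinfeldT Fq r θ x))
    {x : E} (hx : x ∈ drinfeldTorsion r θ a) : ¬ P x := by
  intro hPx
  have := H.finite
  let S := {y : drinfeldTorsion r θ a // P y.1}
  have : Nonempty S := ⟨⟨⟨x, hx⟩, hPx⟩⟩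
  obtain ⟨y, hy⟩ := Finite.exists_max fun y : S => v y.1.1
  obtain ⟨h1, h2⟩ := hP y.1.1 y.1.2 y.2
  exact (hy ⟨⟨_, drinfeldT_mem_drinfeldTorsion y.1.2⟩, h1⟩).not_gt h2

theorem mul_val_pow_le_one {x : E} (hx : x ∈ drinfeldTorsion r θ a) :
    v θ * v x ^ Fintype.card Fq ^ (r - 1) ≤ 1 := by
  refine not_lt.1 (H.not_of_val_lt (P := fun x => 1 < v θ * v x ^ Fintype.card Fq ^ (r - 1))
    (fun x _ h => ?_) hx)
  obtain ⟨h1, h2⟩ := H.lt_val_drinfeldT h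
  have h3 : v x < v (drinfeldT Fq r θ x) :=
    (le_self_pow h2.le (by have := H.one_lt_pow; omega)).trans_lt h1
  exact ⟨h.trans_le (mul_le_mul_right (pow_le_pow_left' h3.le _) _), h3⟩

theorem exists_level {x : E} (hx : x ∈ drinfeldTorsion r θ a) (hx1 : 1 < v x) :
    ∃ j, v θ * v x ^ (Fintype.card Fq ^ (r - 1)) ^ (j + 1) = 1 := by
  by_contra! hcon
  refine H.not_of_val_lt (P := fun x => 1 < v x ∧
    ∀ j, v θ * v x ^ (Fintype.card Fq ^ (r - 1)) ^ (j + 1) ≠ 1) (fun x hx h => ?_) hx ⟨hx1, hcon⟩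
  have h1 := H.val_drinfeldT_eq h.1 (lt_of_le_of_ne (H.mul_val_pow_le_one hx)
    (by simpa using h.2 0))
  rw [h1]
  refine ⟨⟨one_lt_pow' h.1 (by have := H.one_lt_pow; omega), fun j => ?_⟩,
    lt_self_pow₀ h.1 H.one_lt_pow⟩
  rw [← pow_mul, ← pow_succ']
  exact h.2 (j + 1)

theorem val_drinfeldT_pow {x : E} (hx1 : 1 < v x) {j : ℕ}
    (hj : v θ * v x ^ (Fintype.card Fq ^ (r - 1)) ^ (j + 1) = 1) {i : ℕ} (hi : i ≤ j) :
    v ((drinfeldT Fq r θ ^ i) x) = v x ^ (Fintype.card Fq ^ (r - 1)) ^ i := by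
  induction i with
  | zero => simp
  | succ i ih =>
    have hQ := H.one_lt_pow
    have ih := ih (by omega)
    rw [pow_succ', Module.End.mul_apply, H.val_drinfeldT_eq, ih, ← pow_mul, ← pow_succ]
    · rw [ih]
      exact one_lt_pow' hx1 (pow_pos (by omega) _).ne'
    · rw [ih, ← pow_mul, ← pow_succ, ← hj]
      refine mul_lt_mul_of_pos_left ?_ (zero_lt_iff.2 ((Valuation.ne_zero_iff v).2 H.ne_zero))
      exact pow_lt_pow_right₀ hx1 (Nat.pow_lt_pow_right hQ (by omega))

theorem red_pow_eq_neg_one {x : E} (hx : x ∈ drinfeldTorsion r θ a)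
    (h : v θ * v x ^ Fintype.card Fq ^ (r - 1) = 1) :
    R.red (θ * x ^ Fintype.card Fq ^ (r - 1)) ^ (Fintype.card Fq - 1) = -1 := by
  have hq : 1 < Fintype.card Fq := Fintype.one_lt_card
  have hx1 : 1 < v x := by
    by_contra! h1
    exact ((mul_le_of_le_one_right' (pow_le_one' h1 _)).trans_lt H.lt_one).ne h
  have hv0 : 0 < v x := zero_lt_one.trans hx1
  have hθ0 : 0 < v θ := zero_lt_iff.2 ((Valuation.ne_zero_iff v).2 H.ne_zero)
  have hle : v (θ * x ^ Fintype.card Fq ^ (r - 1)) ≤ 1 := by rw [map_mul, map_pow, h]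
  have hx0 : x ≠ 0 := (Valuation.ne_zero_iff v).1 hv0.ne'
  have hle2 : v ((θ * x ^ Fintype.card Fq ^ (r - 1)) ^ (Fintype.card Fq - 1)) ≤ 1 := by
    rw [map_pow]; exact pow_le_one' hle _
  rw [← R.red_pow hle, eq_neg_iff_add_eq_zero, ← R.red_one,
    ← R.red_add hle2 (by simp), R.red_eq_zero_iff (Valuation.map_add_le v hle2 (by simp))]
  have h1 := H.mul_val_pow_le_one (drinfeldT_mem_drinfeldTorsion hx)
  have h2 : v (drinfeldT Fq r θ x) ≤ v x := by
    rw [← h] at h1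
    exact (pow_le_pow_iff_left₀ zero_le zero_le (by have := H.one_lt_pow; omega)).1
      ((mul_le_mul_iff_right₀ hθ0).1 h1)
  have hlt : v x < v x ^ Fintype.card Fq ^ (r - 1) := lt_self_pow₀ hx1 H.one_lt_pow
  have e : (θ * x ^ Fintype.card Fq ^ (r - 1)) ^ (Fintype.card Fq - 1) + 1 =
      (drinfeldT Fq r θ x - θ * x) / x ^ Fintype.card Fq ^ (r - 1) := by
    rw [drinfeldT_apply, eq_div_iff (pow_ne_zero _ hx0), H.pow_eq, mul_pow, add_mul, mul_assoc,
      ← pow_mul, ← pow_add]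
    have : Fintype.card Fq ^ (r - 1) * (Fintype.card Fq - 1) + Fintype.card Fq ^ (r - 1) =
        Fintype.card Fq ^ (r - 1) * Fintype.card Fq := by
      rw [← Nat.mul_succ]; congr 1; omega
    rw [this]
    ring
  rw [e, map_div₀, map_pow, div_lt_one₀ (pow_pos hv0 _)]
  refine Valuation.map_sub_lt v (h2.trans_lt hlt) ?_
  rw [map_mul]
  exact (mul_lt_of_lt_one_left hv0 H.lt_one).trans hlt

include R in
theorem exists_val_sub_smul_lt_of_eq_one {x y : E} (hx : x ∈ drinfeldTorsion r θ a)
    (hy : y ∈ drinfeldTorsion r θ a) (hvx : v θ * v x ^ Fintype.card Fq ^ (r - 1) = 1)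
    (hvy : v θ * v y ^ Fintype.card Fq ^ (r - 1) = 1) :
    ∃ c : Fq, v θ * v (x - c • y) ^ Fintype.card Fq ^ (r - 1) < 1 := by
  have hq : 1 < Fintype.card Fq := Fintype.one_lt_card
  have e1 := H.red_pow_eq_neg_one R hx hvx
  have e2 := H.red_pow_eq_neg_one R hy hvy
  set ξ := R.red (θ * x ^ Fintype.card Fq ^ (r - 1)) with hξ
  set η := R.red (θ * y ^ Fintype.card Fq ^ (r - 1)) with hη
  have hη0 : η ≠ 0 := by
    intro h0
    rw [h0, zero_pow (by omega)] at e2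
    exact neg_ne_zero.2 one_ne_zero e2.symm
  have hdiv : (ξ / η) ^ Fintype.card Fq = ξ / η := by
    have h1 : (ξ / η) ^ (Fintype.card Fq - 1) = 1 := by
      rw [div_pow, e1, e2, div_self (neg_ne_zero.2 one_ne_zero)]
    calc (ξ / η) ^ Fintype.card Fq = (ξ / η) ^ (Fintype.card Fq - 1 + 1) := by
          congr 1; omega
      _ = _ := by rw [pow_succ, h1, one_mul]
  obtain ⟨c, hc⟩ := mem_range_algebraMap_of_pow_card_eq hdiv
  refine ⟨c, ?_⟩
  have hx1 : v (θ * x ^ Fintype.card Fq ^ (r - 1)) ≤ 1 := by rw [map_mul, map_pow, hvx]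
  have hy1 : v (θ * y ^ Fintype.card Fq ^ (r - 1)) ≤ 1 := by rw [map_mul, map_pow, hvy]
  have hcy : v (algebraMap Fq E c * (θ * y ^ Fintype.card Fq ^ (r - 1))) ≤ 1 := by
    rw [map_mul]; exact mul_le_one' (R.val_algebraMap_le c) hy1
  rw [← map_pow, ← map_mul, sub_smul_pow_card_pow, mul_sub, Algebra.smul_def, mul_left_comm,
    ← R.red_eq_zero_iff (Valuation.map_sub_le v hx1 hcy), R.red_sub hx1 hcy,
    R.red_mul (R.val_algebraMap_le c) hy1, R.red_algebraMap, hc, ← hξ, ← hη,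
    div_mul_cancel₀ _ hη0, sub_self]

include R in
theorem exists_val_sub_smul_lt {x y : E} (hx : x ∈ drinfeldTorsion r θ a)
    (hy : y ∈ drinfeldTorsion r θ a) (hx1 : 1 < v x) (hxy : v x = v y) :
    ∃ c : Fq, v (x - c • y) < v x := by
  have hQ := H.one_lt_pow
  obtain ⟨j, hj⟩ := H.exists_level hx hx1
  have hjy := hj
  rw [hxy] at hjy
  have hpow : ∀ z : E, 1 < v z → v θ * v z ^ (Fintype.card Fq ^ (r - 1)) ^ (j + 1) = 1 →
      v θ * v ((drinfeldT Fq r θ ^ j) z) ^ Fintype.card Fq ^ (r - 1) = 1 := by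
    intro z hz hzj
    rw [H.val_drinfeldT_pow hz hzj le_rfl, ← pow_mul, ← pow_succ, hzj]
  obtain ⟨c, hc⟩ := H.exists_val_sub_smul_lt_of_eq_one R (drinfeldT_pow_apply_mem j hx)
    (drinfeldT_pow_apply_mem j hy) (hpow x hx1 hj) (hpow y (hxy ▸ hx1) hjy)
  refine ⟨c, lt_of_le_of_ne (Valuation.map_sub_le v le_rfl ((val_smul_le c y).trans_eq hxy.symm))
    fun h => ?_⟩
  rw [← map_smul, ← map_sub, hpow _ (h ▸ hx1) (by rw [h, hj])] at hc
  exact lt_irrefl _ hc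

include R in
theorem exists_val_sub_aeval_le_one {x₀ : E} (hx₀ : x₀ ∈ drinfeldTorsion r θ a) (h1 : 1 < v x₀)
    (hmin : ∀ y ∈ drinfeldTorsion r θ a, 1 < v y → v x₀ ≤ v y) {m : ℕ}
    (hm : v θ * v x₀ ^ (Fintype.card Fq ^ (r - 1)) ^ (m + 1) = 1) {y : E}
    (hy : y ∈ drinfeldTorsion r θ a) :
    ∃ b : Fq[X], b.degree < (m + 1 : ℕ) ∧ v (y - aeval (drinfeldT Fq r θ) b x₀) ≤ 1 := by
  have hQ := H.one_lt_pow
  have hθ0 : 0 < v θ := zero_lt_iff.2 ((Valuation.ne_zero_iff v).2 H.ne_zero)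
  by_contra hbad
  have := H.finite
  let S := {y : drinfeldTorsion r θ a // ¬ ∃ b : Fq[X], b.degree < (m + 1 : ℕ) ∧
    v (y.1 - aeval (drinfeldT Fq r θ) b x₀) ≤ 1}
  have : Nonempty S := ⟨⟨⟨y, hy⟩, hbad⟩⟩
  obtain ⟨⟨⟨z, hz⟩, hzbad⟩, hzmin⟩ := Finite.exists_min fun y : S => v y.1.1
  have hz1 : 1 < v z := by
    by_contra! h
    exact hzbad ⟨0, by rw [degree_zero]; exact WithBot.bot_lt_coe _, by simpa using h⟩
  obtain ⟨j, hj⟩ := H.exists_level hz hz1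
  have heq : v z ^ (Fintype.card Fq ^ (r - 1)) ^ (j + 1) =
      v x₀ ^ (Fintype.card Fq ^ (r - 1)) ^ (m + 1) :=
    mul_left_cancel₀ hθ0.ne' (hj.trans hm.symm)
  have hjm : j ≤ m := by
    by_contra! h
    have h2 : v z ^ (Fintype.card Fq ^ (r - 1)) ^ (m + 1) <
        v z ^ (Fintype.card Fq ^ (r - 1)) ^ (j + 1) :=
      pow_lt_pow_right₀ hz1 (Nat.pow_lt_pow_right hQ (by omega))
    rw [heq] at h2
    exact h2.not_ge (pow_le_pow_left' (hmin z hz hz1) _)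
  have hvz : v z = v ((drinfeldT Fq r θ ^ (m - j)) x₀) := by
    rw [H.val_drinfeldT_pow h1 hm (by omega : m - j ≤ m)]
    refine (pow_left_inj₀ zero_le zero_le
      (pow_pos (by omega : 0 < Fintype.card Fq ^ (r - 1)) (j + 1)).ne').1 ?_
    rw [heq, ← pow_mul (v x₀), ← pow_add]
    congr 2; omega
  have hmem := drinfeldT_pow_apply_mem (m - j) hx₀
  obtain ⟨c, hc⟩ := H.exists_val_sub_smul_lt R hz hmem hz1 hvz
  have hz' := sub_mem hz (Submodule.smul_mem _ c hmem)
  have : ∃ b : Fq[X], b.degree < (m + 1 : ℕ) ∧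
      v ((z - c • (drinfeldT Fq r θ ^ (m - j)) x₀) - aeval (drinfeldT Fq r θ) b x₀) ≤ 1 := by
    by_contra h
    exact (hzmin ⟨⟨_, hz'⟩, h⟩).not_gt hc
  obtain ⟨b, hb, hvb⟩ := this
  refine hzbad ⟨C c * X ^ (m - j) + b, ?_, ?_⟩
  · refine (degree_add_le _ _).trans_lt (max_lt ((degree_C_mul_X_pow_le _ _).trans_lt ?_) hb)
    exact_mod_cast (by omega : m - j < m + 1)
  · convert hvb using 2
    simp only [map_add, map_mul, aeval_C, map_pow, aeval_X, LinearMap.add_apply,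
      Module.End.mul_apply, Module.algebraMap_end_apply]
    ring

theorem card_le_mul {x₀ : E} (hx₀ : x₀ ∈ drinfeldTorsion r θ a) {N : ℕ}
    (h : ∀ y ∈ drinfeldTorsion r θ a, ∃ b : Fq[X], b.degree < N ∧
      v (y - aeval (drinfeldT Fq r θ) b x₀) ≤ 1) :
    Nat.card (drinfeldTorsion r θ a) ≤
      Nat.card (integralTorsion v r θ a) * Fintype.card Fq ^ N := by
  have := H.finite
  have hfin : Finite (integralTorsion v r θ a) :=
    Finite.of_injective (fun x => (⟨x.1, x.2.1⟩ : drinfeldTorsion r θ a))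
      fun x y h => Subtype.ext (Subtype.mk_eq_mk.1 h)
  choose! b hb hvb using h
  let g : drinfeldTorsion r θ a → integralTorsion v r θ a × (Fin N → Fq) := fun y =>
    (⟨y.1 - aeval (drinfeldT Fq r θ) (b y) x₀,
      sub_mem y.2 (aeval_mem_drinfeldTorsion _ hx₀), hvb y y.2⟩, fun i => (b y).coeff i)
  have hg : Function.Injective g := by
    intro y z hyz
    have h2 : b y = b z := by
      ext i
      by_cases hi : i < N
      · exact congrFun (congrArg Prod.snd hyz) ⟨i, hi⟩
      · have hNi : (N : WithBot ℕ) ≤ i := by exact_mod_cast not_lt.1 hi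
        rw [coeff_eq_zero_of_degree_lt ((hb y y.2).trans_le hNi),
          coeff_eq_zero_of_degree_lt ((hb z z.2).trans_le hNi)]
    have h1 := congrArg (fun p => (Prod.fst p).1) hyz
    simp only [g, h2] at h1
    exact Subtype.ext (sub_left_inj.1 h1)
  refine (Nat.card_le_card_of_injective g hg).trans_eq ?_
  rw [Nat.card_prod, Nat.card_fun, Nat.card_eq_fintype_card (α := Fq), Nat.card_eq_fintype_card (α := Fin N),
    Fintype.card_fin]

end IsPlaceAboveT

end PlaceAboveT

section IntegralTorsion

open WithZero

variable {Fq : Type*} [Field Fq] [Fintype Fq] {E : Type*} [Field E] [Algebra Fq E]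
  {v : Valuation E ℤᵐ⁰} {κ : Type*} [Field κ] [Algebra Fq κ] (R : Reduction Fq v κ)
  {r : ℕ} {θ : E} {a : Fq[X]}

theorem finite_ker_aeval_frobenius_pow (n : ℕ) (hn : n ≠ 0) (hm : a.Monic) :
    Finite (LinearMap.ker (aeval ((FiniteField.frobeniusAlgHom Fq κ).toLinearMap ^ n) a)) ∧
    Nat.card (LinearMap.ker (aeval ((FiniteField.frobeniusAlgHom Fq κ).toLinearMap ^ n) a)) ≤
      (Fintype.card Fq ^ n) ^ a.natDegree := by
  classical
  set Q := Fintype.card Fq ^ n with hQ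
  have hQ1 : 1 < Q := one_lt_card_pow Fq hn
  let g : κ[X] := ∑ i ∈ Finset.range (a.natDegree + 1),
    C (algebraMap Fq κ (a.coeff i)) * X ^ Q ^ i
  have hcoeff : g.coeff (Q ^ a.natDegree) = 1 := by
    simp only [g, finsetSum_coeff, coeff_C_mul, coeff_X_pow]
    rw [Finset.sum_eq_single a.natDegree]
    · simp [hm.coeff_natDegree]
    · intro i _ hi
      rw [if_neg, mul_zero]
      exact fun h => hi (Nat.pow_right_injective hQ1 h).symm
    · simp
  have hg0 : g ≠ 0 := by
    intro h; rw [h, coeff_zero] at hcoeff; exact zero_ne_one hcoeff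
  have hdeg : g.natDegree ≤ Q ^ a.natDegree := by
    refine natDegree_sum_le_of_forall_le _ _ fun i hi => (natDegree_C_mul_X_pow_le _ _).trans ?_
    exact Nat.pow_le_pow_right (by omega) (by have := Finset.mem_range.1 hi; omega)
  have hker : ((LinearMap.ker (aeval ((FiniteField.frobeniusAlgHom Fq κ).toLinearMap ^ n) a) :
      Submodule Fq κ) : Set κ) ⊆ (g.roots.toFinset : Set κ) := by
    intro x hx
    have hx' : aeval ((FiniteField.frobeniusAlgHom Fq κ).toLinearMap ^ n) a x = 0 := hx
    rw [Finset.mem_coe, Multiset.mem_toFinset, mem_roots hg0, IsRoot.def, ← hx',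
      aeval_eq_sum_range, LinearMap.sum_apply, eval_finsetSum]
    refine Finset.sum_congr rfl fun i _ => ?_
    rw [LinearMap.smul_apply, ← pow_mul (FiniteField.frobeniusAlgHom Fq κ).toLinearMap,
      frobeniusAlgHom_toLinearMap_pow_apply, eval_mul, eval_C,
      eval_pow, eval_X, Algebra.smul_def, hQ, ← pow_mul]
  refine ⟨(Finset.finite_toSet _).subset hker, ?_⟩
  change Nat.card ((LinearMap.ker (aeval ((FiniteField.frobeniusAlgHom Fq κ).toLinearMap ^ n) a) :
      Submodule Fq κ) : Set κ) ≤ _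
  rw [Nat.card_coe_set_eq]
  refine (Set.ncard_le_ncard hker (Finset.finite_toSet _)).trans ?_
  rw [Set.ncard_coe_finset]
  exact (Multiset.toFinset_card_le _).trans ((card_roots' _).trans hdeg)

namespace IsPlaceAboveT

section

variable (H : IsPlaceAboveT v r θ a)
include H

theorem finite_integralTorsion : Finite (integralTorsion v r θ a) :=
  have := H.finite
  Finite.of_injective (fun x => (⟨x.1, x.2.1⟩ : drinfeldTorsion r θ a))
    fun _ _ h => Subtype.ext (Subtype.mk_eq_mk.1 h)

theorem val_aeval_le_one (b : Fq[X]) {x : E} (hx : v x ≤ 1) :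
    v (aeval (drinfeldT Fq r θ) b x) ≤ 1 := by
  induction b using Polynomial.induction_on generalizing x with
  | C c =>
    rw [aeval_C, Module.algebraMap_end_apply]
    exact (val_smul_le c x).trans hx
  | add p q hp hq =>
    rw [map_add, LinearMap.add_apply]
    exact Valuation.map_add_le v (hp hx) (hq hx)
  | monomial n c ih =>
    rw [pow_succ, ← mul_assoc, map_mul _ (C c * X ^ n), Module.End.mul_apply, aeval_X]
    exact ih (H.val_drinfeldT_le_one hx)

theorem red_drinfeldT {x : E} (hx : v x ≤ 1) :
    R.red (drinfeldT Fq r θ x) =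
      ((FiniteField.frobeniusAlgHom Fq κ).toLinearMap ^ (r - 1)) (R.red x) := by
  rw [frobeniusAlgHom_toLinearMap_pow_apply, ← R.red_pow hx, R.red_eq_red_iff
    (H.val_drinfeldT_le_one hx) (by rw [map_pow]; exact pow_le_one' hx _)]
  have e : drinfeldT Fq r θ x - x ^ Fintype.card Fq ^ (r - 1) =
      θ * x + θ ^ (Fintype.card Fq - 1) * x ^ Fintype.card Fq ^ r := by
    rw [drinfeldT_apply]; ring
  have hq : 1 < Fintype.card Fq := Fintype.one_lt_card
  rw [e]
  refine Valuation.map_add_lt v ?_ ?_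
  · rw [map_mul]; exact (mul_le_of_le_one_right' hx).trans_lt H.lt_one
  · rw [map_mul, map_pow, map_pow]
    exact (mul_le_of_le_one_right' (pow_le_one' hx _)).trans_lt
      (pow_lt_one₀ zero_le H.lt_one (by omega))

theorem red_aeval (b : Fq[X]) {x : E} (hx : v x ≤ 1) :
    R.red (aeval (drinfeldT Fq r θ) b x) =
      aeval ((FiniteField.frobeniusAlgHom Fq κ).toLinearMap ^ (r - 1)) b (R.red x) := by
  induction b using Polynomial.induction_on generalizing x with
  | C c =>
    rw [aeval_C, Module.algebraMap_end_apply, aeval_C, Module.algebraMap_end_apply,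
      Algebra.smul_def, Algebra.smul_def, R.red_mul (R.val_algebraMap_le c) hx, R.red_algebraMap]
  | add p q hp hq =>
    rw [map_add, LinearMap.add_apply, map_add, LinearMap.add_apply, ← hp hx, ← hq hx,
      R.red_add (H.val_aeval_le_one p hx) (H.val_aeval_le_one q hx)]
  | monomial n c ih =>
    rw [pow_succ, ← mul_assoc, map_mul _ (C c * X ^ n), map_mul _ (C c * X ^ n),
      Module.End.mul_apply, Module.End.mul_apply, aeval_X, aeval_X,
      ih (H.val_drinfeldT_le_one hx), H.red_drinfeldT R hx]

theorem val_aeval_of_lt {b : Fq[X]} (hb : b.coeff 0 ≠ 0) {x : E} (hx : v x < 1) :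
    v (aeval (drinfeldT Fq r θ) b x) = v x := by
  rcases eq_or_ne x 0 with rfl | hx0
  · simp
  have key : ∀ c : Fq[X], ∀ y, v y < v x → v (aeval (drinfeldT Fq r θ) c y) < v x := by
    intro c
    induction c using Polynomial.induction_on with
    | C c =>
      intro y hy
      rw [aeval_C, Module.algebraMap_end_apply]
      exact (val_smul_le c y).trans_lt hy
    | add p q hp hq =>
      intro y hy
      rw [map_add, LinearMap.add_apply]
      exact Valuation.map_add_lt v (hp y hy) (hq y hy)
    | monomial n c ih =>
      intro y hy
      rw [pow_succ, ← mul_assoc, map_mul _ (C c * X ^ n), Module.End.mul_apply, aeval_X]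
      refine ih _ ?_
      rcases eq_or_ne y 0 with rfl | hy0
      · simpa using zero_lt_iff.2 ((Valuation.ne_zero_iff v).2 hx0)
      · exact (H.val_drinfeldT_lt (hy.trans hx) hy0).trans hy
  conv_lhs => rw [← divX_mul_X_add b]
  rw [map_add, map_mul, aeval_X, aeval_C, LinearMap.add_apply, Module.End.mul_apply,
    Module.algebraMap_end_apply]
  have h1 : v (b.coeff 0 • x) = v x := by
    rw [Algebra.smul_def, map_mul, val_algebraMap_of_finite v hb, one_mul]
  rw [Valuation.map_add_eq_of_lt_right v, h1]
  rw [h1]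
  exact key _ _ (H.val_drinfeldT_lt hx hx0)

theorem val_eq_one_of_mem (ha : a.coeff 0 ≠ 0) {x : E} (hx : x ∈ integralTorsion v r θ a)
    (hx0 : x ≠ 0) : v x = 1 := by
  refine le_antisymm hx.2 (not_lt.1 fun h => ?_)
  have h1 := H.val_aeval_of_lt ha h
  rw [mem_drinfeldTorsion.1 hx.1, map_zero] at h1
  exact (Valuation.ne_zero_iff v).2 hx0 h1.symm

include R in
theorem card_integralTorsion_le_of_coeff_ne_zero (ha : a.coeff 0 ≠ 0) (hm : a.Monic) :
    Nat.card (integralTorsion v r θ a) ≤ (Fintype.card Fq ^ (r - 1)) ^ a.natDegree := by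
  have hr := H.two_le
  obtain ⟨hfin, hcard⟩ := finite_ker_aeval_frobenius_pow (κ := κ) (r - 1) (by omega) hm
  refine le_trans ?_ hcard
  refine Nat.card_le_card_of_injective (fun x => ⟨R.red x.1, ?_⟩) ?_
  · rw [LinearMap.mem_ker, ← H.red_aeval R a x.2.2, mem_drinfeldTorsion.1 x.2.1, R.red_zero]
  · intro x y hxy
    have h1 := (R.red_eq_red_iff x.2.2 y.2.2).1 (Subtype.mk_eq_mk.1 hxy)
    by_contra hne
    have h2 := H.val_eq_one_of_mem ha (sub_mem x.2 y.2) (sub_ne_zero.2 fun h => hne (Subtype.ext h))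
    exact h1.ne h2

end

section

variable (H : IsPlaceAboveT v r θ (X : Fq[X]))
include H

theorem mul_eq_neg_of_mem {x : E} (hx : x ∈ integralTorsion v r θ (X : Fq[X])) :
    ∃ ε, v ε < 1 ∧ θ * x = -(x ^ Fintype.card Fq ^ (r - 1) * (1 + ε)) := by
  have hq : 1 < Fintype.card Fq := Fintype.one_lt_card
  refine ⟨θ ^ (Fintype.card Fq - 1) *
    (x ^ Fintype.card Fq ^ (r - 1)) ^ (Fintype.card Fq - 1), ?_, ?_⟩
  · rw [map_mul, map_pow, map_pow, map_pow]
    exact (mul_le_of_le_one_right' (pow_le_one' (pow_le_one' hx.2 _) _)).trans_lt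
      (pow_lt_one₀ zero_le H.lt_one (by omega))
  · have h1 := mem_drinfeldTorsion.1 hx.1
    rw [aeval_X, drinfeldT_apply] at h1
    have h2 : x ^ Fintype.card Fq ^ r = x ^ Fintype.card Fq ^ (r - 1) *
        (x ^ Fintype.card Fq ^ (r - 1)) ^ (Fintype.card Fq - 1) := by
      rw [← pow_succ', Nat.sub_add_cancel hq.le, ← pow_mul, H.pow_eq]
    rw [h2] at h1
    linear_combination h1

theorem val_eq_pow_of_mem {x : E} (hx : x ∈ integralTorsion v r θ (X : Fq[X])) (hx0 : x ≠ 0) :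
    v x ^ (Fintype.card Fq ^ (r - 1) - 1) = v θ := by
  obtain ⟨ε, hε, h⟩ := H.mul_eq_neg_of_mem hx
  have hv0 := (Valuation.ne_zero_iff v).2 hx0
  have h1 := congrArg v h
  rw [map_mul, Valuation.map_neg, map_mul, Valuation.map_one_add_of_lt v hε, mul_one, map_pow] at h1
  refine mul_right_cancel₀ hv0 (Eq.trans ?_ h1.symm)
  rw [← pow_succ, Nat.sub_add_cancel H.one_lt_pow.le]

theorem val_eq_val_of_mem {x y : E} (hx : x ∈ integralTorsion v r θ (X : Fq[X])) (hx0 : x ≠ 0)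
    (hy : y ∈ integralTorsion v r θ (X : Fq[X])) (hy0 : y ≠ 0) : v x = v y := by
  have := H.one_lt_pow
  exact (pow_left_inj₀ zero_le zero_le (by omega)).1
    ((H.val_eq_pow_of_mem hx hx0).trans (H.val_eq_pow_of_mem hy hy0).symm)

include R in
theorem card_integralTorsion_X_le :
    Nat.card (integralTorsion v r θ (X : Fq[X])) ≤ Fintype.card Fq ^ (r - 1) := by
  have hr := H.two_le
  by_cases hex : ∃ y ∈ integralTorsion v r θ (X : Fq[X]), y ≠ 0
  swap
  · push Not at hex
    have : Subsingleton (integralTorsion v r θ (X : Fq[X])) :=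
      ⟨fun x y => Subtype.ext ((hex x x.2).trans (hex y y.2).symm)⟩
    exact (Finite.card_le_one_iff_subsingleton.2 this).trans H.one_lt_pow.le
  obtain ⟨y, hy, hy0⟩ := hex
  obtain ⟨hfin, hcard⟩ := finite_frobeniusFixed (k := Fq) (κ := κ) (r := r - 1) (by omega)
  refine le_trans ?_ hcard
  have hvy := (Valuation.ne_zero_iff v).2 hy0
  have hle : ∀ x ∈ integralTorsion v r θ (X : Fq[X]), v (x / y) ≤ 1 := by
    intro x hx
    rcases eq_or_ne x 0 with rfl | hx0
    · simp
    · rw [map_div₀, H.val_eq_val_of_mem hx hx0 hy hy0, div_self hvy]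
  refine Nat.card_le_card_of_injective (fun x => ⟨R.red (x.1 / y), ?_⟩) ?_
  · have hz := hle x.1 x.2
    rw [mem_frobeniusFixed, ← R.red_pow hz, R.red_eq_red_iff (by rw [map_pow]; exact pow_le_one' hz _) hz]
    obtain ⟨ε, hε, h⟩ := H.mul_eq_neg_of_mem x.2
    obtain ⟨ε', hε', h'⟩ := H.mul_eq_neg_of_mem hy
    have hyQ := pow_ne_zero (Fintype.card Fq ^ (r - 1)) hy0
    have e : (x.1 / y) ^ Fintype.card Fq ^ (r - 1) - x.1 / y =
        x.1 / y * ε' - (x.1 / y) ^ Fintype.card Fq ^ (r - 1) * ε := by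
      have e1 : (1 + ε') * (x.1 / y) = (x.1 / y) ^ Fintype.card Fq ^ (r - 1) * (1 + ε) := by
        rw [div_pow, div_mul_eq_mul_div, mul_div_assoc', div_eq_div_iff hy0 hyQ]
        refine mul_left_cancel₀ H.ne_zero ?_
        linear_combination (1 + ε') * y ^ Fintype.card Fq ^ (r - 1) * h -
          x.1 ^ Fintype.card Fq ^ (r - 1) * (1 + ε) * h'
      linear_combination (-1) * e1
    rw [e]
    refine Valuation.map_sub_lt v ?_ ?_
    · rw [map_mul]; exact (mul_le_of_le_one_left' hz).trans_lt hε'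
    · rw [map_mul, map_pow]; exact (mul_le_of_le_one_left' (pow_le_one' hz _)).trans_lt hε
  · intro x z hxz
    have h1 := (R.red_eq_red_iff (hle x x.2) (hle z z.2)).1 (Subtype.mk_eq_mk.1 hxz)
    by_contra hne
    have hne' : x.1 - z.1 ≠ 0 := sub_ne_zero.2 fun h => hne (Subtype.ext h)
    have h2 := H.val_eq_val_of_mem (sub_mem x.2 z.2) hne' hy hy0
    rw [← sub_div, map_div₀, h2, div_self hvy] at h1
    exact lt_irrefl _ h1

end

end IsPlaceAboveT

end IntegralTorsion

section InertiaAboveT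

open WithZero

section

variable {Fq : Type*} [Field Fq] [Fintype Fq] {E : Type*} [Field E] [Algebra Fq E]
  {v : Valuation E ℤᵐ⁰} {κ : Type*} [Field κ] [Algebra Fq κ] (R : Reduction Fq v κ)
  {r : ℕ} {θ : E} {a l : Fq[X]}

theorem eq_X_of_irreducible_of_coeff_eq_zero {k : Type*} [Field k] {l : k[X]} (hl : l.Monic)
    (hi : Irreducible l) (h0 : l.coeff 0 = 0) : l = X :=
  (eq_of_monic_of_associated monic_X hl
    (irreducible_X.associated_of_dvd hi (X_dvd_iff.2 h0))).symm

theorem drinfeldTorsion_mono {a b : Fq[X]} (h : a ∣ b) :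
    drinfeldTorsion r θ a ≤ drinfeldTorsion r θ b := by
  obtain ⟨c, rfl⟩ := h
  intro x hx
  rw [mem_drinfeldTorsion] at hx ⊢
  rw [mul_comm, map_mul, Module.End.mul_apply, hx, map_zero]

theorem dvd_of_aeval_apply_eq_zero {k V : Type*} [Field k] [AddCommGroup V] [Module k V]
    {T : Module.End k V} {l b : k[X]} (hl : Irreducible l) {x : V} (hx : x ≠ 0)
    (h : aeval T l x = 0) (hb : aeval T b x = 0) : l ∣ b := by
  by_contra hnd
  obtain ⟨u, w, he⟩ := (hl.coprime_iff_not_dvd).2 hnd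
  apply hx
  have := congrArg (fun c => aeval T c x) he
  simpa [h, hb] using this.symm

theorem algEquiv_eq_of_eqOn_torsion {Fq K : Type*} [Field Fq] [Fintype Fq] [Field K]
    {E : Type*} [Field E] [Algebra K E] [Algebra Fq E] {r : ℕ} {θ : E} {a : Fq[X]}
    (hfaith : ∀ σ : E ≃ₐ[K] E, (∀ x ∈ drinfeldTorsion r θ a, σ x = x) → σ = 1)
    {σ τ : E ≃ₐ[K] E} (h : ∀ x ∈ drinfeldTorsion r θ a, σ x = τ x) : σ = τ := by
  rw [eq_comm, ← inv_mul_eq_one]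
  refine hfaith _ fun x hx => ?_
  rw [AlgEquiv.mul_apply, h x hx]
  exact τ.symm_apply_apply x

theorem exists_minimal_nonintegral (H : IsPlaceAboveT v r θ a) (hm : a.Monic) (hd : 0 < a.natDegree)
    (hcard : Nat.card (drinfeldTorsion r θ a) = Fintype.card Fq ^ (r * a.natDegree))
    (hle : Nat.card (integralTorsion v r θ a) ≤ (Fintype.card Fq ^ (r - 1)) ^ a.natDegree)
    (R : Reduction Fq v κ) :
    Nat.card (integralTorsion v r θ a) = (Fintype.card Fq ^ (r - 1)) ^ a.natDegree ∧
    ∃ x₀ ∈ drinfeldTorsion r θ a, 1 < v x₀ ∧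
      (∀ y ∈ drinfeldTorsion r θ a, v y < v x₀ → v y ≤ 1) ∧
      (∀ y ∈ drinfeldTorsion r θ a, ∃ b : Fq[X], v (y - aeval (drinfeldT Fq r θ) b x₀) ≤ 1) ∧
      ∃ m, a.natDegree ≤ m ∧ v θ * v x₀ ^ (Fintype.card Fq ^ (r - 1)) ^ m = 1 := by
  have hr := H.two_le
  have hq : 1 < Fintype.card Fq := Fintype.one_lt_card
  have hfin := H.finite
  have hrd : r * a.natDegree = (r - 1) * a.natDegree + a.natDegree := by
    obtain ⟨k, rfl⟩ : ∃ k, r = k + 1 := ⟨r - 1, by omega⟩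
    rw [Nat.add_sub_cancel]; ring
  have hex : ∃ x ∈ drinfeldTorsion r θ a, 1 < v x := by
    by_contra! hcon
    have h1 : Nat.card (drinfeldTorsion r θ a) ≤ Nat.card (integralTorsion v r θ a) :=
      have := H.finite_integralTorsion
      Nat.card_le_card_of_injective (fun x => ⟨x.1, x.2, hcon x.1 x.2⟩)
        fun x y h => Subtype.ext (Subtype.mk_eq_mk.1 h)
    have h2 := h1.trans hle
    rw [hcard, ← pow_mul, Nat.pow_le_pow_iff_right hq] at h2
    omega
  let S := {y : drinfeldTorsion r θ a // 1 < v y.1}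
  have : Nonempty S := by obtain ⟨x, hx, h⟩ := hex; exact ⟨⟨⟨x, hx⟩, h⟩⟩
  obtain ⟨⟨⟨x₀, hx₀⟩, h1⟩, hmin⟩ := Finite.exists_min fun y : S => v y.1.1
  have hmin' : ∀ y ∈ drinfeldTorsion r θ a, 1 < v y → v x₀ ≤ v y :=
    fun y hy h => hmin ⟨⟨y, hy⟩, h⟩
  obtain ⟨m, hlev⟩ := H.exists_level hx₀ h1
  have happ := fun y hy => H.exists_val_sub_aeval_le_one R hx₀ h1 hmin' hlev (y := y) hy
  have hc1 := H.card_le_mul hx₀ happ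
  have happ2 : ∀ y ∈ drinfeldTorsion r θ a, ∃ b : Fq[X], b.degree < a.natDegree ∧
      v (y - aeval (drinfeldT Fq r θ) b x₀) ≤ 1 := by
    intro y hy
    obtain ⟨b, -, hb⟩ := happ y hy
    refine ⟨b %ₘ a, ?_, ?_⟩
    · rw [← degree_eq_natDegree hm.ne_zero]; exact degree_modByMonic_lt _ hm
    · rwa [aeval_modByMonic_apply (drinfeldT Fq r θ) b (mem_drinfeldTorsion.1 hx₀)]
  have hc2 := H.card_le_mul hx₀ happ2
  rw [hcard, hrd, pow_add] at hc2
  refine ⟨le_antisymm hle ?_, x₀, hx₀, h1, fun y hy h => not_lt.1 fun h' => (hmin' y hy h').not_gt h,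
    fun y hy => (happ y hy).imp fun b hb => hb.2, m + 1, ?_, hlev⟩
  · rw [← pow_mul]
    exact Nat.le_of_mul_le_mul_right hc2 (by positivity)
  · have h3 := hc1.trans (Nat.mul_le_mul_right _ hle)
    rw [hcard, hrd, ← pow_mul, ← pow_add, Nat.pow_le_pow_iff_right hq] at h3
    omega

include R in
theorem card_integralTorsion_le_of_irreducible (H : IsPlaceAboveT v r θ l) (hl : l.Monic)
    (hi : Irreducible l) :
    Nat.card (integralTorsion v r θ l) ≤ (Fintype.card Fq ^ (r - 1)) ^ l.natDegree := by
  by_cases h0 : l.coeff 0 = 0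
  · obtain rfl := eq_X_of_irreducible_of_coeff_eq_zero hl hi h0
    rw [natDegree_X, pow_one]
    exact H.card_integralTorsion_X_le R
  · exact H.card_integralTorsion_le_of_coeff_ne_zero R h0 hl

theorem val_eq_val_of_mem_of_irreducible (H : IsPlaceAboveT v r θ l) (hl : l.Monic)
    (hi : Irreducible l) {x y : E} (hx : x ∈ integralTorsion v r θ l) (hx0 : x ≠ 0)
    (hy : y ∈ integralTorsion v r θ l) (hy0 : y ≠ 0) : v x = v y := by
  by_cases h0 : l.coeff 0 = 0
  · obtain rfl := eq_X_of_irreducible_of_coeff_eq_zero hl hi h0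
    exact H.val_eq_val_of_mem hx hx0 hy hy0
  · rw [H.val_eq_one_of_mem h0 hx hx0, H.val_eq_one_of_mem h0 hy hy0]

include R in
theorem card_integralTorsion_sq_le (H : IsPlaceAboveT v r θ (l ^ 2)) (hl : l.Monic)
    (hi : Irreducible l) : Nat.card (integralTorsion v r θ (l ^ 2)) ≤
      (Fintype.card Fq ^ (r - 1)) ^ (l ^ 2).natDegree := by
  have hfin2 := H.finite
  have hmono : drinfeldTorsion r θ l ≤ drinfeldTorsion r θ (l ^ 2) :=
    drinfeldTorsion_mono (dvd_pow_self l two_ne_zero)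
  have H1 : IsPlaceAboveT v r θ l := ⟨H.two_le, H.ne_zero, H.lt_one,
    Finite.of_injective _ (Submodule.inclusion_injective hmono)⟩
  have hcl := card_integralTorsion_le_of_irreducible R H1 hl hi
  have := H.finite_integralTorsion
  have := H1.finite_integralTorsion
  let f : integralTorsion v r θ (l ^ 2) →ₗ[Fq] E :=
    (aeval (drinfeldT Fq r θ) l).comp (Submodule.subtype _)
  have hr : Nat.card (LinearMap.range f) ≤ Nat.card (integralTorsion v r θ l) := by
    refine Nat.card_le_card_of_injective (Submodule.inclusion ?_) (Submodule.inclusion_injective _)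
    rintro _ ⟨x, rfl⟩
    refine ⟨?_, H.val_aeval_le_one l x.2.2⟩
    have h : aeval (drinfeldT Fq r θ) (l * l) x.1 = 0 := by
      have := mem_drinfeldTorsion.1 x.2.1
      rw [← pow_two]; exact this
    rwa [map_mul] at h
  have hk : Nat.card (LinearMap.ker f) ≤ Nat.card (integralTorsion v r θ l) :=
    Nat.card_le_card_of_injective (fun x => ⟨x.1.1, x.2, x.1.2.2⟩)
      fun x y h => Subtype.ext (Subtype.ext (Subtype.mk_eq_mk.1 h))
  rw [Submodule.card_eq_card_quotient_mul_card (LinearMap.ker f),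
    Nat.card_congr f.quotKerEquivRange.toEquiv, hl.natDegree_pow, pow_mul', pow_two (_ ^ l.natDegree)]
  exact Nat.mul_le_mul (hk.trans hcl) (hr.trans hcl)

end

variable {Fq : Type*} [Field Fq] [Fintype Fq] {K : Type*}
  [Field K] [Algebra Fq K] {t : K} {E : Type} [Field E]
  [Algebra K E] [Algebra Fq E] [IsScalarTower Fq K E] [FiniteDimensional K E] [IsGalois K E]
  {r : ℕ} {a l : Fq[X]}

theorem exists_wild_subgroup {v : Valuation E ℤᵐ⁰} {I : Subgroup (E ≃ₐ[K] E)}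
    (hI : ∀ σ ∈ I, ActsAsPowAt v 1 σ) {n : ℕ} (hn : Fintype.card Fq ^ n ∣ Nat.card I) :
    ∃ P : Subgroup (E ≃ₐ[K] E), Nat.card P = Fintype.card Fq ^ n ∧
      ∀ σ ∈ P, ∀ x ≠ 0, v (σ x - x) < v x := by
  obtain ⟨p, _⟩ := CharP.exists Fq
  obtain ⟨k, hp, hk⟩ := FiniteField.card Fq p
  have : Fact p.Prime := ⟨hp⟩
  have : CharP E p := charP_of_injective_algebraMap (algebraMap Fq E).injective p
  rw [hk, ← pow_mul] at hn ⊢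
  obtain ⟨P, hP⟩ := Sylow.exists_subgroup_card_pow_prime p hn
  refine ⟨P.map I.subtype, ?_, ?_⟩
  · rw [← hP]
    exact (Nat.card_congr (P.equivMapOfInjective I.subtype I.subtype_injective).toEquiv).symm
  · rintro _ ⟨σ, hσ, rfl⟩ x hx
    refine ActsAsPowAt.sub_lt_of_orderOf (p := p) (σ := (σ.1 : E →+* E)) (k := k * n)
      (hI _ σ.2) (fun y => ?_) hx
    have h1 : σ ^ p ^ ((k : ℕ) * n) = 1 := by
      have : (⟨σ, hσ⟩ : P) ^ p ^ ((k : ℕ) * n) = 1 := by rw [← hP]; exact pow_card_eq_one'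
      simpa using congrArg Subtype.val this
    have h2 : (σ.1) ^ p ^ ((k : ℕ) * n) = 1 := by simpa using congrArg Subtype.val h1
    have h3 : ∀ j : ℕ, ((σ.1 : E →+* E))^[j] y = (σ.1 ^ j) y := by
      intro j
      induction j with
      | zero => rfl
      | succ j ih => rw [Function.iterate_succ_apply', ih, pow_succ']; rfl
    rw [h3, h2]; rfl

theorem pow_dvd_of_level {Q m d e : ℕ} {x : ℤᵐ⁰} (hx : x ≠ 0) (hdm : d ≤ m)
    (h : exp (-(e : ℤ)) * x ^ Q ^ m = 1) : Q ^ d ∣ e := by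
  obtain ⟨n, rfl⟩ : ∃ n : ℤ, x = exp n := ⟨log x, (exp_log hx).symm⟩
  rw [← exp_nsmul, ← exp_add, exp_eq_one, nsmul_eq_mul] at h
  have : (Q ^ m : ℤ) * n = e := by push_cast at h; linarith
  refine (pow_dvd_pow Q hdm).trans ?_
  exact_mod_cast Dvd.intro n this

theorem exists_transvections_of_irreducible (h : IsRationalFunctionField Fq t) (hr : 2 ≤ r)
    (hl : l.Monic) (hi : Irreducible l)
    (hcard : Nat.card (drinfeldTorsion r (algebraMap K E t) l) =
      Fintype.card Fq ^ (r * l.natDegree))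
    (hfaith : ∀ σ : E ≃ₐ[K] E, (∀ x ∈ drinfeldTorsion r (algebraMap K E t) l, σ x = x) → σ = 1) :
    ∃ (H : Submodule Fq E) (x₀ : E), H ≤ drinfeldTorsion r (algebraMap K E t) l ∧
      (∀ x ∈ H, drinfeldT Fq r (algebraMap K E t) x ∈ H) ∧
      x₀ ∈ drinfeldTorsion r (algebraMap K E t) l ∧ x₀ ∉ H ∧
      (∀ x ∈ drinfeldTorsion r (algebraMap K E t) l, ∃ b : Fq[X],
        x - aeval (drinfeldT Fq r (algebraMap K E t)) b x₀ ∈ H) ∧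
      ∀ y ∈ H, ∃ σ : E ≃ₐ[K] E, σ x₀ = x₀ + y ∧ ∀ x ∈ H, σ x = x := by
  obtain ⟨v, I, s, -, h2, h3, h4, -⟩ := h.exists_place (E := E) (prime_X (R := Fq))
  obtain ⟨κ, _, _, ⟨R⟩⟩ := exists_reduction (k := Fq) v
  set θ := algebraMap K E t with hθ
  rw [aeval_X] at h3
  have hfin : Finite (drinfeldTorsion r θ l) :=
    Nat.finite_of_card_ne_zero (by rw [hcard]; positivity)
  have H : IsPlaceAboveT v r θ l := by
    refine ⟨hr, fun h0 => ?_, ?_, hfin⟩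
    · rw [← hθ, h0, map_zero] at h3; exact exp_ne_zero h3.symm
    · have := (h2 X).2 dvd_rfl; rwa [aeval_X] at this
  obtain ⟨hH, x₀, hx₀, h1, hmin, happ, m, hdm, hlev⟩ := exists_minimal_nonintegral H hl
    hi.natDegree_pos hcard (card_integralTorsion_le_of_irreducible R H hl hi) R
  have hx0 : v x₀ ≠ 0 := (zero_lt_one.trans h1).ne'
  rw [h3] at hlev
  obtain ⟨P, hP, hPv⟩ := exists_wild_subgroup h4 (n := (r - 1) * l.natDegree)
    (by rw [pow_mul]; exact pow_dvd_of_level hx0 hdm hlev)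
  have hmem : ∀ (σ : E ≃ₐ[K] E), ∀ x ∈ drinfeldTorsion r θ l, σ x ∈ drinfeldTorsion r θ l :=
    fun σ x hx => map_mem_drinfeldTorsion ((σ : E →ₐ[K] E).restrictScalars Fq)
      (σ.commutes t) hx
  have hfix : ∀ σ ∈ P, ∀ x ∈ integralTorsion v r θ l, σ x = x := by
    intro σ hσ x hx
    rcases eq_or_ne x 0 with rfl | hx0
    · exact map_zero σ
    by_contra hne
    have hlt := hPv σ hσ x hx0
    refine hlt.ne (val_eq_val_of_mem_of_irreducible H hl hi ⟨sub_mem (hmem σ x hx.1) hx.1, hlt.le.trans hx.2⟩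
      (sub_ne_zero.2 hne) hx hx0)
  have hsub : ∀ σ ∈ P, σ x₀ - x₀ ∈ integralTorsion v r θ l := fun σ hσ =>
    ⟨sub_mem (hmem σ x₀ hx₀) hx₀, hmin _ (sub_mem (hmem σ x₀ hx₀) hx₀)
      (hPv σ hσ x₀ ((Valuation.ne_zero_iff v).1 hx0))⟩
  have hφ : ∀ (σ : E ≃ₐ[K] E) (b : Fq[X]) (x : E), σ (aeval (drinfeldT Fq r θ) b x) =
      aeval (drinfeldT Fq r θ) b (σ x) := fun σ b x =>
    map_aeval_drinfeldT ((σ : E →ₐ[K] E).restrictScalars Fq) (σ.commutes t) b x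
  have hext : ∀ σ ∈ P, ∀ τ ∈ P, σ x₀ = τ x₀ → σ = τ := by
    intro σ hσ τ hτ he
    refine algEquiv_eq_of_eqOn_torsion hfaith fun x hx => ?_
    obtain ⟨b, hb⟩ := happ x hx
    have hb' : x - aeval (drinfeldT Fq r θ) b x₀ ∈ integralTorsion v r θ l :=
      ⟨sub_mem hx (aeval_mem_drinfeldTorsion b hx₀), hb⟩
    have e := (hfix σ hσ _ hb').trans (hfix τ hτ _ hb').symm
    rw [map_sub, map_sub, hφ, hφ, he] at e
    exact sub_left_inj.1 e
  have hfinH := H.finite_integralTorsion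
  let f : P → integralTorsion v r θ l := fun σ => ⟨σ.1 x₀ - x₀, hsub σ.1 σ.2⟩
  have hf : Function.Bijective f := by
    rw [Nat.bijective_iff_injective_and_card]
    refine ⟨fun σ τ he => Subtype.ext (hext _ σ.2 _ τ.2 ?_), by rw [hP, hH, pow_mul]⟩
    exact sub_left_inj.1 (Subtype.mk_eq_mk.1 he)
  refine ⟨integralTorsion v r θ l, x₀, fun x hx => hx.1, fun x hx =>
    ⟨drinfeldT_mem_drinfeldTorsion hx.1, H.val_drinfeldT_le_one hx.2⟩, hx₀, fun h => h1.not_ge h.2,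
    fun x hx => (happ x hx).imp fun b hb => ⟨sub_mem hx (aeval_mem_drinfeldTorsion b hx₀), hb⟩,
    fun y hy => ?_⟩
  obtain ⟨σ, hσ⟩ := hf.2 ⟨y, hy⟩
  exact ⟨σ.1, eq_add_of_sub_eq' (Subtype.mk_eq_mk.1 hσ), hfix σ.1 σ.2⟩

theorem exists_nonscalar_of_irreducible (h : IsRationalFunctionField Fq t) (hr : 3 ≤ r)
    (hl : l.Monic) (hi : Irreducible l)
    (hcard : Nat.card (drinfeldTorsion r (algebraMap K E t) l) =
      Fintype.card Fq ^ (r * l.natDegree))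
    (hcard2 : Nat.card (drinfeldTorsion r (algebraMap K E t) (l ^ 2)) =
      Fintype.card Fq ^ (r * (l ^ 2).natDegree))
    (hfaith : ∀ σ : E ≃ₐ[K] E,
      (∀ x ∈ drinfeldTorsion r (algebraMap K E t) (l ^ 2), σ x = x) → σ = 1) :
    ∃ σ : E ≃ₐ[K] E, (∀ x ∈ drinfeldTorsion r (algebraMap K E t) l, σ x = x) ∧
      ¬ ∃ b : Fq[X], ∀ x ∈ drinfeldTorsion r (algebraMap K E t) (l ^ 2),
        σ x = aeval (drinfeldT Fq r (algebraMap K E t)) b x := by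
  classical
  obtain ⟨v, I, s, -, h2, h3, h4, -⟩ := h.exists_place (E := E) (prime_X (R := Fq))
  obtain ⟨κ, _, _, ⟨R⟩⟩ := exists_reduction (k := Fq) v
  set θ := algebraMap K E t with hθ
  rw [aeval_X] at h3
  have hfin : Finite (drinfeldTorsion r θ l) :=
    Nat.finite_of_card_ne_zero (by rw [hcard]; positivity)
  have hfin2 : Finite (drinfeldTorsion r θ (l ^ 2)) :=
    Nat.finite_of_card_ne_zero (by rw [hcard2]; positivity)
  have hθ0 : θ ≠ 0 := fun h0 => by rw [← hθ, h0, map_zero] at h3; exact exp_ne_zero h3.symm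
  have hθ1 : v θ < 1 := by have := (h2 X).2 dvd_rfl; rwa [aeval_X] at this
  have H : IsPlaceAboveT v r θ l := ⟨by omega, hθ0, hθ1, hfin⟩
  have H2 : IsPlaceAboveT v r θ (l ^ 2) := ⟨by omega, hθ0, hθ1, hfin2⟩
  have hd := hi.natDegree_pos
  have hd2 : (l ^ 2).natDegree = l.natDegree + l.natDegree := by
    rw [hl.natDegree_pow, two_mul]
  obtain ⟨-, y₀, hy₀, hy1, -, -, m, hdm, hlev⟩ := exists_minimal_nonintegral H2 (hl.pow 2)
    (by omega) hcard2 (card_integralTorsion_sq_le R H2 hl hi) R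
  obtain ⟨hH, x₀, hx₀, h1, hmin, happ, -, -, -⟩ := exists_minimal_nonintegral H hl
    hi.natDegree_pos hcard (card_integralTorsion_le_of_irreducible R H hl hi) R
  have hx0 : v x₀ ≠ 0 := (zero_lt_one.trans h1).ne'
  rw [h3] at hlev
  obtain ⟨P, hP, hPv⟩ := exists_wild_subgroup h4 (n := (r - 1) * (l ^ 2).natDegree)
    (by rw [pow_mul]; exact pow_dvd_of_level (zero_lt_one.trans hy1).ne' hdm hlev)
  have hmem : ∀ (σ : E ≃ₐ[K] E), ∀ x ∈ drinfeldTorsion r θ l, σ x ∈ drinfeldTorsion r θ l :=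
    fun σ x hx => map_mem_drinfeldTorsion ((σ : E →ₐ[K] E).restrictScalars Fq)
      (σ.commutes t) hx
  have hφ : ∀ (σ : E ≃ₐ[K] E) (b : Fq[X]) (x : E), σ (aeval (drinfeldT Fq r θ) b x) =
      aeval (drinfeldT Fq r θ) b (σ x) := fun σ b x =>
    map_aeval_drinfeldT ((σ : E →ₐ[K] E).restrictScalars Fq) (σ.commutes t) b x
  have hfix : ∀ σ ∈ P, ∀ x ∈ integralTorsion v r θ l, σ x = x := by
    intro σ hσ x hx
    rcases eq_or_ne x 0 with rfl | hx0
    · exact map_zero σ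
    by_contra hne
    have hlt := hPv σ hσ x hx0
    exact hlt.ne (val_eq_val_of_mem_of_irreducible H hl hi
      ⟨sub_mem (hmem σ x hx.1) hx.1, hlt.le.trans hx.2⟩ (sub_ne_zero.2 hne) hx hx0)
  have hsub : ∀ σ ∈ P, σ x₀ - x₀ ∈ integralTorsion v r θ l := fun σ hσ =>
    ⟨sub_mem (hmem σ x₀ hx₀) hx₀, hmin _ (sub_mem (hmem σ x₀ hx₀) hx₀)
      (hPv σ hσ x₀ ((Valuation.ne_zero_iff v).1 hx0))⟩
  have hext : ∀ σ ∈ P, ∀ τ ∈ P, σ x₀ = τ x₀ → ∀ x ∈ drinfeldTorsion r θ l, σ x = τ x := by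
    intro σ hσ τ hτ he x hx
    obtain ⟨b, hb⟩ := happ x hx
    have hb' : x - aeval (drinfeldT Fq r θ) b x₀ ∈ integralTorsion v r θ l :=
      ⟨sub_mem hx (aeval_mem_drinfeldTorsion b hx₀), hb⟩
    have e := (hfix σ hσ _ hb').trans (hfix τ hτ _ hb').symm
    rw [map_sub, map_sub, hφ, hφ, he] at e
    exact sub_left_inj.1 e
  have hmono : drinfeldTorsion r θ l ≤ drinfeldTorsion r θ (l ^ 2) :=
    drinfeldTorsion_mono (dvd_pow_self l two_ne_zero)
  by_contra! hcon
  have := H.finite_integralTorsion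
  let f : P → integralTorsion v r θ l := fun σ => ⟨σ.1 x₀ - x₀, hsub σ.1 σ.2⟩
  have hq : 1 < Fintype.card Fq := Fintype.one_lt_card
  let _ := Fintype.ofFinite P
  let _ := Fintype.ofFinite (integralTorsion v r θ l)
  obtain ⟨z, -, hz⟩ := Finset.exists_lt_card_fiber_of_mul_lt_card_of_maps_to (s := Finset.univ)
    (t := Finset.univ) (f := f) (n := Fintype.card Fq ^ l.natDegree) (fun _ _ => Finset.mem_univ _) (by
      rw [Finset.card_univ, Finset.card_univ, ← Nat.card_eq_fintype_card (α := P),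
        ← Nat.card_eq_fintype_card (α := integralTorsion v r θ l), hP, hH, hd2, ← pow_mul, ← pow_add,
        Nat.pow_lt_pow_iff_right hq, mul_add]
      have : 1 * l.natDegree < (r - 1) * l.natDegree := Nat.mul_lt_mul_of_pos_right (by omega) hd
      omega)
  obtain ⟨σ₀, hσ₀⟩ := Finset.card_pos.1 (Nat.zero_le _ |>.trans_lt hz)
  have hσ₀z := (Finset.mem_filter.1 hσ₀).2
  have hb : ∀ σ : {σ ∈ (Finset.univ : Finset P) | f σ = z}, ∃ b : Fq[X],
      b.degree < l.natDegree ∧ ∀ x ∈ drinfeldTorsion r θ (l ^ 2), (σ₀.1⁻¹ * σ.1.1) x =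
        aeval (drinfeldT Fq r θ) (1 + b * l) x := by
    rintro ⟨σ, hσ⟩
    have hσz := (Finset.mem_filter.1 hσ).2
    have hx₀σ : σ.1 x₀ = σ₀.1 x₀ :=
      sub_left_inj.1 (Subtype.mk_eq_mk.1 (hσz.trans hσ₀z.symm))
    have hl1 : ∀ x ∈ drinfeldTorsion r θ l, (σ₀.1⁻¹ * σ.1) x = x := by
      intro x hx
      rw [AlgEquiv.mul_apply, hext _ σ.2 _ σ₀.2 hx₀σ x hx]
      exact σ₀.1.symm_apply_apply x
    obtain ⟨c, hc⟩ := hcon _ hl1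
    obtain ⟨e, he⟩ : l ∣ c - 1 := by
      refine dvd_of_aeval_apply_eq_zero hi ((Valuation.ne_zero_iff v).1 hx0) hx₀ ?_
      rw [map_sub, map_one, LinearMap.sub_apply, ← hc _ (hmono hx₀), hl1 _ hx₀,
        Module.End.one_apply, sub_self]
    refine ⟨e %ₘ l, ?_, fun x hx => ?_⟩
    · rw [← degree_eq_natDegree hl.ne_zero]; exact degree_modByMonic_lt _ hl
    · have hlx : aeval (drinfeldT Fq r θ) l (aeval (drinfeldT Fq r θ) l x) = 0 := by
        rw [← Module.End.mul_apply, ← map_mul, ← pow_two]; exact hx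
      rw [hc x hx, ← sub_add_cancel c 1, he, add_comm, map_add, map_add, mul_comm l, map_mul,
        map_mul, LinearMap.add_apply, LinearMap.add_apply, Module.End.mul_apply,
        Module.End.mul_apply, aeval_modByMonic_apply _ _ hlx]
  choose b hbd hb using hb
  have hinj : Function.Injective fun σ => (⟨b σ, mem_degreeLT.2 (hbd σ)⟩ : degreeLT Fq l.natDegree) := by
    intro σ τ hστ
    have h5 : b σ = b τ := Subtype.mk_eq_mk.1 hστ
    refine Subtype.ext (Subtype.ext (mul_left_cancel (algEquiv_eq_of_eqOn_torsion hfaith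
      (σ := σ₀.1⁻¹ * σ.1.1) (τ := σ₀.1⁻¹ * τ.1.1) fun x hx => ?_)))
    rw [hb σ x hx, hb τ x hx, h5]
  have : Finite (degreeLT Fq l.natDegree) :=
    Finite.of_equiv _ (degreeLTEquiv Fq l.natDegree).symm.toEquiv
  have hle := Nat.card_le_card_of_injective _ hinj
  rw [Nat.card_congr (degreeLTEquiv Fq l.natDegree).toEquiv, Nat.card_fun,
    Nat.card_eq_fintype_card (α := Fin _), Fintype.card_fin, Nat.card_eq_fintype_card (α := Fq),
    Nat.card_eq_fintype_card, Fintype.card_coe] at hle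
  omega

end InertiaAboveT

section TorsionDet

variable {Fq : Type*} [Field Fq] [Fintype Fq] {E : Type*} [Field E] [Algebra Fq E]
  {r : ℕ} {θ : E} {a : Fq[X]}

theorem torsionPoly_drinfeldT (x : E) :
    torsionPoly (drinfeldT Fq r θ) a (drinfeldT Fq r θ x) =
      C θ * torsionPoly (drinfeldT Fq r θ) a x +
      (frobeniusCoeff Fq E ^ (r - 1)) (torsionPoly (drinfeldT Fq r θ) a x) +
      C (θ ^ (Fintype.card Fq - 1)) *
        (frobeniusCoeff Fq E ^ r) (torsionPoly (drinfeldT Fq r θ) a x) := by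
  ext i
  rw [coeff_add, coeff_add, coeff_C_mul, coeff_C_mul, coeff_frobeniusCoeff_pow,
    coeff_frobeniusCoeff_pow, coeff_torsionPoly, coeff_torsionPoly, ← drinfeldT_apply]
  have : ∀ b : Fq[X], aeval (drinfeldT Fq r θ) b (drinfeldT Fq r θ x) =
      drinfeldT Fq r θ (aeval (drinfeldT Fq r θ) b x) := by
    intro b
    have h := congrArg (fun c => aeval (drinfeldT Fq r θ) c x) (mul_comm b X)
    simpa using h
  exact this _

theorem dvd_torsionPoly_sub {x : E} (hx : x ∈ drinfeldTorsion r θ a) :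
    a.map (algebraMap Fq E) ∣ C (θ ^ (Fintype.card Fq - 1)) *
        (frobeniusCoeff Fq E ^ r) (torsionPoly (drinfeldT Fq r θ) a x) -
      ((X - C θ) * torsionPoly (drinfeldT Fq r θ) a x -
        (frobeniusCoeff Fq E ^ (r - 1)) (torsionPoly (drinfeldT Fq r θ) a x)) := by
  have h := X_mul_torsionPoly (drinfeldT Fq r θ) a (mem_drinfeldTorsion.1 hx)
  rw [torsionPoly_drinfeldT] at h
  exact ⟨-C x, by linear_combination -h⟩

theorem mul_det_cyclic {S : Type*} [CommRing S] {n : ℕ} (hn : Odd n) (g : ℕ → Fin (n + 2) → S)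
    (c d : S) (hg : ∀ j, c * g (n + 2) j = d * g 0 j - g (n + 1) j) :
    c * (Matrix.of fun (i j : Fin (n + 2)) => g (i + 1) j).det =
      d * (Matrix.of fun (i j : Fin (n + 2)) => g i j).det := by
  set B : Matrix (Fin (n + 2)) (Fin (n + 2)) S := Matrix.of fun i j => g (i + 1) j with hB
  have h1 : c * B.det = (B.updateRow (Fin.last _) (c • B (Fin.last _))).det := by
    rw [Matrix.det_updateRow_smul, Matrix.updateRow_eq_self]
  have h2 : c • B (Fin.last _) = d • g 0 + (-1 : S) • g (n + 1) := by
    ext j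
    simpa [B, sub_eq_add_neg] using hg j
  have h3 : (B.updateRow (Fin.last _) (g (n + 1))).det = 0 := by
    have hne : (⟨n, by omega⟩ : Fin (n + 2)) ≠ Fin.last _ := by simp [Fin.ext_iff]
    refine Matrix.det_zero_of_row_eq hne ?_
    rw [Matrix.updateRow_self, Matrix.updateRow_ne hne]
    rfl
  have h4 : B.updateRow (Fin.last _) (g 0) =
      (Matrix.of fun (i j : Fin (n + 2)) => g i j).submatrix (finRotate _) id := by
    ext i j
    refine Fin.lastCases ?_ (fun i => ?_) i
    · simp
    · rw [Matrix.updateRow_ne (Fin.castSucc_lt_last i).ne]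
      simp [B]
  rw [h1, h2, Matrix.det_updateRow_add, Matrix.det_updateRow_smul, Matrix.det_updateRow_smul, h3,
    h4, Matrix.det_permute, sign_finRotate, show n + 2 - 1 = n + 1 from rfl, hn.add_one.neg_one_pow]
  simp

theorem dvd_frobeniusCoeff_torsionDet (hr : Odd r) (hr3 : 3 ≤ r) {x : Fin r → E}
    (hx : ∀ j, x j ∈ drinfeldTorsion r θ a) :
    a.map (algebraMap Fq E) ∣ C (θ ^ (Fintype.card Fq - 1)) *
        frobeniusCoeff Fq E (torsionDet (drinfeldT Fq r θ) a x) -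
      (X - C θ) * torsionDet (drinfeldT Fq r θ) a x := by
  obtain ⟨m, rfl⟩ : ∃ m, r = m + 2 := ⟨r - 2, by omega⟩
  have hm : Odd m := by
    have h2 : (m + 2) % 2 = 1 := Nat.odd_iff.1 hr
    exact Nat.odd_iff.2 (by omega)
  set A := a.map (algebraMap Fq E)
  let π := Ideal.Quotient.mk (Ideal.span {A})
  rw [← Ideal.mem_span_singleton, ← Ideal.Quotient.mk_eq_mk_iff_sub_mem, map_mul, map_mul]
  have h := mul_det_cyclic hm
    (fun i j => π ((frobeniusCoeff Fq E ^ i) (torsionPoly (drinfeldT Fq (m + 2) θ) a (x j))))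
    (π (C (θ ^ (Fintype.card Fq - 1)))) (π (X - C θ)) (fun j => by
      have := dvd_torsionPoly_sub (hx j)
      rw [← Ideal.mem_span_singleton, ← Ideal.Quotient.mk_eq_mk_iff_sub_mem, map_mul, map_sub,
        map_mul] at this
      exact this)
  convert h using 2
  · rw [torsionDet, RingHom.map_det, RingHom.map_det]
    congr 1
    ext i j
    simp only [RingHom.mapMatrix_apply, Matrix.map_apply, Matrix.of_apply, pow_succ',
      RingHom.mul_def, RingHom.comp_apply]
    rfl
  · rw [torsionDet, RingHom.map_det]
    rfl

theorem dvd_frobeniusCoeff_pow_sub {D : E[X]} (hD : a.map (algebraMap Fq E) ∣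
      C (θ ^ (Fintype.card Fq - 1)) * frobeniusCoeff Fq E D - (X - C θ) * D) (m : ℕ) :
    a.map (algebraMap Fq E) ∣ C (θ ^ (Fintype.card Fq ^ m - 1)) * (frobeniusCoeff Fq E ^ m) D -
      (∏ i ∈ Finset.range m, (X - C (θ ^ Fintype.card Fq ^ i))) * D := by
  have hF : ∀ z : E, frobeniusCoeff Fq E (C z) = C (z ^ Fintype.card Fq) := by
    intro z; simp [frobeniusCoeff]
  have hq : 1 < Fintype.card Fq := Fintype.one_lt_card
  induction m with
  | zero => simp
  | succ m ih =>
    obtain ⟨g, hg⟩ := ih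
    obtain ⟨g₁, hg₁⟩ := hD
    have h := congrArg (frobeniusCoeff Fq E) hg
    have ha : frobeniusCoeff Fq E (a.map (algebraMap Fq E)) = a.map (algebraMap Fq E) := by
      simpa using frobeniusCoeff_pow_map (E := E) a 1
    simp only [map_sub, map_mul, map_prod, hF, ha] at h
    have hX : frobeniusCoeff Fq E X = X := by simp [frobeniusCoeff]
    simp only [hX, ← pow_mul, ← pow_succ] at h
    have he : θ ^ (Fintype.card Fq ^ (m + 1) - 1) =
        θ ^ (Fintype.card Fq - 1) * θ ^ ((Fintype.card Fq ^ m - 1) * Fintype.card Fq) := by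
      rw [← pow_add]
      congr 1
      have : 1 ≤ Fintype.card Fq ^ m := Nat.one_le_pow _ _ (by omega)
      obtain ⟨k, hk⟩ := Nat.exists_eq_add_of_le this
      rw [pow_succ, hk, Nat.add_sub_cancel_left, add_mul]
      omega
    rw [Finset.prod_range_succ', he, C_mul, pow_zero, pow_one, pow_succ', RingHom.mul_def,
      RingHom.comp_apply]
    refine ⟨C (θ ^ (Fintype.card Fq - 1)) * frobeniusCoeff Fq E g +
      (∏ i ∈ Finset.range m, (X - C (θ ^ Fintype.card Fq ^ (i + 1)))) * g₁, ?_⟩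
    linear_combination C (θ ^ (Fintype.card Fq - 1)) * h +
      (∏ i ∈ Finset.range m, (X - C (θ ^ Fintype.card Fq ^ (i + 1)))) * hg₁

theorem dvd_torsionPoly_aeval_sub (T : Module.End Fq E) (b : Fq[X]) {x : E}
    (hx : aeval T a x = 0) :
    a.map (algebraMap Fq E) ∣
      torsionPoly T a (aeval T b x) - b.map (algebraMap Fq E) * torsionPoly T a x := by
  induction b using Polynomial.induction_on generalizing x with
  | C c =>
    rw [aeval_C, Module.algebraMap_end_apply, map_smul, map_C]
    simp [Algebra.smul_def, Polynomial.algebraMap_apply]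
  | add p q hp hq =>
    rw [map_add, LinearMap.add_apply, map_add, Polynomial.map_add, add_mul, add_sub_add_comm]
    exact dvd_add (hp hx) (hq hx)
  | monomial n c ih =>
    have hTx : aeval T a (T x) = 0 := by
      have h := congrArg (fun c => aeval T c x) (mul_comm a X)
      simpa [hx] using h
    rw [pow_succ, ← mul_assoc, map_mul _ (C c * X ^ n), Module.End.mul_apply, aeval_X,
      Polynomial.map_mul, map_X]
    obtain ⟨g, hg⟩ := ih hTx
    have h := X_mul_torsionPoly T a hx
    refine ⟨g - (C c * X ^ n).map (algebraMap Fq E) * C x, ?_⟩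
    linear_combination hg - (C c * X ^ n).map (algebraMap Fq E) * h

theorem map_torsionPoly (σ : E →ₐ[Fq] E) (hσ : σ θ = θ) (x : E) :
    (torsionPoly (drinfeldT Fq r θ) a x).map (σ : E →+* E) =
      torsionPoly (drinfeldT Fq r θ) a (σ x) := by
  ext i
  rw [coeff_map, coeff_torsionPoly, coeff_torsionPoly]
  exact map_aeval_drinfeldT σ hσ _ x

theorem dvd_map_torsionDet_sub (σ : E →ₐ[Fq] E) (hσ : σ θ = θ) {n : ℕ} {x : Fin n → E}
    (hx : ∀ j, x j ∈ drinfeldTorsion r θ a) {B : Matrix (Fin n) (Fin n) Fq[X]}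
    (hB : ∀ j, σ (x j) = ∑ k, aeval (drinfeldT Fq r θ) (B k j) (x k)) :
    a.map (algebraMap Fq E) ∣ (torsionDet (drinfeldT Fq r θ) a x).map (σ : E →+* E) -
      B.det.map (algebraMap Fq E) * torsionDet (drinfeldT Fq r θ) a x := by
  set A := a.map (algebraMap Fq E) with hA
  let π := Ideal.Quotient.mk (Ideal.span {A})
  have hπ : ∀ f g : E[X], π f = π g ↔ A ∣ f - g := fun f g => by
    rw [← Ideal.mem_span_singleton, ← Ideal.Quotient.mk_eq_mk_iff_sub_mem]
  have hFA : ∀ i f, A ∣ f → A ∣ (frobeniusCoeff Fq E ^ i) f := by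
    rintro i _ ⟨g, rfl⟩
    rw [map_mul, hA, frobeniusCoeff_pow_map]
    exact dvd_mul_right _ _
  have hcomm : ∀ (i : ℕ) (f : E[X]), ((frobeniusCoeff Fq E ^ i) f).map (σ : E →+* E) =
      (frobeniusCoeff Fq E ^ i) (f.map (σ : E →+* E)) := by
    intro i f
    ext m
    rw [coeff_map, coeff_frobeniusCoeff_pow, coeff_frobeniusCoeff_pow, coeff_map, map_pow]
  rw [← hπ, mul_comm, map_mul]
  have e1 : (torsionDet (drinfeldT Fq r θ) a x).map (σ : E →+* E) = (Matrix.of fun i j : Fin n =>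
      (frobeniusCoeff Fq E ^ (i : ℕ)) (torsionPoly (drinfeldT Fq r θ) a (σ (x j)))).det := by
    rw [torsionDet, ← coe_mapRingHom, RingHom.map_det]
    congr 1
    ext1 i j
    simp only [RingHom.mapMatrix_apply, Matrix.map_apply, Matrix.of_apply, coe_mapRingHom]
    rw [hcomm, map_torsionPoly σ hσ]
  have e2 : B.det.map (algebraMap Fq E) = (B.map (Polynomial.map (algebraMap Fq E))).det := by
    rw [← coe_mapRingHom, RingHom.map_det]; rfl
  rw [e1, e2, torsionDet, RingHom.map_det, RingHom.map_det, RingHom.map_det, ← Matrix.det_mul]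
  congr 1
  ext1 i j
  simp only [RingHom.mapMatrix_apply, Matrix.map_apply, Matrix.of_apply, Matrix.mul_apply]
  rw [hB, map_sum, map_sum, map_sum]
  refine Finset.sum_congr rfl fun k _ => ?_
  rw [← map_mul, hπ]
  have h := hFA i _ (dvd_torsionPoly_aeval_sub (drinfeldT Fq r θ) (B k j) (hx k))
  rw [map_sub, map_mul, frobeniusCoeff_pow_map] at h
  rwa [mul_comm (((frobeniusCoeff Fq E) ^ (i : ℕ)) _)]

end TorsionDet

theorem IsRationalFunctionField.exists_isTorsionBasis {Fq : Type*} [Field Fq] [Fintype Fq]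
    {K : Type*} [Field K] [Algebra Fq K] {t : K} (h : IsRationalFunctionField Fq t) {E : Type}
    [Field E] [Algebra K E] [Algebra Fq E] [IsScalarTower Fq K E] [FiniteDimensional K E]
    [IsGalois K E] {r : ℕ} (hr : 2 ≤ r) {a : Fq[X]} (hm : a.Monic) (hd : 0 < a.natDegree)
    (hcard : Nat.card (drinfeldTorsion r (algebraMap K E t) a) =
      Fintype.card Fq ^ (r * a.natDegree)) :
    ∃ x : Fin r → E, IsTorsionBasis (drinfeldT Fq r (algebraMap K E t)) a x ∧
      ∀ l : Fq[X], l.Monic → 0 < l.natDegree → ¬ l.map (algebraMap Fq E) ∣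
        torsionDet (drinfeldT Fq r (algebraMap K E t)) a x := by
  obtain ⟨v, I, s, -, -, h3, -, -⟩ := h.inv.exists_place (E := E) (prime_X (R := Fq))
  obtain ⟨κ, _, _, ⟨R⟩⟩ := exists_reduction (k := Fq) v
  rw [aeval_X, map_inv₀, map_inv₀, WithZero.exp_neg, inv_inj] at h3
  have hcard1 : 1 < Nat.card (drinfeldTorsion r (algebraMap K E t) a) := by
    rw [hcard]; exact Nat.one_lt_pow (by positivity) Fintype.one_lt_card
  have hfin : Finite (drinfeldTorsion r (algebraMap K E t) a) :=
    Nat.finite_of_card_ne_zero (by omega)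
  obtain ⟨x₀, hx₀⟩ := Finite.exists_max fun x : drinfeldTorsion r (algebraMap K E t) a => v x.1
  have hx0 : x₀.1 ≠ 0 := by
    intro h0
    have : Nontrivial (drinfeldTorsion r (algebraMap K E t) a) :=
      Finite.one_lt_card_iff_nontrivial.1 hcard1
    obtain ⟨y, hy⟩ := exists_ne (0 : drinfeldTorsion r (algebraMap K E t) a)
    have h1 := hx₀ y
    rw [h0, map_zero, le_zero_iff, Valuation.zero_iff] at h1
    exact hy (Subtype.ext h1)
  have H : IsMaxTorsion v r (algebraMap K E t) a x₀.1 :=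
    ⟨hr, by rw [h3, ← WithZero.exp_zero, WithZero.exp_lt_exp]; exact_mod_cast Nat.card_pos,
      hm, hd, x₀.2, hx0, fun y hy => hx₀ ⟨y, hy⟩⟩
  obtain ⟨x, η, hη, hli, hx⟩ := H.exists_isTorsionBasis R hcard
  exact ⟨x, hx, fun l hl hl0 => H.not_dvd_torsionDet R hx.mem hη hli hl hl0⟩

section GoodReduction

open WithZero

variable {Fq : Type*} [Field Fq] [Fintype Fq] {E : Type*} [Field E] [Algebra Fq E]
  {v : Valuation E ℤᵐ⁰} {κ : Type*} [Field κ] [Algebra Fq κ] (R : Reduction Fq v κ)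
  {r : ℕ} {θ : E} {a l : Fq[X]}

namespace Reduction

include R in
theorem val_aeval_le {z : E} (hz : v z ≤ 1) (b : Fq[X]) : v (aeval z b) ≤ 1 := by
  rw [aeval_eq_sum_range]
  refine Valuation.map_sum_le v fun i _ => ?_
  rw [Algebra.smul_def, map_mul, map_pow]
  exact mul_le_one' (R.val_algebraMap_le _) (pow_le_one' hz _)

theorem red_aeval {z : E} (hz : v z ≤ 1) (b : Fq[X]) :
    R.red (aeval z b) = aeval (R.red z) b := by
  induction b using Polynomial.induction_on' with
  | add p q hp hq =>
    rw [map_add, R.red_add (R.val_aeval_le hz p) (R.val_aeval_le hz q), hp, hq, map_add]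
  | monomial n c =>
    rw [aeval_monomial, aeval_monomial, R.red_mul (R.val_algebraMap_le c)
      (by rw [map_pow]; exact pow_le_one' hz _), R.red_algebraMap, R.red_pow hz]

theorem val_coeff_sub_le {p q : E[X]} (hp : ∀ i, v (p.coeff i) ≤ 1)
    (hq : ∀ i, v (q.coeff i) ≤ 1) (i : ℕ) : v ((p - q).coeff i) ≤ 1 := by
  rw [coeff_sub]
  exact (v.map_sub _ _).trans (max_le (hp i) (hq i))

theorem redPoly_sub {p q : E[X]} (hp : ∀ i, v (p.coeff i) ≤ 1) (hq : ∀ i, v (q.coeff i) ≤ 1) :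
    R.redPoly (p - q) = R.redPoly p - R.redPoly q := by
  ext i
  rw [coeff_sub, coeff_redPoly, coeff_redPoly, coeff_redPoly, coeff_sub, R.red_sub (hp i) (hq i)]

theorem val_coeff_C_le {z : E} (hz : v z ≤ 1) (i : ℕ) : v ((C z).coeff i) ≤ 1 := by
  rw [coeff_C]
  split_ifs
  · exact hz
  · simp

include R in
theorem val_coeff_X_sub_C_le {z : E} (hz : v z ≤ 1) (i : ℕ) : v ((X - C z).coeff i) ≤ 1 :=
  val_coeff_sub_le (fun i => by simpa using R.val_coeff_map_le X i) (val_coeff_C_le hz) i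

theorem redPoly_X_sub_C {z : E} (hz : v z ≤ 1) : R.redPoly (X - C z) = X - C (R.red z) := by
  rw [R.redPoly_sub (fun i => by simpa using R.val_coeff_map_le X i) (val_coeff_C_le hz),
    redPoly_X, redPoly_C]

theorem val_coeff_frobeniusCoeff_pow_le {D : E[X]} (hD : ∀ i, v (D.coeff i) ≤ 1) (m i : ℕ) :
    v (((frobeniusCoeff Fq E ^ m) D).coeff i) ≤ 1 := by
  rw [coeff_frobeniusCoeff_pow, map_pow]
  exact pow_le_one' (hD i) _

theorem redPoly_frobeniusCoeff_pow {D : E[X]} (hD : ∀ i, v (D.coeff i) ≤ 1) (m : ℕ) :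
    R.redPoly ((frobeniusCoeff Fq E ^ m) D) = (frobeniusCoeff Fq κ ^ m) (R.redPoly D) := by
  ext i
  rw [coeff_redPoly, coeff_frobeniusCoeff_pow, coeff_frobeniusCoeff_pow, coeff_redPoly,
    R.red_pow (hD i)]

/-- Reduction of the Frobenius relation satisfied by the torsion determinant. -/
theorem dvd_redPoly_frobenius (ha : a.Monic) {c z : E} (hc : v c ≤ 1) (hz : v z ≤ 1) {D : E[X]}
    (hD : ∀ i, v (D.coeff i) ≤ 1)
    (h : a.map (algebraMap Fq E) ∣ C c * frobeniusCoeff Fq E D - (X - C z) * D) :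
    a.map (algebraMap Fq κ) ∣ C (R.red c) * frobeniusCoeff Fq κ (R.redPoly D) -
      (X - C (R.red z)) * R.redPoly D := by
  have h0 : ∀ i, v ((frobeniusCoeff Fq E D).coeff i) ≤ 1 := by
    simpa using val_coeff_frobeniusCoeff_pow_le (Fq := Fq) hD 1
  have h1 := val_coeff_mul_le (val_coeff_C_le hc) h0
  have h2 := val_coeff_mul_le (R.val_coeff_X_sub_C_le hz) hD
  have h3 := R.map_dvd_redPoly ha (val_coeff_sub_le h1 h2) h
  have h4 := R.redPoly_frobeniusCoeff_pow hD 1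
  rw [pow_one, pow_one] at h4
  rwa [R.redPoly_sub h1 h2, R.redPoly_mul (val_coeff_C_le hc) h0,
    R.redPoly_mul (R.val_coeff_X_sub_C_le hz) hD, redPoly_C, R.redPoly_X_sub_C hz, h4] at h3

include R in
theorem val_coeff_modByMonic_le (hl : l.Monic) {D : E[X]} (hD : ∀ i, v (D.coeff i) ≤ 1) (i : ℕ) :
    v ((D %ₘ l.map (algebraMap Fq E)).coeff i) ≤ 1 := by
  obtain ⟨P, rfl⟩ := exists_map_subtype_eq hD
  obtain ⟨L, hL⟩ := exists_map_subtype_eq (R.val_coeff_map_le l)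
  have hinj : Function.Injective v.valuationSubring.subtype := Subtype.val_injective
  have hLm : L.Monic := monic_of_injective hinj (by rw [hL]; exact hl.map _)
  rw [← hL, ← map_modByMonic _ hLm, coeff_map]
  exact ((P %ₘ L).coeff i).2

theorem not_dvd_redPoly (hl : l.Monic) (hθ : v θ ≤ 1) (hvl : v (aeval θ l) = 1)
    {D : E[X]} (hD : ∀ i, v (D.coeff i) ≤ 1) (hlD : ¬ l.map (algebraMap Fq E) ∣ D)
    (hF : l.map (algebraMap Fq E) ∣
      C (θ ^ (Fintype.card Fq - 1)) * frobeniusCoeff Fq E D - (X - C θ) * D) :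
    ¬ l.map (algebraMap Fq κ) ∣ R.redPoly D := by
  set L := l.map (algebraMap Fq E) with hL
  have hLm : L.Monic := hl.map _
  set D₀ := D %ₘ L with hD₀
  have hD₀v : ∀ i, v (D₀.coeff i) ≤ 1 := R.val_coeff_modByMonic_le hl hD
  have hne : D₀ ≠ 0 := fun h => hlD ((modByMonic_eq_zero_iff_dvd hLm).1 h)
  obtain ⟨i₀, hi₀, hmax⟩ := D₀.support.exists_max_image (fun i => v (D₀.coeff i))
    (support_nonempty.2 hne)
  set δ := D₀.coeff i₀ with hδ
  have hδ0 : δ ≠ 0 := mem_support_iff.1 hi₀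
  set D₁ := C δ⁻¹ * D₀ with hD₁
  have hD₀₁ : D₀ = C δ * D₁ := by
    rw [hD₁, ← mul_assoc, ← C_mul, mul_inv_cancel₀ hδ0, C_1, one_mul]
  have hD₁v : ∀ i, v (D₁.coeff i) ≤ 1 := by
    intro i
    rw [hD₁, coeff_C_mul, map_mul, map_inv₀, ← div_eq_inv_mul]
    by_cases hi : i ∈ D₀.support
    · exact div_le_one_of_le₀ (hmax i hi) zero_le
    · rw [notMem_support_iff.1 hi]; simp
  have hlD₁ : ¬ l.map (algebraMap Fq κ) ∣ R.redPoly D₁ := by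
    intro h
    have h0 := eq_zero_of_dvd_of_degree_lt h (by
      rw [degree_map, degree_eq_natDegree hl.ne_zero, degree_lt_iff_coeff_zero]
      intro m hm
      rw [coeff_redPoly, hD₁, coeff_C_mul, (degree_lt_iff_coeff_zero _ _).1
        (show D₀.degree < l.natDegree from by
          rw [← degree_eq_natDegree hl.ne_zero, ← degree_map l (algebraMap Fq E)]
          exact degree_modByMonic_lt _ hLm) m hm, mul_zero, red_zero])
    have h1 := (R.redPoly_eq_zero_iff hD₁v).1 h0 i₀
    rw [hD₁, coeff_C_mul, ← hδ, inv_mul_cancel₀ hδ0, map_one] at h1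
    exact lt_irrefl _ h1
  have hδ1 : v δ ≤ 1 := hD₀v i₀
  have hsub : L ∣ D - D₀ := by
    rw [hD₀]; exact ⟨D /ₘ L, by rw [sub_eq_iff_eq_add']; exact (modByMonic_add_div D L).symm⟩
  rcases hδ1.eq_or_lt with h1 | h1
  · intro h
    have h2 := R.map_dvd_redPoly hl (val_coeff_sub_le hD hD₀v) hsub
    rw [R.redPoly_sub hD hD₀v, dvd_sub_right h, hD₀₁, R.redPoly_mul (val_coeff_C_le hδ1) hD₁v,
      redPoly_C] at h2
    refine hlD₁ ((IsUnit.dvd_mul_left ?_).1 h2)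
    rw [isUnit_C, isUnit_iff_ne_zero, Ne, R.red_eq_zero_iff hδ1, h1]
    exact lt_irrefl _
  · exfalso
    have hFsub : L ∣ frobeniusCoeff Fq E (D - D₀) := by
      obtain ⟨g, hg⟩ := hsub
      rw [hg, map_mul]
      have h2 := frobeniusCoeff_pow_map (E := E) l 1
      rw [pow_one] at h2
      rw [hL, h2]
      exact dvd_mul_right _ _
    have hq : 1 < Fintype.card Fq := Fintype.one_lt_card
    have h2 : L ∣ C δ * (C ((θ * δ) ^ (Fintype.card Fq - 1)) * frobeniusCoeff Fq E D₁ -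
        (X - C θ) * D₁) := by
      have h3 : C δ * (C ((θ * δ) ^ (Fintype.card Fq - 1)) * frobeniusCoeff Fq E D₁ -
          (X - C θ) * D₁) = (C (θ ^ (Fintype.card Fq - 1)) * frobeniusCoeff Fq E D -
          (X - C θ) * D) - (C (θ ^ (Fintype.card Fq - 1)) * frobeniusCoeff Fq E (D - D₀) -
          (X - C θ) * (D - D₀)) := by
        have h4 : frobeniusCoeff Fq E (C δ) = C δ * C δ ^ (Fintype.card Fq - 1) := by
          rw [← pow_succ', Nat.sub_add_cancel hq.le]
          simp [frobeniusCoeff]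
        rw [map_sub, hD₀₁, map_mul _ (C δ) D₁, h4, mul_pow, C_mul, C_pow, C_pow]
        ring
      rw [h3]
      exact dvd_sub hF (dvd_sub (hFsub.mul_left _) (hsub.mul_left _))
    rw [IsUnit.dvd_mul_left (isUnit_C.2 (isUnit_iff_ne_zero.2 hδ0))] at h2
    have hc : v ((θ * δ) ^ (Fintype.card Fq - 1)) < 1 := by
      rw [map_pow, map_mul]
      exact pow_lt_one₀ zero_le ((mul_le_of_le_one_left' hθ).trans_lt h1) (by omega)
    have h3 := R.dvd_redPoly_frobenius hl hc.le hθ hD₁v h2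
    rw [(R.red_eq_zero_iff hc.le).2 hc, C_0, zero_mul, zero_sub, dvd_neg] at h3
    refine hlD₁ (IsCoprime.dvd_of_dvd_mul_left ?_ h3)
    refine IsCoprime.symm ((irreducible_X_sub_C _).coprime_iff_not_dvd.2 ?_)
    rw [dvd_iff_isRoot, IsRoot.def, eval_map_algebraMap, ← R.red_aeval hθ,
      R.red_eq_zero_iff hvl.le, hvl]
    exact lt_irrefl _

theorem isCoprime_redPoly (hl : l.Monic) (hi : Irreducible l) (hθ : v θ = 1)
    (hvl : v (aeval θ l) = 1)
    {D : E[X]} (hD : ∀ i, v (D.coeff i) ≤ 1) (hlD : ¬ l.map (algebraMap Fq E) ∣ D)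
    (hF : l.map (algebraMap Fq E) ∣
      C (θ ^ (Fintype.card Fq - 1)) * frobeniusCoeff Fq E D - (X - C θ) * D) :
    IsCoprime (l.map (algebraMap Fq κ)) (R.redPoly D) := by
  have hnd := R.not_dvd_redPoly hl hθ.le hvl hD hlD hF
  have hθq : v (θ ^ (Fintype.card Fq - 1)) ≤ 1 := by rw [map_pow, hθ, one_pow]
  have h1 := R.dvd_redPoly_frobenius hl hθq hθ.le hD hF
  have hc : R.red (θ ^ (Fintype.card Fq - 1)) ≠ 0 := by
    rw [Ne, R.red_eq_zero_iff hθq, map_pow, hθ, one_pow]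
    exact lt_irrefl _
  set J : Ideal κ[X] := Ideal.span {l.map (algebraMap Fq κ), R.redPoly D} with hJ
  have hlJ : l.map (algebraMap Fq κ) ∈ J := Ideal.subset_span (by simp)
  have hDJ : R.redPoly D ∈ J := Ideal.subset_span (by simp)
  have hJ0 : J ≠ ⊥ := by
    intro h
    rw [h, Ideal.mem_bot, Polynomial.map_eq_zero] at hlJ
    exact hl.ne_zero hlJ
  obtain ⟨b₀, -, hb⟩ := exists_span_eq_of_frobenius_stable (k := Fq) J hJ0 hc (by
    intro f hf
    change C _ * frobeniusCoeff Fq κ f ∈ J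
    obtain ⟨y, z, rfl⟩ := Ideal.mem_span_pair.1 hf
    have h2 := frobeniusCoeff_pow_map (E := κ) l 1
    rw [pow_one] at h2
    rw [map_add, map_mul, map_mul, h2, mul_add, mul_left_comm, mul_left_comm _ _
      (frobeniusCoeff Fq κ (R.redPoly D)), ← mul_assoc]
    refine J.add_mem (J.mul_mem_left _ hlJ) (J.mul_mem_left _ ?_)
    have h3 := J.add_mem (J.mem_of_dvd h1 hlJ) (J.mul_mem_left (X - C (R.red θ)) hDJ)
    rwa [sub_add_cancel] at h3)
  have hdvd : b₀ ∣ l := by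
    rw [hb, Ideal.mem_span_singleton] at hlJ
    exact (map_dvd_map' _).1 hlJ
  rcases hi.dvd_iff.1 hdvd with h | h
  · have h2 : J = ⊤ := by
      rw [hb, Ideal.span_singleton_eq_top]
      exact h.map (mapRingHom (algebraMap Fq κ))
    have h3 : (1 : κ[X]) ∈ J := by rw [h2]; trivial
    obtain ⟨y, z, h4⟩ := Ideal.mem_span_pair.1 h3
    exact ⟨y, z, h4⟩
  · rw [hb, Ideal.mem_span_singleton] at hDJ
    exact absurd (((map_dvd_map' _).2 h.dvd).trans hDJ) hnd

end Reduction

theorem prod_X_sub_C_frobenius {k κ : Type*} [Field k] [Fintype k] [Field κ] [Algebra k κ]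
    {p : k[X]} (hp : p.Monic) (hi : Irreducible p) {z : κ} (hz : aeval z p = 0)
    (hzm : z ^ Fintype.card k ^ p.natDegree = z) :
    ∏ i ∈ Finset.range p.natDegree, (X - C (z ^ Fintype.card k ^ i)) = p.map (algebraMap k κ) := by
  set g := ∏ i ∈ Finset.range p.natDegree, (X - C (z ^ Fintype.card k ^ i)) with hg
  have hm : g.Monic := monic_prod_of_monic _ _ fun i _ => monic_X_sub_C _
  have hFg : frobeniusCoeff k κ g = g := by
    have h1 : ∀ i, frobeniusCoeff k κ (X - C (z ^ Fintype.card k ^ i)) =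
        X - C (z ^ Fintype.card k ^ (i + 1)) := by
      intro i
      rw [frobeniusCoeff, coe_mapRingHom, Polynomial.map_sub, map_X, map_C]
      change X - C ((z ^ Fintype.card k ^ i) ^ Fintype.card k) = _
      rw [← pow_mul, ← pow_succ]
    rw [hg, map_prod, Finset.prod_congr rfl fun i _ => h1 i]
    have h2 := Finset.prod_range_succ' (fun i => X - C (z ^ Fintype.card k ^ i)) p.natDegree
    rw [Finset.prod_range_succ, hzm, pow_zero, pow_one] at h2
    exact (mul_right_cancel₀ (X_sub_C_ne_zero z) h2).symm
  obtain ⟨g₀, hg₀⟩ : ∃ g₀ : k[X], g₀.map (algebraMap k κ) = g := by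
    refine (lifts_iff_set_range _).1 ((lifts_iff_coeff_lifts _).2 fun i => ?_)
    refine mem_range_algebraMap_of_pow_card_eq ?_
    have h3 := coeff_frobeniusCoeff_pow (k := k) g 1 i
    rw [pow_one, hFg, pow_one] at h3
    exact h3.symm
  have hg₀m : g₀.Monic := monic_of_injective (algebraMap k κ).injective (by rwa [hg₀])
  have hdeg : g₀.natDegree = p.natDegree := by
    rw [← natDegree_map (algebraMap k κ), hg₀, hg, natDegree_prod_of_monic _ _
      fun i _ => monic_X_sub_C _]
    simp only [natDegree_X_sub_C]
    simp
  have hroot : aeval z g₀ = 0 := by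
    rw [← eval_map_algebraMap, hg₀, hg, eval_prod]
    exact Finset.prod_eq_zero (Finset.mem_range.2 hi.natDegree_pos) (by simp)
  have hdvd : p ∣ g₀ := by
    rw [minpoly.eq_of_irreducible_of_monic hi hz hp]
    exact minpoly.dvd _ _ hroot
  rw [← hg₀, eq_of_monic_of_dvd_of_natDegree_le hp hg₀m hdvd hdeg.le]

theorem val_le_one_of_mem_drinfeldTorsion (hr : 1 ≤ r) (hθ : v θ = 1)
    (hfin : Finite (drinfeldTorsion r θ a)) {x : E} (hx : x ∈ drinfeldTorsion r θ a) :
    v x ≤ 1 := by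
  have : Nonempty (drinfeldTorsion r θ a) := ⟨0⟩
  obtain ⟨x₀, hx₀⟩ := Finite.exists_max fun x : drinfeldTorsion r θ a => v x.1
  refine (hx₀ ⟨x, hx⟩).trans ?_
  by_contra! h1
  have h2 := hx₀ ⟨_, drinfeldT_mem_drinfeldTorsion x₀.2⟩
  have hq : 1 < Fintype.card Fq := Fintype.one_lt_card
  have hqr : Fintype.card Fq ^ (r - 1) < Fintype.card Fq ^ r :=
    Nat.pow_lt_pow_right hq (by omega)
  have h3 : v (x₀.1 ^ Fintype.card Fq ^ (r - 1)) < v x₀.1 ^ Fintype.card Fq ^ r := by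
    rw [map_pow]; exact pow_lt_pow_right₀ h1 hqr
  have h5 : v x₀.1 < v x₀.1 ^ Fintype.card Fq ^ r :=
    lt_self_pow₀ h1 (Nat.one_lt_pow (by omega) hq)
  have h4 : v (θ * x₀.1 + x₀.1 ^ Fintype.card Fq ^ (r - 1)) < v x₀.1 ^ Fintype.card Fq ^ r := by
    refine Valuation.map_add_lt v ?_ h3
    rwa [map_mul, hθ, one_mul]
  have h6 : v (θ ^ (Fintype.card Fq - 1) * x₀.1 ^ Fintype.card Fq ^ r) =
      v x₀.1 ^ Fintype.card Fq ^ r := by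
    rw [map_mul, map_pow, map_pow, hθ, one_pow, one_mul]
  dsimp only at h2
  rw [drinfeldT_apply, Valuation.map_add_eq_of_lt_right v (by rwa [h6]), h6] at h2
  exact h5.not_ge h2

/-- A Frobenius element at a place above `ϖ` acts on the torsion with determinant `ϖ`. -/
theorem dvd_det_sub_of_actsAsPowAt (R : Reduction Fq v κ) (hr : Odd r) (hr3 : 3 ≤ r) {n : ℕ}
    (hl : l.Monic) (hi : Irreducible l) (hn : n ≠ 0) (hfin : Finite (drinfeldTorsion r θ (l ^ n)))
    {x : Fin r → E} (hx : ∀ j, x j ∈ drinfeldTorsion r θ (l ^ n))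
    (hΔ : ¬ l.map (algebraMap Fq E) ∣ torsionDet (drinfeldT Fq r θ) (l ^ n) x)
    (hθ : v θ = 1) (hvl : v (aeval θ l) = 1) {p : Fq[X]} (hp : p.Monic) (hpi : Irreducible p)
    (hvp : v (aeval θ p) < 1) (σ : E →ₐ[Fq] E) (hσ : σ θ = θ)
    (hs : ActsAsPowAt v (Fintype.card Fq ^ p.natDegree) σ) {B : Matrix (Fin r) (Fin r) Fq[X]}
    (hB : ∀ j, σ (x j) = ∑ k, aeval (drinfeldT Fq r θ) (B k j) (x k)) :
    l ^ n ∣ B.det - p := by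
  set a := l ^ n with ha
  have hla : l ∣ a := dvd_pow_self l hn
  have ham : a.Monic := hl.pow n
  set Δ := torsionDet (drinfeldT Fq r θ) a x with hΔdef
  have hΔv : ∀ i, v (Δ.coeff i) ≤ 1 := by
    refine Reduction.val_coeff_det_le fun i j m => ?_
    refine Reduction.val_coeff_frobeniusCoeff_pow_le (Fq := Fq) (fun m => ?_) _ _
    rw [coeff_torsionPoly]
    exact val_le_one_of_mem_drinfeldTorsion (by omega) hθ hfin (aeval_mem_drinfeldTorsion _ (hx j))
  have hF := dvd_frobeniusCoeff_torsionDet hr hr3 hx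
  have hF' := ((map_dvd_map' (algebraMap Fq E)).2 hla).trans hF
  have hcop : IsCoprime (a.map (algebraMap Fq κ)) (R.redPoly Δ) := by
    rw [ha, Polynomial.map_pow]
    exact (R.isCoprime_redPoly hl hi hθ hvl hΔv hΔ hF').pow_left
  have hθ0 : R.red θ ≠ 0 := by
    rw [Ne, R.red_eq_zero_iff hθ.le, hθ]; exact lt_irrefl _
  have hzm : R.red θ ^ Fintype.card Fq ^ p.natDegree = R.red θ := by
    rw [← R.red_map_of_actsAsPowAt hs hθ.le, hσ]
  have hz : aeval (R.red θ) p = 0 := by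
    rw [← R.red_aeval hθ.le, R.red_eq_zero_iff hvp.le]; exact hvp
  have h1 := R.dvd_redPoly_frobenius ham (by rw [map_pow, hθ, one_pow]) hθ.le hΔv hF
  rw [R.red_pow hθ.le] at h1
  have h2 := dvd_frobeniusCoeff_pow_sub h1 p.natDegree
  have h3 : R.red θ ^ (Fintype.card Fq ^ p.natDegree - 1) = 1 := by
    refine mul_left_cancel₀ hθ0 ?_
    rw [← pow_succ', Nat.sub_add_cancel (Nat.one_le_pow _ _ Fintype.card_pos), hzm, mul_one]
  rw [h3, C_1, one_mul, prod_X_sub_C_frobenius hp hpi hz hzm] at h2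
  have h4 := dvd_map_torsionDet_sub σ hσ hx hB
  have h5 : ∀ i, v ((Δ.map (σ : E →+* E)).coeff i) ≤ 1 := fun i => by
    rw [coeff_map]; exact ((hs _).1.trans_le (hΔv i))
  have h6 := R.val_coeff_map_le B.det
  have h7 := R.map_dvd_redPoly ham (Reduction.val_coeff_sub_le h5
    (Reduction.val_coeff_mul_le h6 hΔv)) h4
  have h8 : R.redPoly (Δ.map (σ : E →+* E)) =
      (frobeniusCoeff Fq κ ^ p.natDegree) (R.redPoly Δ) := by
    ext i
    rw [coeff_frobeniusCoeff_pow, R.coeff_redPoly, R.coeff_redPoly, coeff_map]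
    exact R.red_map_of_actsAsPowAt hs (hΔv i)
  rw [R.redPoly_sub h5 (Reduction.val_coeff_mul_le h6 hΔv), R.redPoly_mul h6 hΔv, R.redPoly_map,
    h8] at h7
  have h9 := dvd_sub h2 h7
  rw [sub_sub_sub_cancel_left, ← sub_mul, ← Polynomial.map_sub] at h9
  exact (map_dvd_map' _).1 (hcop.dvd_of_dvd_mul_right h9)

end GoodReduction

theorem IsRationalFunctionField.exists_dvd_det_sub {Fq : Type*} [Field Fq] [Fintype Fq]
    {K : Type*} [Field K] [Algebra Fq K] {t : K} (h : IsRationalFunctionField Fq t) {E : Type}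
    [Field E] [Algebra K E] [Algebra Fq E] [IsScalarTower Fq K E] [FiniteDimensional K E]
    [IsGalois K E] {r : ℕ} (hr : Odd r) (hr3 : 3 ≤ r) {l : Fq[X]} (hl : l.Monic)
    (hi : Irreducible l) {n : ℕ} (hn : n ≠ 0)
    (hfin : Finite (drinfeldTorsion r (algebraMap K E t) (l ^ n))) {x : Fin r → E}
    (hx : ∀ j, x j ∈ drinfeldTorsion r (algebraMap K E t) (l ^ n))
    (hΔ : ¬ l.map (algebraMap Fq E) ∣ torsionDet (drinfeldT Fq r (algebraMap K E t)) (l ^ n) x)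
    {p : Fq[X]} (hp : p.Monic) (hpi : Irreducible p) (hpX : p ≠ X) (hpl : p ≠ l) :
    ∃ s : E ≃ₐ[K] E, ∀ B : Matrix (Fin r) (Fin r) Fq[X],
      (∀ j, s (x j) = ∑ k, aeval (drinfeldT Fq r (algebraMap K E t)) (B k j) (x k)) →
      l ^ n ∣ B.det - p := by
  obtain ⟨v, I, s, h1, h2, -, -, h5⟩ := h.exists_place (E := E) hpi.prime
  obtain ⟨κ, _, _, ⟨R⟩⟩ := exists_reduction (k := Fq) v
  simp only [← aeval_algebraMap_apply] at h1 h2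
  have hndvd : ∀ b : Fq[X], b.Monic → Irreducible b → p ≠ b → v (aeval (algebraMap K E t) b) = 1 := by
    intro b hb hbi hne
    refine (h1 b).antisymm (not_lt.1 fun hlt => hne ?_)
    exact eq_of_monic_of_associated hp hb (hpi.associated_of_dvd hbi ((h2 b).1 hlt))
  refine ⟨s, fun B hB => ?_⟩
  refine dvd_det_sub_of_actsAsPowAt R hr hr3 hl hi hn hfin hx hΔ ?_ (hndvd l hl hi hpl) hp hpi
    ((h2 p).2 dvd_rfl) (s.toAlgHom.restrictScalars Fq) (s.commutes t) h5 hB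
  simpa using hndvd X monic_X irreducible_X hpX

section Units

variable {k : Type*} [Field k] {l : k[X]} {n : ℕ}

theorem not_dvd_of_isUnit_mk (hl : Irreducible l) (hn : n ≠ 0) {b : k[X]}
    (hb : IsUnit (Ideal.Quotient.mk (Ideal.span {l ^ n}) b)) : ¬ l ∣ b := by
  intro h
  obtain ⟨c, hc⟩ := hb.exists_right_inv
  obtain ⟨c, rfl⟩ := Ideal.Quotient.mk_surjective c
  rw [← map_mul, ← map_one (Ideal.Quotient.mk _), Ideal.Quotient.mk_eq_mk_iff_sub_mem,
    Ideal.mem_span_singleton] at hc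
  refine hl.not_isUnit (isUnit_of_dvd_one ?_)
  exact (dvd_sub_right (h.mul_right c)).1 ((dvd_pow_self l hn).trans hc)

theorem units_eq_top_of_forall_irreducible (hlm : l.Monic) (hl : Irreducible l) (hn : n ≠ 0)
    (D : Subgroup (k[X] ⧸ Ideal.span {l ^ n})ˣ)
    (hD : ∀ p : k[X], p.Monic → Irreducible p → p ≠ X → p ≠ l →
      ∀ u : (k[X] ⧸ Ideal.span {l ^ n})ˣ, u.1 = Ideal.Quotient.mk _ p → u ∈ D) : D = ⊤ := by
  have key : ∀ m, ∀ b : k[X], b.natDegree = m → b.Monic → ¬ X ∣ b →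
      ∀ u : (k[X] ⧸ Ideal.span {l ^ n})ˣ, u.1 = Ideal.Quotient.mk _ b → u ∈ D := by
    intro m
    induction m using Nat.strong_induction_on with
    | _ m ih =>
      intro b hbm hb hbX u hu
      have hlb : ¬ l ∣ b := not_dvd_of_isUnit_mk hl hn (hu ▸ u.isUnit)
      by_cases hbu : IsUnit b
      · have h1 : b = 1 := hb.eq_one_of_isUnit hbu
        rw [h1, map_one] at hu
        rw [show u = 1 from Units.ext hu]
        exact D.one_mem
      · obtain ⟨p, hp, hpi, c, rfl⟩ := exists_monic_irreducible_factor b hbu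
        have hc : c.Monic := hp.of_mul_monic_left hb
        rw [map_mul] at hu
        have hpu : IsUnit (Ideal.Quotient.mk (Ideal.span {l ^ n}) p) :=
          isUnit_of_mul_isUnit_left (hu ▸ u.isUnit)
        have hcu : IsUnit (Ideal.Quotient.mk (Ideal.span {l ^ n}) c) :=
          isUnit_of_mul_isUnit_right (hu ▸ u.isUnit)
        have h1 : u = hpu.unit * hcu.unit := Units.ext hu
        rw [h1]
        refine D.mul_mem (hD p hp hpi ?_ ?_ _ rfl)
          (ih c.natDegree ?_ c rfl hc (fun h => hbX (h.mul_left p)) _ rfl)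
        · rintro rfl; exact hbX (dvd_mul_right _ _)
        · rintro rfl; exact hlb (dvd_mul_right _ _)
        · have := hpi.natDegree_pos
          rw [hp.natDegree_mul hc] at hbm
          omega
  rw [eq_top_iff]
  rintro u -
  obtain ⟨b₀, hb₀⟩ := Ideal.Quotient.mk_surjective u.1
  have hlb₀ : ¬ l ∣ b₀ := not_dvd_of_isUnit_mk hl hn (hb₀ ▸ u.isUnit)
  obtain ⟨c₀, hc₀⟩ : ∃ c₀ : k, b₀.eval 0 + l.eval 0 ^ n * c₀ ≠ 0 := by
    by_cases h0 : l.eval 0 = 0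
    · refine ⟨0, fun h => hlb₀ ?_⟩
      have hX : X ∣ l := by rw [X_dvd_iff, coeff_zero_eq_eval_zero, h0]
      have hlX : X = l :=
        eq_of_monic_of_associated monic_X hlm (irreducible_X.associated_of_dvd hl hX)
      rw [← hlX, X_dvd_iff, coeff_zero_eq_eval_zero]
      simpa using h
    · refine ⟨(1 - b₀.eval 0) / l.eval 0 ^ n, ?_⟩
      rw [mul_div_cancel₀ _ (pow_ne_zero n h0)]
      simp
  set N := b₀.natDegree + 1
  have hXm : (X ^ N + C c₀ : k[X]).Monic := monic_X_pow_add_C _ (by omega)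
  have hm : (l ^ n * (X ^ N + C c₀)).Monic := (hlm.pow n).mul hXm
  have hdeg : b₀.degree < (l ^ n * (X ^ N + C c₀)).degree := by
    refine degree_lt_degree ?_
    rw [(hlm.pow n).natDegree_mul hXm, natDegree_X_pow_add_C]
    omega
  refine key _ (l ^ n * (X ^ N + C c₀) + b₀) rfl (hm.add_of_left hdeg) ?_ u ?_
  · rw [X_dvd_iff, coeff_zero_eq_eval_zero]
    simpa [N, add_comm] using hc₀
  · rw [← hb₀, Ideal.Quotient.mk_eq_mk_iff_sub_mem, Ideal.mem_span_singleton, sub_add_cancel_right,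
      dvd_neg]
    exact dvd_mul_right _ _

end Units

section TorsionField

variable {Fq : Type*} [Field Fq] [Fintype Fq] {K : Type} [Field K] [Algebra Fq K] {t : K}
  {Ω : Type} [Field Ω] [Algebra K Ω] [Algebra Fq Ω] [IsScalarTower Fq K Ω]
  {E : Type} [Field E] [Algebra K E] [Algebra Fq E] [IsScalarTower Fq K E] {r : ℕ} {a b : Fq[X]}

theorem map_aeval_drinfeldT_algebraMap (i : E →ₐ[K] Ω) (b : Fq[X]) (x : E) :
    i (aeval (drinfeldT Fq r (algebraMap K E t)) b x) =
      aeval (drinfeldT Fq r (algebraMap K Ω t)) b (i x) :=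
  map_aeval_drinfeldT (i.restrictScalars Fq) (i.commutes t) b x

theorem map_mem_drinfeldTorsion_iff (i : E →ₐ[K] Ω) {x : E} :
    i x ∈ drinfeldTorsion r (algebraMap K Ω t) a ↔ x ∈ drinfeldTorsion r (algebraMap K E t) a := by
  rw [mem_drinfeldTorsion, mem_drinfeldTorsion, ← map_aeval_drinfeldT_algebraMap,
    map_eq_zero_iff i i.injective]

theorem map_drinfeldPoly (r : ℕ) (t : K) (b : Fq[X]) :
    (drinfeldPoly r t b).map (algebraMap K Ω) = drinfeldPoly r (algebraMap K Ω t) b := by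
  have h : ∀ j, ((drinfeldPolyT Fq r t).comp^[j] X).map (algebraMap K Ω) =
      (drinfeldPolyT Fq r (algebraMap K Ω t)).comp^[j] X := by
    intro j
    induction j with
    | zero => simp
    | succ j ih =>
      rw [Function.iterate_succ_apply', Function.iterate_succ_apply', Polynomial.map_comp, ih]
      simp [drinfeldPolyT]
  rw [drinfeldPoly, drinfeldPoly, Polynomial.map_sum]
  refine Finset.sum_congr rfl fun j _ => ?_
  rw [Polynomial.map_mul, h, map_C, ← IsScalarTower.algebraMap_apply]

theorem separable_drinfeldPoly {E : Type*} [Field E] [Algebra Fq E] {r : ℕ} (hr : 2 ≤ r) {θ : E}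
    {b : Fq[X]} (hb : aeval θ b ≠ 0) : (drinfeldPoly r θ b).Separable := by
  rw [Polynomial.separable_def, derivative_drinfeldPoly hr]
  exact ⟨0, C (aeval θ b)⁻¹, by rw [zero_mul, zero_add, ← C_mul, inv_mul_cancel₀ hb, C_1]⟩

/-- `E` is the field generated by the `a`-torsion, embedded in `Ω`. -/
structure IsTorsionField (r : ℕ) (t : K) (a : Fq[X]) (i : E →ₐ[K] Ω) : Prop where
  finiteDimensional : FiniteDimensional K E
  isGalois : IsGalois K E
  exists_map_eq : ∀ x ∈ drinfeldTorsion r (algebraMap K Ω t) a, ∃ y, i y = x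
  card : ∀ b, b ∣ a → Nat.card (drinfeldTorsion r (algebraMap K E t) b) =
    Fintype.card Fq ^ (r * b.natDegree)
  faithful : ∀ σ : E ≃ₐ[K] E, (∀ x ∈ drinfeldTorsion r (algebraMap K E t) a, σ x = x) → σ = 1
  exists_lift : ∀ σ : E ≃ₐ[K] E, ∃ τ : Ω ≃ₐ[K] Ω, ∀ y, τ (i y) = i (σ y)

theorem exists_isTorsionField [IsAlgClosure K Ω] (h : IsRationalFunctionField Fq t) (hr : 2 ≤ r)
    (ha : a ≠ 0) :
    ∃ (E : Type) (_ : Field E) (_ : Algebra K E) (_ : Algebra Fq E) (_ : IsScalarTower Fq K E)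
      (i : E →ₐ[K] Ω), IsTorsionField r t a i := by
  have : IsAlgClosed Ω := IsAlgClosure.isAlgClosed K
  have : Normal K Ω := IsAlgClosure.normal K Ω
  have ht : t ≠ 0 := fun h0 => h.transcendental (h0 ▸ isAlgebraic_zero)
  have hθ : algebraMap K Ω t ≠ 0 := by simpa
  have hb0 : ∀ b : Fq[X], b ≠ 0 → aeval t b ≠ 0 := fun b hb h0 =>
    hb (h.aeval_injective (by rw [h0, map_zero]))
  have hbΩ : ∀ b : Fq[X], b ≠ 0 → aeval (algebraMap K Ω t) b ≠ 0 := fun b hb => by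
    rw [aeval_algebraMap_apply]; simpa using hb0 b hb
  have hM : (drinfeldTorsion r (algebraMap K Ω t) a : Set Ω) = (drinfeldPoly r t a).rootSet Ω := by
    rw [coe_drinfeldTorsion hr hθ ha, rootSet, rootSet, aroots, aroots, map_drinfeldPoly]
    simp [map_drinfeldPoly]
  let E := IntermediateField.adjoin K ((drinfeldPoly r t a).rootSet Ω)
  have hsplit : (drinfeldPoly r t a).IsSplittingField K E :=
    IntermediateField.adjoin_rootSet_isSplittingField (IsAlgClosed.splits _)
  have hsub : ∀ x ∈ drinfeldTorsion r (algebraMap K Ω t) a, x ∈ E := fun x hx =>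
    IntermediateField.subset_adjoin _ _ (hM ▸ hx)
  letI : Algebra Fq E := ((algebraMap K E).comp (algebraMap Fq K)).toAlgebra
  have : IsScalarTower Fq K E := IsScalarTower.of_algebraMap_eq fun x => rfl
  refine ⟨E, inferInstance, inferInstance, inferInstance, inferInstance, E.val,
    ⟨hsplit.finiteDimensional _ _, IsGalois.of_separable_splitting_field
      (separable_drinfeldPoly hr (hb0 a ha)), fun x hx => ⟨⟨x, hsub x hx⟩, rfl⟩, ?_, ?_, ?_⟩⟩
  · intro b hb
    rw [← card_drinfeldTorsion hr hθ (hbΩ b (ne_zero_of_dvd_ne_zero ha hb))]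
    refine Nat.card_congr (Equiv.ofBijective
      (fun x => ⟨E.val x.1, (map_mem_drinfeldTorsion_iff E.val).2 x.2⟩) ⟨?_, ?_⟩)
    · intro x y hxy
      exact Subtype.ext (E.val.injective (congrArg (fun z => z.1) hxy))
    · intro x
      have hxE : x.1 ∈ E := hsub _ (drinfeldTorsion_mono hb x.2)
      exact ⟨⟨⟨x.1, hxE⟩, (map_mem_drinfeldTorsion_iff E.val).1 x.2⟩, rfl⟩
  · intro σ hσ
    have h1 : E.val.comp σ.toAlgHom = E.val := by
      refine IntermediateField.algHom_ext_of_eq_adjoin K rfl ?_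
      intro x hx
      have hx' : x ∈ drinfeldTorsion r (algebraMap K Ω t) a := by
        rw [← SetLike.mem_coe, hM]; exact hx
      exact congrArg E.val (hσ ⟨x, hsub x hx'⟩ ((map_mem_drinfeldTorsion_iff E.val).1 hx'))
    ext x
    exact congrArg (fun f => f x) h1
  · intro σ
    exact ⟨σ.liftNormal Ω, fun y => σ.liftNormal_commutes Ω y⟩

namespace IsTorsionField

variable {i : E →ₐ[K] Ω} (H : IsTorsionField r t a i) (h : IsRationalFunctionField Fq t)
include H h

theorem exists_isTorsionBasis (hr : Odd r) (hr3 : 3 ≤ r) {l : Fq[X]} (hl : l.Monic)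
    (hi : Irreducible l) {n : ℕ} (hn : n ≠ 0) (ha : a = l ^ n) :
    ∃ x : Fin r → Ω, IsTorsionBasis (drinfeldT Fq r (algebraMap K Ω t)) a x ∧
      ∀ p : Fq[X], p.Monic → Irreducible p → p ≠ X → p ≠ l →
        ∃ s : Ω ≃ₐ[K] Ω, ∀ B : Matrix (Fin r) (Fin r) Fq[X],
          (∀ j, s (x j) = ∑ k, aeval (drinfeldT Fq r (algebraMap K Ω t)) (B k j) (x k)) →
          a ∣ B.det - p := by
  have := H.finiteDimensional
  have := H.isGalois
  subst ha
  have hc := H.card _ dvd_rfl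
  obtain ⟨x, hx, hΔ⟩ := h.exists_isTorsionBasis (E := E) (by omega) (hl.pow n)
    (by rw [natDegree_pow]; exact Nat.mul_pos (by omega) hi.natDegree_pos) hc
  have hmap : ∀ c : Fin r → Fq[X],
      ∑ k, aeval (drinfeldT Fq r (algebraMap K Ω t)) (c k) (i (x k)) =
        i (∑ k, aeval (drinfeldT Fq r (algebraMap K E t)) (c k) (x k)) := fun c => by
    rw [map_sum]
    exact Finset.sum_congr rfl fun k _ => (map_aeval_drinfeldT_algebraMap i _ _).symm
  refine ⟨fun j => i (x j), ⟨fun j => ?_, fun y hy => ?_, fun c hc => ?_⟩,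
    fun p hp hpi hpX hpl => ?_⟩
  · rw [← map_aeval_drinfeldT_algebraMap, hx.mem, map_zero]
  · obtain ⟨z, rfl⟩ := H.exists_map_eq y hy
    obtain ⟨c, hc⟩ := hx.span z ((map_mem_drinfeldTorsion_iff i).1 hy)
    exact ⟨c, by rw [hmap, ← hc]⟩
  · rw [hmap, map_eq_zero_iff i i.injective] at hc
    exact hx.indep c hc
  · obtain ⟨s, hs⟩ := h.exists_dvd_det_sub (E := E) hr hr3 hl hi hn
      (Nat.finite_of_card_ne_zero (by rw [hc]; exact (pow_pos Fintype.card_pos _).ne')) hx.mem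
      (hΔ l hl hi.natDegree_pos) hp hpi hpX hpl
    obtain ⟨τ, hτ⟩ := H.exists_lift s
    refine ⟨τ, fun B hB => hs B fun j => i.injective ?_⟩
    change i _ = i _
    rw [← hmap, ← hB, hτ]

theorem eq_bot_or_eq (hq : 3 ≤ Fintype.card Fq) (hr : 3 ≤ r) (hrp : r.Prime) (hm : a.Monic)
    (ha : Irreducible a) {W : Submodule Fq Ω} (hWM : W ≤ drinfeldTorsion r (algebraMap K Ω t) a)
    (hWT : ∀ x ∈ W, drinfeldT Fq r (algebraMap K Ω t) x ∈ W)
    (hWG : ∀ σ : Ω ≃ₐ[K] Ω, ∀ x ∈ W, σ x ∈ W) :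
    W = ⊥ ∨ W = drinfeldTorsion r (algebraMap K Ω t) a := by
  have := H.finiteDimensional
  have := H.isGalois
  have hT : ∀ x ∈ W.comap (i.restrictScalars Fq).toLinearMap,
      drinfeldT Fq r (algebraMap K E t) x ∈ W.comap (i.restrictScalars Fq).toLinearMap := by
    intro x hx
    have h2 := map_aeval_drinfeldT_algebraMap (Fq := Fq) (r := r) (t := t) i X x
    rw [aeval_X, aeval_X] at h2
    change i _ ∈ W
    rw [h2]
    exact hWT _ hx
  have hG : ∀ σ : E ≃ₐ[K] E, ∀ x ∈ W.comap (i.restrictScalars Fq).toLinearMap,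
      σ x ∈ W.comap (i.restrictScalars Fq).toLinearMap := by
    intro σ x hx
    obtain ⟨τ, hτ⟩ := H.exists_lift σ
    change i (σ x) ∈ W
    rw [← hτ]
    exact hWG τ _ hx
  rcases eq_bot_or_eq_drinfeldTorsion_of_stable h (E := E) hq hr hrp hm ha (H.card _ dvd_rfl)
    H.faithful (W := W.comap (i.restrictScalars Fq).toLinearMap)
    (fun x hx => (map_mem_drinfeldTorsion_iff i).1 (hWM hx)) hT hG with h1 | h1
  · left
    rw [eq_bot_iff]
    intro x hx
    obtain ⟨y, rfl⟩ := H.exists_map_eq x (hWM hx)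
    have : y ∈ W.comap (i.restrictScalars Fq).toLinearMap := hx
    rw [h1, Submodule.mem_bot] at this
    rw [this, map_zero]
    exact zero_mem _
  · right
    refine le_antisymm hWM fun x hx => ?_
    obtain ⟨y, rfl⟩ := H.exists_map_eq x hx
    have : y ∈ W.comap (i.restrictScalars Fq).toLinearMap := by
      rw [h1]; exact (map_mem_drinfeldTorsion_iff i).1 hx
    exact this

theorem exists_transvections (hr : 2 ≤ r) (hl : a.Monic) (hi : Irreducible a) :
    ∃ (V : Submodule Fq Ω) (x₀ : Ω), V ≤ drinfeldTorsion r (algebraMap K Ω t) a ∧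
      (∀ x ∈ V, drinfeldT Fq r (algebraMap K Ω t) x ∈ V) ∧
      x₀ ∈ drinfeldTorsion r (algebraMap K Ω t) a ∧ x₀ ∉ V ∧
      (∀ x ∈ drinfeldTorsion r (algebraMap K Ω t) a, ∃ b : Fq[X],
        x - aeval (drinfeldT Fq r (algebraMap K Ω t)) b x₀ ∈ V) ∧
      ∀ y ∈ V, ∃ σ : Ω ≃ₐ[K] Ω, σ x₀ = x₀ + y ∧ ∀ x ∈ V, σ x = x := by
  have := H.finiteDimensional
  have := H.isGalois
  obtain ⟨V, x₀, h1, h2, h3, h4, h5, h6⟩ := exists_transvections_of_irreducible (E := E) h hr hl hi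
    (H.card _ dvd_rfl) H.faithful
  refine ⟨V.map (i.restrictScalars Fq).toLinearMap, i x₀, ?_, ?_,
    (map_mem_drinfeldTorsion_iff i).2 h3, ?_, ?_, ?_⟩
  · rintro _ ⟨x, hx, rfl⟩
    exact (map_mem_drinfeldTorsion_iff i).2 (h1 hx)
  · rintro _ ⟨x, hx, rfl⟩
    have h7 := map_aeval_drinfeldT_algebraMap (Fq := Fq) (r := r) (t := t) i X x
    rw [aeval_X, aeval_X] at h7
    exact ⟨_, h2 x hx, h7⟩
  · rintro ⟨x, hx, hxx⟩
    exact h4 (i.injective hxx ▸ hx)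
  · intro x hx
    obtain ⟨y, rfl⟩ := H.exists_map_eq x hx
    obtain ⟨b, hb⟩ := h5 y ((map_mem_drinfeldTorsion_iff i).1 hx)
    refine ⟨b, _, hb, ?_⟩
    rw [← map_aeval_drinfeldT_algebraMap, ← map_sub]
    rfl
  · rintro _ ⟨y, hy, rfl⟩
    obtain ⟨σ, hσ, hσ'⟩ := h6 y hy
    obtain ⟨τ, hτ⟩ := H.exists_lift σ
    refine ⟨τ, by rw [hτ, hσ, map_add]; rfl, ?_⟩
    rintro _ ⟨x, hx, rfl⟩
    exact (hτ x).trans (congrArg i (hσ' x hx))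

theorem exists_nonscalar (hr : 3 ≤ r) {l : Fq[X]} (hl : l.Monic) (hi : Irreducible l)
    (ha : a = l ^ 2) :
    ∃ σ : Ω ≃ₐ[K] Ω, (∀ x ∈ drinfeldTorsion r (algebraMap K Ω t) l, σ x = x) ∧
      ¬ ∃ b : Fq[X], ∀ x ∈ drinfeldTorsion r (algebraMap K Ω t) a,
        σ x = aeval (drinfeldT Fq r (algebraMap K Ω t)) b x := by
  have := H.finiteDimensional
  have := H.isGalois
  subst ha
  obtain ⟨σ, hσ, hσ'⟩ := exists_nonscalar_of_irreducible (E := E) h hr hl hi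
    (H.card _ (dvd_pow_self l two_ne_zero)) (H.card _ dvd_rfl) H.faithful
  obtain ⟨τ, hτ⟩ := H.exists_lift σ
  refine ⟨τ, fun x hx => ?_, fun ⟨b, hb⟩ => hσ' ⟨b, fun x hx => i.injective ?_⟩⟩
  · obtain ⟨y, rfl⟩ := H.exists_map_eq x (drinfeldTorsion_mono (dvd_pow_self l two_ne_zero) hx)
    rw [hτ, hσ y ((map_mem_drinfeldTorsion_iff i).1 hx)]
  · change i _ = i _
    rw [← hτ, hb _ ((map_mem_drinfeldTorsion_iff i).2 hx), map_aeval_drinfeldT_algebraMap]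

end IsTorsionField

end TorsionField

section TorsionRepresentation

variable {k : Type*} [Field k] {E : Type*} [Field E] [Algebra k E] {T : Module.End k E}
  {ι : Type*} [Fintype ι] {a b : k[X]} {x : ι → E}

/-- The linear combination of `x` with coefficients polynomials in `T`. -/
def polyCombination (T : Module.End k E) (x : ι → E) : (ι → k[X]) →ₗ[k] E where
  toFun c := ∑ j, aeval T (c j) (x j)
  map_add' c d := by simp [Finset.sum_add_distrib]
  map_smul' s c := by simp [Finset.smul_sum]

theorem polyCombination_apply (c : ι → k[X]) :
    polyCombination T x c = ∑ j, aeval T (c j) (x j) := rfl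

theorem polyCombination_mul (b : k[X]) (c : ι → k[X]) :
    polyCombination T x (fun j => b * c j) = aeval T b (polyCombination T x c) := by
  simp [polyCombination_apply, map_sum]

theorem polyCombination_single [DecidableEq ι] (j : ι) :
    polyCombination T x (Pi.single j 1) = x j := by
  rw [polyCombination_apply, Finset.sum_eq_single j]
  · simp
  · intro i _ hi
    simp [hi]
  · simp

theorem polyCombination_mulVec {y : ι → E} {B : Matrix ι ι k[X]}
    (hB : ∀ j, y j = polyCombination T x fun i => B i j) (c : ι → k[X]) :
    polyCombination T y c = polyCombination T x (B.mulVec c) := by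
  rw [polyCombination_apply]
  simp_rw [hB, ← polyCombination_mul]
  rw [← map_sum]
  congr 1
  ext1 i
  simp [Matrix.mulVec, dotProduct, mul_comm]

namespace IsTorsionBasis

variable (hx : IsTorsionBasis T a x)
include hx

theorem exists_eq {y : E} (hy : aeval T a y = 0) : ∃ c, y = polyCombination T x c := hx.span y hy

theorem eq_zero_iff {c : ι → k[X]} : polyCombination T x c = 0 ↔ ∀ j, a ∣ c j := by
  refine ⟨hx.indep c, fun h => Finset.sum_eq_zero fun j _ => ?_⟩
  obtain ⟨d, hd⟩ := h j
  rw [hd, mul_comm, map_mul, Module.End.mul_apply, hx.mem, map_zero]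

theorem eq_iff {c d : ι → k[X]} : polyCombination T x c = polyCombination T x d ↔
    ∀ j, Ideal.Quotient.mk (Ideal.span {a}) (c j) = Ideal.Quotient.mk (Ideal.span {a}) (d j) := by
  rw [← sub_eq_zero, ← map_sub, hx.eq_zero_iff]
  simp [Ideal.Quotient.eq, Ideal.mem_span_singleton]

theorem aeval_polyCombination (c : ι → k[X]) : aeval T a (polyCombination T x c) = 0 := by
  rw [← polyCombination_mul, hx.eq_zero_iff]
  exact fun j => dvd_mul_right _ _

theorem exists_matrix {f : E → E} (hf : ∀ y, aeval T a y = 0 → aeval T a (f y) = 0) :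
    ∃ B : Matrix ι ι k[X], ∀ j, f (x j) = polyCombination T x fun i => B i j := by
  choose B hB using fun j => hx.exists_eq (hf (x j) (hx.mem j))
  exact ⟨fun i j => B j i, hB⟩

theorem map_mk_eq {f : E → E} {B C : Matrix ι ι k[X]}
    (hB : ∀ j, f (x j) = polyCombination T x fun i => B i j)
    (hC : ∀ j, f (x j) = polyCombination T x fun i => C i j) :
    B.map (Ideal.Quotient.mk (Ideal.span {a})) = C.map (Ideal.Quotient.mk (Ideal.span {a})) := by
  ext i j
  exact hx.eq_iff.1 ((hB j).symm.trans (hC j)) i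

theorem of_map_mk_eq {f : E → E} {B C : Matrix ι ι k[X]}
    (hB : ∀ j, f (x j) = polyCombination T x fun i => B i j)
    (h : B.map (Ideal.Quotient.mk (Ideal.span {a})) = C.map (Ideal.Quotient.mk (Ideal.span {a})))
    (j : ι) : f (x j) = polyCombination T x fun i => C i j :=
  (hB j).trans (hx.eq_iff.2 fun i => congrFun (congrFun h i) j)


end IsTorsionBasis

variable {Γ : Type*} [Group Γ] [DistribMulAction Γ E]

theorem smul_polyCombination (hΓ : ∀ (σ : Γ) (b : k[X]) (y : E), σ • aeval T b y = aeval T b (σ • y))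
    (σ : Γ) (c : ι → k[X]) :
    σ • polyCombination T x c = polyCombination T (fun j => σ • x j) c := by
  simp_rw [polyCombination_apply, Finset.smul_sum, hΓ]

variable [DecidableEq ι]

/-- The matrix representation of a group acting on the torsion, in a basis of the torsion. -/
def torsionRep (hx : IsTorsionBasis T a x)
    (hΓ : ∀ (σ : Γ) (b : k[X]) (y : E), σ • aeval T b y = aeval T b (σ • y)) :
    Γ →* GL ι (k[X] ⧸ Ideal.span {a}) :=
  MonoidHom.toHomUnits
    { toFun := fun σ => (hx.exists_matrix (f := (σ • ·)) fun y hy => by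
        rw [← hΓ, hy, smul_zero]).choose.map (Ideal.Quotient.mk _)
      map_one' := by
        have h := (hx.exists_matrix (f := ((1 : Γ) • ·)) fun y hy => by
          rw [← hΓ, hy, smul_zero]).choose_spec
        rw [hx.map_mk_eq h (C := 1), Matrix.map_one _ (map_zero _) (map_one _)]
        intro j
        rw [one_smul, ← polyCombination_single (T := T) (x := x) j]
        congr 1
        ext1 i
        simp [Matrix.one_apply, Pi.single_apply]
      map_mul' := fun σ τ => by
        have hσ := (hx.exists_matrix (f := (σ • ·)) fun y hy => by
          rw [← hΓ, hy, smul_zero]).choose_spec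
        have hτ := (hx.exists_matrix (f := (τ • ·)) fun y hy => by
          rw [← hΓ, hy, smul_zero]).choose_spec
        have h := (hx.exists_matrix (f := ((σ * τ) • ·)) fun y hy => by
          rw [← hΓ, hy, smul_zero]).choose_spec
        rw [← Matrix.map_mul]
        refine hx.map_mk_eq h fun j => ?_
        refine (mul_smul σ τ (x j)).trans ((congrArg (σ • ·) (hτ j)).trans ?_)
        exact (smul_polyCombination hΓ σ _).trans (polyCombination_mulVec hσ _) }

theorem torsionRep_eq_iff (hx : IsTorsionBasis T a x)
    (hΓ : ∀ (σ : Γ) (b : k[X]) (y : E), σ • aeval T b y = aeval T b (σ • y)) (σ : Γ)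
    (B : Matrix ι ι k[X]) :
    (torsionRep hx hΓ σ).1 = B.map (Ideal.Quotient.mk _) ↔
      ∀ j, σ • x j = polyCombination T x fun i => B i j := by
  have h := (hx.exists_matrix (f := (σ • ·)) fun y hy => by
    rw [← hΓ, hy, smul_zero]).choose_spec
  exact ⟨fun hB => hx.of_map_mk_eq h hB, fun hB => hx.map_mk_eq h hB⟩

end TorsionRepresentation

section TorsionRepresentation

variable {k : Type*} [Field k] {E : Type*} [Field E] [Algebra k E] {T : Module.End k E}
  {ι : Type*} [Fintype ι] {a b c l : k[X]} {x : ι → E}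

theorem polyCombination_aeval (b : k[X]) (c : ι → k[X]) :
    polyCombination T (fun j => aeval T b (x j)) c = aeval T b (polyCombination T x c) := by
  rw [← polyCombination_mul]
  simp [polyCombination_apply, mul_comm b]

theorem IsTorsionBasis.of_mul (hx : IsTorsionBasis T (b * c) x) (hb : b ≠ 0) (hc : c ≠ 0) :
    IsTorsionBasis T c fun j => aeval T b (x j) := by
  refine ⟨fun j => ?_, fun y hy => ?_, fun d hd j => ?_⟩
  · rw [← Module.End.mul_apply, ← map_mul, mul_comm, hx.mem]
  · obtain ⟨d, rfl⟩ := hx.exists_eq (y := y) (by rw [map_mul, Module.End.mul_apply, hy, map_zero])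
    rw [← polyCombination_mul, hx.eq_zero_iff] at hy
    choose e he using fun j => (mul_dvd_mul_iff_left hc).1 (mul_comm b c ▸ hy j)
    refine ⟨e, ?_⟩
    change _ = polyCombination T (fun j => aeval T b (x j)) e
    rw [polyCombination_aeval, ← polyCombination_mul]
    congr 1
    exact funext he
  · change polyCombination T (fun j => aeval T b (x j)) d = 0 at hd
    rw [polyCombination_aeval, ← polyCombination_mul, hx.eq_zero_iff] at hd
    exact (mul_dvd_mul_iff_left hb).1 (hd j)

variable {Γ : Type*} [Group Γ] [DistribMulAction Γ E] [DecidableEq ι]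

theorem exists_det_torsionRep_eq (hx : IsTorsionBasis T a x)
    (hΓ : ∀ (σ : Γ) (b : k[X]) (y : E), σ • aeval T b y = aeval T b (σ • y))
    (hlm : l.Monic) (hl : Irreducible l) {n : ℕ} (hn : n ≠ 0) (ha : a = l ^ n)
    (hfrob : ∀ p : k[X], p.Monic → Irreducible p → p ≠ X → p ≠ l → ∃ σ : Γ, ∀ B : Matrix ι ι k[X],
      (∀ j, σ • x j = polyCombination T x fun i => B i j) → a ∣ B.det - p)
    (u : (k[X] ⧸ Ideal.span {a})ˣ) : ∃ g ∈ (torsionRep hx hΓ).range, g.1.det = u := by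
  subst ha
  have hD := units_eq_top_of_forall_irreducible hlm hl hn
    ((torsionRep hx hΓ).range.map Matrix.GeneralLinearGroup.det) fun p h1 h2 h3 h4 u hu => by
      obtain ⟨σ, hσ⟩ := hfrob p h1 h2 h3 h4
      obtain ⟨B, hB⟩ := hx.exists_matrix (f := (σ • ·)) fun y hy => by
        rw [← hΓ, hy, smul_zero]
      refine ⟨_, ⟨σ, rfl⟩, Units.ext ?_⟩
      rw [Matrix.GeneralLinearGroup.val_det_apply, hu, (torsionRep_eq_iff hx hΓ σ B).2 hB,
        ← RingHom.mapMatrix_apply, ← RingHom.map_det, Ideal.Quotient.eq,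
        Ideal.mem_span_singleton]
      exact hσ B hB
  obtain ⟨g, hg, hgu⟩ := hD ▸ Subgroup.mem_top u
  exact ⟨g, hg, by rw [← hgu]; rfl⟩

theorem range_torsionRep_eq_top_of_irreducible [Nontrivial ι] (hx : IsTorsionBasis T l x)
    (hΓ : ∀ (σ : Γ) (b : k[X]) (y : E), σ • aeval T b y = aeval T b (σ • y))
    (hl : Irreducible l)
    (hirr : ∀ W : Submodule k E, (∀ y ∈ W, aeval T l y = 0) → (∀ y ∈ W, T y ∈ W) →
      (∀ σ : Γ, ∀ y ∈ W, σ • y ∈ W) → W = ⊥ ∨ ∀ y, aeval T l y = 0 → y ∈ W)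
    (htv : ∃ (V : Submodule k E) (x₀ : E), (∀ y ∈ V, aeval T l y = 0) ∧ (∀ y ∈ V, T y ∈ V) ∧
      aeval T l x₀ = 0 ∧ x₀ ∉ V ∧ (∀ y, aeval T l y = 0 → ∃ b : k[X], y - aeval T b x₀ ∈ V) ∧
      ∀ y ∈ V, ∃ σ : Γ, σ • x₀ = x₀ + y ∧ ∀ z ∈ V, σ • z = z)
    (hdet : ∀ u : (k[X] ⧸ Ideal.span {l})ˣ, ∃ g ∈ (torsionRep hx hΓ).range, g.1.det = u) :
    (torsionRep hx hΓ).range = ⊤ := by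
  have hmax : (Ideal.span {l}).IsMaximal := PrincipalIdealRing.isMaximal_of_irreducible hl
  letI : Field (k[X] ⧸ Ideal.span {l}) := Ideal.Quotient.field _
  have hmk : ∀ w : ι → k[X] ⧸ Ideal.span {l}, ∃ c : ι → k[X],
      w = fun j => Ideal.Quotient.mk _ (c j) := fun w => by
    choose c hc using fun j => Ideal.Quotient.mk_surjective (w j)
    exact ⟨c, funext fun j => (hc j).symm⟩
  have hmk0 : ∀ b : k[X], Ideal.Quotient.mk (Ideal.span {l}) b = 0 ↔ l ∣ b := fun b => by
    rw [Ideal.Quotient.eq_zero_iff_mem, Ideal.mem_span_singleton]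
  have hrep : ∀ σ : Γ, ∃ B : Matrix ι ι k[X], (torsionRep hx hΓ σ).1 = B.map (Ideal.Quotient.mk _) ∧
      ∀ j, σ • x j = polyCombination T x fun i => B i j := fun σ => by
    obtain ⟨B, hB⟩ := hx.exists_matrix (f := (σ • ·)) fun y hy => by
      rw [← hΓ, hy, smul_zero]
    exact ⟨B, (torsionRep_eq_iff hx hΓ σ B).2 hB, hB⟩
  obtain ⟨V, x₀, hV, hVT, hx₀, hxV, hsplit, hex⟩ := htv
  have hVb : ∀ (b : k[X]), ∀ y ∈ V, aeval T b y ∈ V := by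
    intro b
    induction b using Polynomial.induction_on' with
    | add p q hp hq =>
      intro y hy
      rw [map_add]
      exact V.add_mem (hp y hy) (hq y hy)
    | monomial n s =>
      intro y hy
      rw [aeval_monomial, Module.End.mul_apply, Module.algebraMap_end_apply]
      refine V.smul_mem _ ?_
      induction n with
      | zero => simpa
      | succ n ih => rw [pow_succ', Module.End.mul_apply]; exact hVT _ ih
  have hx₀V : ∀ b, aeval T b x₀ ∈ V → l ∣ b := by
    intro b hb
    by_contra hlb
    obtain ⟨u, v, huv⟩ := (hl.coprime_iff_not_dvd).2 hlb
    refine hxV ?_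
    have := congrArg (fun p => aeval T p x₀) huv
    simp only [map_add, map_mul, LinearMap.add_apply, Module.End.mul_apply, hx₀, map_zero,
      zero_add, map_one, Module.End.one_apply] at this
    rw [← this]
    exact hVb v _ hb
  choose e he using fun j => hsplit (x j) (hx.mem j)
  have hcomb : ∀ c : ι → k[X],
      polyCombination T x c - aeval T (∑ j, e j * c j) x₀ ∈ V := by
    intro c
    have : polyCombination T x c - aeval T (∑ j, e j * c j) x₀ =
        ∑ j, aeval T (c j) (x j - aeval T (e j) x₀) := by
      simp_rw [mul_comm (e _)]
      simp [polyCombination_apply, LinearMap.sum_apply, Finset.sum_sub_distrib]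
    rw [this]
    exact V.sum_mem fun j _ => hVb _ _ (he j)
  refine eq_top_of_irreducible_of_transvections _ (fun W hW => ?_)
    (fun j => Ideal.Quotient.mk _ (e j)) (fun h0 => hxV ?_) (fun h hh => ?_) hdet
  · let W₀ : Submodule k (ι → k[X]) :=
      { carrier := {c | (fun j => Ideal.Quotient.mk (Ideal.span {l}) (c j)) ∈ W}
        add_mem' := fun {c d} hc hd => W.add_mem hc hd
        zero_mem' := W.zero_mem
        smul_mem' := fun s c hc => by
          have := W.smul_mem (Ideal.Quotient.mk (Ideal.span {l}) (C s)) hc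
          have h1 : (fun j => Ideal.Quotient.mk (Ideal.span {l}) ((s • c) j)) =
              Ideal.Quotient.mk (Ideal.span {l}) (C s) •
                fun j => Ideal.Quotient.mk (Ideal.span {l}) (c j) := by
            ext j
            simp [Polynomial.smul_eq_C_mul]
          rw [Set.mem_ofPred_eq, h1]
          exact this }
    have h0 := hirr (W₀.map (polyCombination T x)) ?_ ?_ ?_
    rotate_left
    · rintro _ ⟨c, -, rfl⟩
      exact hx.aeval_polyCombination c
    · rintro _ ⟨c, hc, rfl⟩
      refine ⟨fun j => X * c j, ?_, by rw [polyCombination_mul, aeval_X]⟩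
      have := W.smul_mem (Ideal.Quotient.mk (Ideal.span {l}) X) hc
      have h1 : (fun j => Ideal.Quotient.mk (Ideal.span {l}) (X * c j)) =
          Ideal.Quotient.mk (Ideal.span {l}) X •
            fun j => Ideal.Quotient.mk (Ideal.span {l}) (c j) := by
        ext j
        simp
      change (fun j => Ideal.Quotient.mk (Ideal.span {l}) (X * c j)) ∈ W
      rw [h1]
      exact this
    · rintro σ _ ⟨c, hc, rfl⟩
      obtain ⟨B, hB, hB'⟩ := hrep σ
      refine ⟨B.mulVec c, ?_, by
        rw [smul_polyCombination hΓ]; exact (polyCombination_mulVec hB' c).symm⟩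
      have := hW _ ⟨σ, rfl⟩ _ hc
      rw [hB] at this
      have h1 : (fun j => Ideal.Quotient.mk (Ideal.span {l}) (B.mulVec c j)) =
          (B.map (Ideal.Quotient.mk (Ideal.span {l}))).mulVec
            fun j => Ideal.Quotient.mk (Ideal.span {l}) (c j) :=
        funext fun j => RingHom.map_mulVec _ _ _ _
      change (fun j => Ideal.Quotient.mk (Ideal.span {l}) (B.mulVec c j)) ∈ W
      rw [h1]
      exact this
    rcases h0 with h1 | h1
    · left
      rw [eq_bot_iff]
      intro w hw
      obtain ⟨c, rfl⟩ := hmk w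
      have : polyCombination T x c ∈ W₀.map (polyCombination T x) := ⟨c, hw, rfl⟩
      rw [h1, Submodule.mem_bot, hx.eq_zero_iff] at this
      rw [Submodule.mem_bot]
      ext j
      exact (hmk0 _).2 (this j)
    · right
      rw [eq_top_iff]
      intro w _
      obtain ⟨c, rfl⟩ := hmk w
      obtain ⟨d, hd, hdc⟩ := h1 _ (hx.aeval_polyCombination c)
      rw [hx.eq_iff] at hdc
      rw [← funext hdc]
      exact hd
  · obtain ⟨c, rfl⟩ := hx.exists_eq hx₀
    have := hcomb c
    have hdvd : aeval T (∑ j, e j * c j) (polyCombination T x c) = 0 := by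
      obtain ⟨d, hd⟩ : l ∣ ∑ j, e j * c j := Finset.dvd_sum fun j _ =>
        ((hmk0 _).1 (congrFun h0 j)).mul_right _
      rw [hd, mul_comm, map_mul, Module.End.mul_apply, hx.aeval_polyCombination, map_zero]
    rwa [hdvd, sub_zero] at this
  · obtain ⟨c, rfl⟩ := hmk h
    have hd : l ∣ ∑ j, e j * c j := by
      rw [← hmk0, map_sum]
      simpa [dotProduct] using hh
    have hy : polyCombination T x c ∈ V := by
      have := hcomb c
      obtain ⟨d, hd⟩ := hd
      rwa [hd, mul_comm, map_mul, Module.End.mul_apply, hx₀, map_zero, sub_zero] at this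
    obtain ⟨σ, hσ, hσV⟩ := hex _ hy
    refine ⟨_, ⟨σ, rfl⟩, ?_⟩
    have : (torsionRep hx hΓ σ).1 = (1 + Matrix.vecMulVec c e).map (Ideal.Quotient.mk _) := by
      rw [torsionRep_eq_iff]
      intro j
      have h1 : (fun i => (1 + Matrix.vecMulVec c e) i j) =
          Pi.single j 1 + fun i => e j * c i := by
        ext1 i
        simp [Matrix.one_apply, Pi.single_apply, Matrix.vecMulVec_apply, mul_comm]
      rw [h1, map_add, polyCombination_single, polyCombination_mul]
      have h2 : x j = (x j - aeval T (e j) x₀) + aeval T (e j) x₀ := by abel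
      rw [h2, smul_add, hσV _ (he j), hΓ, hσ, map_add]
      abel
    rw [this]
    ext i j
    simp [Matrix.one_apply, Matrix.vecMulVec_apply, apply_ite]

end TorsionRepresentation

section TorsionRepresentation

variable {k : Type*} [Field k] {E : Type*} [Field E] [Algebra k E] {T : Module.End k E}
  {ι : Type*} [Fintype ι] {l : k[X]} {x : ι → E}

variable {Γ : Type*} [Group Γ] [DistribMulAction Γ E] [DecidableEq ι]

theorem range_torsionRep_eq_top (hι : 3 ≤ Fintype.card ι) (h2 : (2 : k) ≠ 0) {n : ℕ} (hn : n ≠ 0)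
    (hx : IsTorsionBasis T (l ^ n) x)
    (hΓ : ∀ (σ : Γ) (b : k[X]) (y : E), σ • aeval T b y = aeval T b (σ • y))
    (hlm : l.Monic) (hl : Irreducible l)
    (hfrob : ∀ p : k[X], p.Monic → Irreducible p → p ≠ X → p ≠ l → ∃ σ : Γ, ∀ B : Matrix ι ι k[X],
      (∀ j, σ • x j = polyCombination T x fun i => B i j) → l ^ n ∣ B.det - p)
    (hirr : ∀ W : Submodule k E, (∀ y ∈ W, aeval T l y = 0) → (∀ y ∈ W, T y ∈ W) →
      (∀ σ : Γ, ∀ y ∈ W, σ • y ∈ W) → W = ⊥ ∨ ∀ y, aeval T l y = 0 → y ∈ W)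
    (htv : ∃ (V : Submodule k E) (x₀ : E), (∀ y ∈ V, aeval T l y = 0) ∧ (∀ y ∈ V, T y ∈ V) ∧
      aeval T l x₀ = 0 ∧ x₀ ∉ V ∧ (∀ y, aeval T l y = 0 → ∃ b : k[X], y - aeval T b x₀ ∈ V) ∧
      ∀ y ∈ V, ∃ σ : Γ, σ • x₀ = x₀ + y ∧ ∀ z ∈ V, σ • z = z)
    (hns : ∃ σ : Γ, (∀ y, aeval T l y = 0 → σ • y = y) ∧
      ¬ ∃ b : k[X], ∀ y, aeval T (l ^ 2) y = 0 → σ • y = aeval T b y) :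
    (torsionRep hx hΓ).range = ⊤ := by
  have hι' : Nontrivial ι := Fintype.one_lt_card_iff_nontrivial.1 (by omega)
  obtain ⟨m, rfl⟩ : ∃ m, n = m + 1 := Nat.exists_eq_succ_of_ne_zero hn
  have hl0 : l ≠ 0 := hl.ne_zero
  have hy : IsTorsionBasis T l fun j => aeval T (l ^ m) (x j) :=
    IsTorsionBasis.of_mul (b := l ^ m) (c := l) (by rwa [← pow_succ]) (pow_ne_zero _ hl0) hl0
  have hxy : ∀ (σ : Γ) (B : Matrix ι ι k[X]),
      (∀ j, σ • x j = polyCombination T x fun i => B i j) →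
      ∀ j, σ • aeval T (l ^ m) (x j) =
        polyCombination T (fun j => aeval T (l ^ m) (x j)) fun i => B i j := fun σ B hB j => by
    rw [hΓ, hB, polyCombination_aeval]
  have hrep : ∀ σ : Γ, ∃ B : Matrix ι ι k[X], (∀ j, σ • x j = polyCombination T x fun i => B i j) :=
    fun σ => hx.exists_matrix (f := (σ • ·)) fun y hy => by rw [← hΓ, hy, smul_zero]
  have hfrob' : ∀ p : k[X], p.Monic → Irreducible p → p ≠ X → p ≠ l →
      ∃ σ : Γ, ∀ B : Matrix ι ι k[X], (∀ j, σ • aeval T (l ^ m) (x j) =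
        polyCombination T (fun j => aeval T (l ^ m) (x j)) fun i => B i j) → l ∣ B.det - p := by
    intro p h1 h2 h3 h4
    obtain ⟨σ, hσ⟩ := hfrob p h1 h2 h3 h4
    refine ⟨σ, fun B hB => ?_⟩
    obtain ⟨C, hC⟩ := hrep σ
    have h5 := hy.map_mk_eq (f := (σ • ·)) hB (hxy σ C hC)
    have h6 : l ∣ B.det - C.det := by
      rw [← Ideal.mem_span_singleton, ← Ideal.Quotient.eq, RingHom.map_det, RingHom.map_det]
      exact congrArg Matrix.det h5
    have h7 := dvd_add h6 ((dvd_pow_self l hn).trans (hσ C hC))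
    rwa [sub_add_sub_cancel] at h7
  have hA := range_torsionRep_eq_top_of_irreducible hy hΓ hl hirr htv
    (exists_det_torsionRep_eq hy hΓ hlm hl one_ne_zero (pow_one l).symm hfrob')
  have hmax : (Ideal.span {l}).IsMaximal := PrincipalIdealRing.isMaximal_of_irreducible hl
  letI : Field (k[X] ⧸ Ideal.span {l}) := Ideal.Quotient.field _
  have hle : Ideal.span {l ^ (m + 1)} ≤ Ideal.span {l} :=
    Ideal.span_singleton_le_span_singleton.2 (dvd_pow_self l hn)
  refine eq_top_of_residual_surjective (Ideal.Quotient.factor hle)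
    (Ideal.Quotient.factor_surjective hle) (ϖ := Ideal.Quotient.mk _ l) (n := m + 1)
    (fun s => ?_) ?_ ?_ hι _ (fun g => ?_) (fun hm => ?_)
    (exists_det_torsionRep_eq hx hΓ hlm hl hn rfl hfrob)
  · obtain ⟨b, rfl⟩ := Ideal.Quotient.mk_surjective s
    rw [Ideal.Quotient.factor_mk, Ideal.Quotient.eq_zero_iff_mem, Ideal.mem_span_singleton]
    refine ⟨fun h => map_dvd _ h, ?_⟩
    rintro ⟨s, hs⟩
    obtain ⟨c, rfl⟩ := Ideal.Quotient.mk_surjective s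
    rw [← map_mul, Ideal.Quotient.eq, Ideal.mem_span_singleton] at hs
    exact (dvd_sub_left (dvd_mul_right l c)).1 ((dvd_pow_self l hn).trans hs)
  · rw [← map_pow, Ideal.Quotient.eq_zero_iff_mem, Ideal.mem_span_singleton]
  · intro h
    have : Ideal.Quotient.mk (Ideal.span {l}) (C (2 : k)) = 0 := by
      rw [← h, map_ofNat C 2, map_ofNat]
    rw [Ideal.Quotient.eq_zero_iff_mem, Ideal.mem_span_singleton] at this
    exact hl.not_isUnit (isUnit_of_dvd_unit this (isUnit_C.2 (Ne.isUnit h2)))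
  · obtain ⟨σ, rfl⟩ : g ∈ (torsionRep hy hΓ).range := hA ▸ Subgroup.mem_top g
    obtain ⟨B, hB⟩ := hrep σ
    refine ⟨_, ⟨σ, rfl⟩, ?_⟩
    rw [(torsionRep_eq_iff hx hΓ σ B).2 hB, (torsionRep_eq_iff hy hΓ σ B).2 (hxy σ B hB)]
    rfl
  · obtain ⟨σ, hσ, hσ'⟩ := hns
    obtain ⟨B, hB⟩ := hrep σ
    have h1 : B.map (Ideal.Quotient.mk (Ideal.span {l})) =
        (1 : Matrix ι ι k[X]).map (Ideal.Quotient.mk (Ideal.span {l})) := by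
      refine hy.map_mk_eq (f := (σ • ·)) (hxy σ B hB) fun j => ?_
      rw [hσ _ (hy.mem j)]
      conv_lhs => rw [← polyCombination_single (T := T) (x := fun j => aeval T (l ^ m) (x j)) j]
      congr 1
      ext1 i
      simp [Matrix.one_apply, Pi.single_apply]
    have h3 : ∀ i j, ∃ d, B i j = (1 : Matrix ι ι k[X]) i j + l * d := fun i j => by
      have := congrFun (congrFun h1 i) j
      rw [Matrix.map_apply, Matrix.map_apply, Ideal.Quotient.eq, Ideal.mem_span_singleton] at this
      obtain ⟨d, hd⟩ := this
      exact ⟨d, by rw [← hd]; ring⟩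
    choose Y hY using h3
    refine ⟨_, ⟨σ, rfl⟩, (Matrix.of Y).map (Ideal.Quotient.mk _), ?_, fun c hc => hσ' ?_⟩
    · rw [(torsionRep_eq_iff hx hΓ σ B).2 hB]
      ext i j
      rw [Matrix.map_apply, hY, map_add, map_mul]
      by_cases hij : i = j <;> simp [Matrix.one_apply, hij]
    · obtain ⟨b, rfl⟩ := Ideal.Quotient.mk_surjective c
      have h4 : ∀ i j, ∃ d, Y i j = Matrix.scalar ι b i j + l * d := fun i j => by
        have := congrFun (congrFun hc i) j
        rw [Matrix.map_apply, Matrix.map_apply, Matrix.of_apply, Ideal.Quotient.factor_mk] at this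
        have h5 : Matrix.scalar ι (Ideal.Quotient.mk (Ideal.span {l}) b) i j =
            Ideal.Quotient.mk (Ideal.span {l}) (Matrix.scalar ι b i j) := by
          by_cases hij : i = j <;> simp [hij]
        rw [h5, Ideal.Quotient.eq, Ideal.mem_span_singleton] at this
        obtain ⟨d, hd⟩ := this
        exact ⟨d, by rw [← hd]; ring⟩
      choose Z hZ using h4
      refine ⟨1 + l * b, fun z hz => ?_⟩
      obtain ⟨q, rfl⟩ := Nat.exists_eq_add_of_le' (show 1 ≤ m by omega)
      obtain ⟨c, rfl⟩ := hx.exists_eq (y := z) (by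
        rw [show l ^ (q + 1 + 1) = l ^ q * l ^ 2 by ring, map_mul, Module.End.mul_apply, hz,
          map_zero])
      rw [← polyCombination_mul, hx.eq_zero_iff] at hz
      have h5 : ∀ j, l ^ q ∣ c j := fun j => by
        have := hz j
        rw [show l ^ (q + 1 + 1) = l ^ 2 * l ^ q by ring] at this
        exact (mul_dvd_mul_iff_left (pow_ne_zero 2 hl0)).1 this
      rw [smul_polyCombination hΓ, polyCombination_mulVec hB, ← polyCombination_mul, hx.eq_iff]
      intro i
      rw [Ideal.Quotient.eq, Ideal.mem_span_singleton]
      have h6 : B.mulVec c i - (1 + l * b) * c i = ∑ j, l ^ 2 * Z i j * c j := by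
        have : (1 + l * b) * c i = ∑ j, ((1 : Matrix ι ι k[X]) i j +
            l * Matrix.scalar ι b i j) * c j := by
          simp [Matrix.one_apply, Matrix.diagonal_apply, add_mul, Finset.sum_add_distrib]
        rw [this, Matrix.mulVec, dotProduct, ← Finset.sum_sub_distrib]
        refine Finset.sum_congr rfl fun j _ => ?_
        rw [hY, hZ]
        ring
      rw [h6]
      refine Finset.dvd_sum fun j _ => ?_
      rw [show l ^ (q + 1 + 1) = l ^ 2 * l ^ q by ring]
      exact mul_dvd_mul (dvd_mul_right _ _) (h5 j)

end TorsionRepresentation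

section

variable {Fq : Type} [Field Fq] [Fintype Fq] {K : Type} [Field K] [Algebra Fq K] {t : K}
  {Ω : Type} [Field Ω] [Algebra K Ω] [Algebra Fq Ω] [IsScalarTower Fq K Ω] [IsAlgClosure K Ω]

theorem exists_algEquiv_eq_of_bijOn (h : IsRationalFunctionField Fq t) {r : ℕ} (hrp : r.Prime)
    (hr : 3 ≤ r) (hq : 3 ≤ Fintype.card Fq) (h2 : (2 : Fq) ≠ 0) {l : Fq[X]} (hlm : l.Monic)
    (hl : Irreducible l) {n : ℕ} (hn : n ≠ 0) {g : Ω → Ω}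
    (hbij : Set.BijOn g (drinfeldTorsion r (algebraMap K Ω t) (l ^ n))
      (drinfeldTorsion r (algebraMap K Ω t) (l ^ n)))
    (hadd : ∀ x ∈ drinfeldTorsion r (algebraMap K Ω t) (l ^ n),
      ∀ y ∈ drinfeldTorsion r (algebraMap K Ω t) (l ^ n), g (x + y) = g x + g y)
    (hsmul : ∀ b : Fq[X], ∀ x ∈ drinfeldTorsion r (algebraMap K Ω t) (l ^ n),
      g (aeval (drinfeldT Fq r (algebraMap K Ω t)) b x) =
        aeval (drinfeldT Fq r (algebraMap K Ω t)) b (g x)) :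
    ∃ σ : Ω ≃ₐ[K] Ω, ∀ x ∈ drinfeldTorsion r (algebraMap K Ω t) (l ^ n), σ x = g x := by
  obtain ⟨E, _, _, _, _, i, H⟩ := exists_isTorsionField (Ω := Ω) h (r := r) (by omega)
    (pow_ne_zero n hl.ne_zero)
  obtain ⟨x, hx, hfrob⟩ := H.exists_isTorsionBasis h (hrp.odd_of_ne_two (by omega)) hr hlm hl hn rfl
  obtain ⟨E₁, _, _, _, _, i₁, H₁⟩ := exists_isTorsionField (Ω := Ω) h (r := r) (by omega)
    hl.ne_zero
  obtain ⟨E₂, _, _, _, _, i₂, H₂⟩ := exists_isTorsionField (Ω := Ω) h (r := r) (by omega)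
    (pow_ne_zero 2 hl.ne_zero)
  have hΓ : ∀ (σ : Ω ≃ₐ[K] Ω) (b : Fq[X]) (y : Ω),
      σ • aeval (drinfeldT Fq r (algebraMap K Ω t)) b y =
        aeval (drinfeldT Fq r (algebraMap K Ω t)) b (σ • y) := fun σ b y =>
    map_aeval_drinfeldT_algebraMap σ.toAlgHom b y
  have htop : (torsionRep hx hΓ).range = ⊤ :=
    range_torsionRep_eq_top (by simpa) h2 hn hx hΓ hlm hl hfrob
      (fun W h1 h3 h4 => (H₁.eq_bot_or_eq h hq hr hrp hlm hl h1 h3 h4).imp_right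
        fun h5 y hy => by rw [h5]; exact hy)
      (H₁.exists_transvections h (by omega) hlm hl) (H₂.exists_nonscalar h hr hlm hl rfl)
  set T := drinfeldT Fq r (algebraMap K Ω t) with hT
  have hg : ∀ y : Fin r → Ω, (∀ j, aeval T (l ^ n) (y j) = 0) → ∀ c : Fin r → Fq[X],
      g (polyCombination T y c) = polyCombination T (fun j => g (y j)) c := by
    intro y hy c
    have hmem : ∀ s : Finset (Fin r), ∑ j ∈ s, aeval T (c j) (y j) ∈
        drinfeldTorsion r (algebraMap K Ω t) (l ^ n) := fun s =>
      Submodule.sum_mem _ fun j _ => aeval_mem_drinfeldTorsion _ (hy j)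
    have h0 : g 0 = 0 := by
      have := hadd 0 (zero_mem _) 0 (zero_mem _)
      simpa using this
    rw [polyCombination_apply, polyCombination_apply]
    generalize (Finset.univ : Finset (Fin r)) = s
    induction s using Finset.induction_on with
    | empty => simpa
    | insert j s hj ih =>
      rw [Finset.sum_insert hj, Finset.sum_insert hj,
        hadd _ (aeval_mem_drinfeldTorsion _ (hy j)) _ (hmem s), ih, hsmul _ _ (hy j)]
  obtain ⟨B, hB⟩ := hx.exists_matrix (f := g) fun y hy => hbij.mapsTo hy
  choose y hy hyx using fun j => hbij.surjOn (show x j ∈ _ from hx.mem j)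
  choose C hC using fun j => hx.exists_eq (hy j)
  have hBC : B.map (Ideal.Quotient.mk (Ideal.span {l ^ n})) *
      (Matrix.of fun i j => C j i).map (Ideal.Quotient.mk (Ideal.span {l ^ n})) = 1 := by
    rw [← Matrix.map_mul, ← Matrix.map_one (Ideal.Quotient.mk (Ideal.span {l ^ n})) (map_zero _)
      (map_one _)]
    refine hx.map_mk_eq (f := id) (fun j => ?_) fun j => ?_
    · change x j = polyCombination T x (B.mulVec (C j))
      rw [← polyCombination_mulVec hB, ← hg x hx.mem, ← hC, hyx]
    · rw [id, ← polyCombination_single (T := T) (x := x) j]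
      congr 1
      ext1 i
      simp [Matrix.one_apply, Pi.single_apply]
  obtain ⟨σ, hσ⟩ : (⟨_, _, hBC, mul_eq_one_comm.1 hBC⟩ : GL (Fin r) _) ∈
    (torsionRep hx hΓ).range := htop ▸ Subgroup.mem_top _
  have hσB := (torsionRep_eq_iff hx hΓ σ B).1 (congrArg Units.val hσ)
  refine ⟨σ, fun z hz => ?_⟩
  obtain ⟨c, rfl⟩ := hx.exists_eq hz
  rw [← AlgEquiv.smul_def, smul_polyCombination hΓ, hg x hx.mem]
  congr 1
  exact congrArg _ (funext fun j => (hσB j).trans (hB j).symm)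

end

theorem aeval_drinfeldT_eq_of_isDrinfeldPhi {Fq : Type} [Field Fq] [Fintype Fq] {r : ℕ}
    {φ : Fq[X] →+* AddMonoid.End (Kbar Fq)} (hφ : IsDrinfeldPhi Fq (Fintype.card Fq) r φ)
    (b : Fq[X]) (x : Kbar Fq) :
    aeval (drinfeldT Fq r (algebraMap (RatFunc Fq) (Kbar Fq) RatFunc.X)) b x = φ b x := by
  have h : ∀ (c : Fq) (x : Kbar Fq), φ (C c) x = c • x := fun c x => by
    rw [hφ.1, Algebra.smul_def, IsScalarTower.algebraMap_apply Fq (RatFunc Fq) (Kbar Fq),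
      RatFunc.algebraMap_eq_C]
  induction b using Polynomial.induction_on' with
  | add p s hp hs => rw [map_add, LinearMap.add_apply, hp, hs, map_add]; rfl
  | monomial n c =>
    rw [aeval_monomial, Module.End.mul_apply, Module.algebraMap_end_apply,
      ← C_mul_X_pow_eq_monomial, map_mul, AddMonoid.End.coe_mul, Function.comp_apply, h]
    congr 1
    induction n with
    | zero => simp
    | succ n ih =>
      rw [pow_succ', pow_succ', map_mul, AddMonoid.End.coe_mul, Function.comp_apply, Module.End.mul_apply, ih,
        drinfeldT_apply, hφ.2]

/-- `𝔩`-adic surjectivity: there is `c = c(r)` such that for `p > c`, for every nonzero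
prime `𝔩 = (l)` of `A` and every `n ≥ 1`, every `A/𝔩^n`-module automorphism of `φ[𝔩^n]`
is the restriction of some `σ ∈ Gal(F̄/F)`. -/
theorem ladic_galois_representation_surjective (r : ℕ) (hr : r.Prime) (hr3 : 3 ≤ r) :
    ∃ c : ℕ, ∀ (p e q : ℕ), p.Prime → 5 ≤ p → c < p → 0 < e → q = p ^ e →
    ∀ (Fq : Type) [Field Fq] [Fintype Fq], Fintype.card Fq = q →
    ∀ φ : Polynomial Fq →+* AddMonoid.End (Kbar Fq), IsDrinfeldPhi Fq q r φ →
    ∀ l : Polynomial Fq, l.Monic → Irreducible l →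
    ∀ n : ℕ, 1 ≤ n →
    ∀ g : Kbar Fq → Kbar Fq, IsTorsionAut Fq φ (l ^ n) g →
    ∃ σ : Kbar Fq ≃ₐ[RatFunc Fq] Kbar Fq, ∀ x ∈ phiTorsion Fq φ (l ^ n), σ x = g x := by
  refine ⟨0, ?_⟩
  rintro p e _ hp h5 - he rfl Fq _ _ hcard φ hφ l hlm hl n hn g ⟨hbij, hadd, hsmul⟩
  rw [← hcard] at hφ
  have hφ' := aeval_drinfeldT_eq_of_isDrinfeldPhi hφ
  have htor : phiTorsion Fq φ (l ^ n) =
      drinfeldTorsion r (algebraMap (RatFunc Fq) (Kbar Fq) RatFunc.X) (l ^ n) := by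
    ext x
    change φ (l ^ n) x = 0 ↔ aeval (drinfeldT Fq r _) (l ^ n) x = 0
    rw [hφ']
  have hq : 5 ≤ Fintype.card Fq := by
    rw [hcard]
    exact h5.trans (Nat.le_self_pow he.ne' p)
  have h2 : (2 : Fq) ≠ 0 := by
    intro h2
    have : Fact p.Prime := ⟨hp⟩
    have : CharP Fq p := charP_of_card_eq_prime_pow hcard
    have := (CharP.cast_eq_zero_iff Fq p 2).1 (by exact_mod_cast h2)
    exact absurd (Nat.le_of_dvd two_pos this) (by omega)
  rw [htor] at hbij hadd hsmul ⊢
  exact exists_algEquiv_eq_of_bijOn IsRationalFunctionField.ratFunc hr hr3 (by omega) h2 hlm hl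
    (by omega) hbij hadd fun b x hx => by rw [hφ', hφ']; exact hsmul b x hx
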